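/- arXiv:0707.2262 — 4 statements merged into one kernel-verified Lean document; each statement's English description precedes it below -/
import Mathlib

section
/- Let K be a finitely generated normal subgroup of a finitely generated group Γ, with finite generating sets S_K of K and S_Γ of Γ. Let m ≥ 1, let ρ : Γ → GL(m, ℤ) be a group homomorphism, and let ψ : K → ℤ^m be a surjective group homomorphism satisfying ψ(x y x⁻¹) = ρ(x) · ψ(y) for all x ∈ Γ and y ∈ K. Suppose there is a nonzero subgroup W ≤ ℤ^m with ρ(g) · W ⊆ W for all g ∈ Γ such that: (i) for every nonzero subgroup W' ≤ W with ρ(g) · W' ⊆ W' for all g ∈ Γ, the ℝ-span of W' equals the ℝ-span of W; and (ii) the image of Γ under the induced action Γ → GL(W) is infinite. Then there exist x ∈ Γ, y ∈ K, and real constants a > 0 and λ > 1 such that ‖xⁿ y x⁻ⁿ‖_{S_K} ≥ a λⁿ for all n ≥ 1; in particular K is at least exponentially distorted in Γ. -/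
/-- The word length of `g` with respect to a generating set `S`. -/
noncomputable def wordLength {G : Type*} [Group G] (S : Set G) (g : G) : ℕ :=
  sInf {n | ∃ l : List G, l.length = n ∧ (∀ x ∈ l, x ∈ S ∨ x⁻¹ ∈ S) ∧ l.prod = g}

open Polynomial Module

/-- An endomorphism all of whose positive powers are traceless fixes no nonzero vector. -/
theorem eq_zero_of_apply_eq_self_of_trace_pow_eq_zero {F V : Type*} [Field F] [CharZero F]
    [AddCommGroup V] [Module F V] [FiniteDimensional F V] (c : End F V)
    (hc : ∀ k : ℕ, LinearMap.trace F V (c ^ (k + 1)) = 0) {v : V} (hv : c v = v) : v = 0 := by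
  obtain ⟨r, hr, hr1⟩ := (c.charpoly).exists_eq_pow_rootMultiplicity_mul_and_not_dvd
    c.charpoly_monic.ne_zero 1
  set e := c.charpoly.rootMultiplicity 1
  have hcop : IsCoprime (X * r) ((X - C (1 : F)) ^ e) := by
    refine IsCoprime.pow_right (IsCoprime.mul_left ?_ ?_)
    · exact ⟨1, -1, by simp⟩
    · exact ((irreducible_X_sub_C (1 : F)).coprime_iff_not_dvd.mpr hr1).symm
  obtain ⟨s, t, hst⟩ := hcop
  have hzero : ∀ q : F[X], aeval c (c.charpoly * q) = 0 := fun q => by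
    rw [map_mul, LinearMap.aeval_self_charpoly, zero_mul]
  have hidem : IsIdempotentElem (aeval c (s * (X * r))) := by
    have h : s * (X * r) * (s * (X * r)) - s * (X * r) = c.charpoly * (-(s * X * t)) := by
      rw [hr, mul_comm ((X - C (1 : F)) ^ e)]
      linear_combination (s * (X * r)) * hst
    have := hzero (-(s * X * t))
    rw [← h, map_sub, map_mul, sub_eq_zero] at this
    exact this
  have htr : ∀ q : F[X], LinearMap.trace F V (aeval c (X * q)) = 0 := by
    intro q
    induction q using Polynomial.induction_on' with
    | add p q hp hq => rw [mul_add, map_add, map_add, hp, hq, add_zero]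
    | monomial n a =>
      rw [X_mul_monomial, aeval_monomial, ← Algebra.smul_def, map_smul, hc, smul_zero]
  have hp0 : aeval c (s * (X * r)) = 0 := by
    have h := (LinearMap.IsIdempotentElem.isProj_range _ hidem).trace
    rw [mul_left_comm, htr] at h
    have h' := Nat.cast_eq_zero.mp h.symm
    rw [← mul_left_comm] at h'
    exact LinearMap.range_eq_bot.mp (Submodule.finrank_eq_zero.mp h')
  by_contra hv0
  have hvec : c.HasEigenvector 1 v := by
    rw [End.hasEigenvector_iff, End.mem_eigenspace_iff]
    exact ⟨by simpa using hv, hv0⟩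
  have he : e ≠ 0 := by
    have : c.charpoly.IsRoot 1 :=
      (End.hasEigenvalue_iff_isRoot_charpoly c 1).mp (End.hasEigenvalue_of_hasEigenvector hvec)
    exact ((rootMultiplicity_pos c.charpoly_monic.ne_zero).mpr this).ne'
  have h1 := End.aeval_apply_of_hasEigenvector (p := s * (X * r)) hvec
  have h2 := congrArg (eval 1) hst
  simp [he] at h2
  rw [hp0, LinearMap.zero_apply, eq_comm, smul_eq_zero, or_iff_left hv0] at h1
  simp at h1
  rcases h1 with h | h <;> simp [h] at h2

/-- An irreducible linear representation in characteristic zero whose character takes finitely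
many values has finite image. -/
theorem finite_range_of_irreducible_of_finite_trace {G F V : Type*} [Monoid G] [Field F]
    [CharZero F] [AddCommGroup V] [Module F V] [FiniteDimensional F V] (σ : G →* End F V)
    (hirr : ∀ U : Submodule F V, U ≠ ⊥ → (∀ g, ∀ u ∈ U, σ g u ∈ U) → U = ⊤)
    (hfin : (Set.range fun g => LinearMap.trace F V (σ g)).Finite) : (Set.range σ).Finite := by
  set A : Subalgebra F (End F V) := Algebra.adjoin F (Set.range σ)
  have hA : Subalgebra.toSubmodule A = Submodule.span F (Set.range σ) := by
    have h := Algebra.adjoin_eq_span F (Set.range σ)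
    rwa [← MonoidHom.coe_mrange, Submonoid.closure_eq, MonoidHom.coe_mrange] at h
  have hσA : ∀ g, σ g ∈ A := fun g => Algebra.subset_adjoin ⟨g, rfl⟩
  have hnd : ∀ x ∈ A, (∀ a ∈ A, LinearMap.trace F V (x * a) = 0) → x = 0 := by
    intro x hx h
    ext w
    by_contra hw
    have htop := hirr ((Subalgebra.toSubmodule A).map (LinearMap.applyₗ (x w))) ?_ ?_
    · obtain ⟨a, ha, haw⟩ := Submodule.mem_map.mp (htop ▸ Submodule.mem_top (x := w))
      refine hw (eq_zero_of_apply_eq_self_of_trace_pow_eq_zero (x * a) (fun k => ?_)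
        (v := x w) ?_)
      · rw [pow_succ', mul_assoc]
        exact h _ (A.mul_mem ha (A.pow_mem (A.mul_mem hx ha) k))
      · exact congrArg x haw
    · refine (Submodule.ne_bot_iff _).mpr ⟨x w, Submodule.mem_map.mpr ⟨1, A.one_mem, rfl⟩, hw⟩
    · rintro g _ ⟨a, ha, rfl⟩
      exact Submodule.mem_map.mpr ⟨σ g * a, A.mul_mem (hσA g) ha, rfl⟩
  obtain ⟨t, ht, -, hspan, -⟩ := Submodule.exists_finset_span_eq_linearIndepOn F (Set.range σ)
  refine Set.Finite.of_finite_image (f := fun x (b : t) => LinearMap.trace F V (x * b)) ?_ ?_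
  · refine (Set.Finite.pi' (fun _ : t => hfin)).subset ?_
    rintro _ ⟨_, ⟨g, rfl⟩, rfl⟩ ⟨b, hb⟩
    obtain ⟨h, rfl⟩ := ht hb
    exact ⟨g * h, by simp⟩
  · rintro _ ⟨g, rfl⟩ _ ⟨h, rfl⟩ heq
    refine sub_eq_zero.mp (hnd _ (A.sub_mem (hσA g) (hσA h)) fun a ha => ?_)
    replace ha : a ∈ Submodule.span F (t : Set (End F V)) := by
      rw [hspan, ← hA]; exact ha
    induction ha using Submodule.span_induction with
    | mem b hb =>
      have := congrFun heq ⟨b, hb⟩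
      simpa [sub_mul, sub_eq_zero] using this
    | zero => simp
    | add _ _ _ _ h1 h2 => rw [mul_add, map_add, h1, h2, add_zero]
    | smul c _ _ h1 => rw [mul_smul_comm, map_smul, h1, smul_zero]

/-- The trace of a rational endomorphism annihilated by a monic integer polynomial with roots in
the closed unit disc is an integer bounded by the dimension. -/
theorem exists_int_trace_eq_of_aeval_eq_zero {V : Type*} [AddCommGroup V] [Module ℚ V]
    [FiniteDimensional ℚ V] (f : End ℚ V) (p : ℤ[X]) (hp : p.Monic) (hf : aeval f p = 0)
    (hroot : ∀ z : ℂ, aeval z p = 0 → ‖z‖ ≤ 1) :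
    ∃ n ∈ Set.Icc (-(finrank ℚ V : ℤ)) (finrank ℚ V), (n : ℚ) = LinearMap.trace ℚ V f := by
  set f' : End ℂ (TensorProduct ℚ ℂ V) := LinearMap.baseChange ℂ f
  have hf' : aeval f' p = 0 := by
    have h := aeval_algHom_apply ((Module.End.baseChangeHom ℚ ℂ V).toRingHom.toIntAlgHom) f p
    rw [hf, map_zero] at h
    exact h
  have hz : ∀ z ∈ f'.charpoly.roots, aeval z p = 0 := by
    intro z hz
    have hz' := (End.hasEigenvalue_iff_isRoot_charpoly f' z).mpr (isRoot_of_mem_roots hz)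
    obtain ⟨v, hv⟩ := hz'.exists_hasEigenvector
    have h := End.aeval_apply_of_hasEigenvector (p := p.map (algebraMap ℤ ℂ)) hv
    rw [aeval_map_algebraMap, hf', eval_map_algebraMap] at h
    simpa [hv.2] using h.symm
  have htr : ((LinearMap.trace ℚ V f : ℚ) : ℂ) = f'.charpoly.roots.sum := by
    rw [← End.trace_eq_sum_roots_charpoly_of_splits (IsAlgClosed.splits _)]
    exact (LinearMap.trace_baseChange f ℂ).symm
  have hint : IsIntegral ℤ (LinearMap.trace ℚ V f) := by
    rw [← isIntegral_algebraMap_iff (algebraMap ℚ ℂ).injective]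
    rw [eq_ratCast, htr]
    exact IsIntegral.multiset_sum fun z h => ⟨p, hp, hz z h⟩
  obtain ⟨n, hn⟩ := IsIntegrallyClosed.isIntegral_iff.mp hint
  refine ⟨n, ?_, by simpa using hn⟩
  rw [← hn] at htr
  have hb : ‖(n : ℂ)‖ ≤ finrank ℚ V := by
    have h1 : ‖f'.charpoly.roots.sum‖ ≤ (f'.charpoly.roots.map fun z => ‖z‖).sum :=
      norm_multiset_sum_le _
    have h2 : (f'.charpoly.roots.map fun z => ‖z‖).sum ≤
        (f'.charpoly.roots.map fun z => ‖z‖).card • (1 : ℝ) := by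
      refine Multiset.sum_le_card_nsmul _ _ fun x hx => ?_
      obtain ⟨z, h, rfl⟩ := Multiset.mem_map.mp hx
      exact hroot z (hz z h)
    have h3 : f'.charpoly.roots.card ≤ finrank ℚ V := by
      refine (card_roots' _).trans ?_
      rw [LinearMap.charpoly_natDegree, Module.finrank_baseChange]
    have h4 : (f'.charpoly.roots.card : ℝ) ≤ finrank ℚ V := by exact_mod_cast h3
    simp at htr
    rw [htr]
    simp at h2
    linarith
  rw [Complex.norm_intCast] at hb
  rw [Set.mem_Icc, ← abs_le]
  exact_mod_cast hb

/-- Polynomials in a linear map commute with intertwining operators. -/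
theorem aeval_apply_of_intertwines {V V' : Type*} [AddCommGroup V] [Module ℚ V]
    [AddCommGroup V'] [Module ℚ V'] (ι : V →ₗ[ℚ] V') (f : End ℚ V) (f' : End ℚ V')
    (h : ∀ v, ι (f v) = f' (ι v)) (p : ℤ[X]) (v : V) :
    ι (aeval f p v) = aeval f' p (ι v) := by
  have hpow : ∀ n : ℕ, ∀ v, ι ((f ^ n) v) = (f' ^ n) (ι v) := by
    intro n
    induction n with
    | zero => simp
    | succ n ih => intro v; rw [pow_succ, pow_succ]; simp [ih, h]
  induction p using Polynomial.induction_on' with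
  | add p q hp hq => simp [hp, hq]
  | monomial n a => simp [aeval_monomial, hpow]

/-- A homomorphism to a normed group is bounded by a multiple of the word length. -/
theorem exists_norm_le_mul_wordLength {G E : Type*} [Group G] [SeminormedAddCommGroup E]
    (S : Finset G) (hS : Subgroup.closure (S : Set G) = ⊤) (φ : G → E)
    (hφ : ∀ a b, φ (a * b) = φ a + φ b) :
    ∃ C : ℝ, 0 < C ∧ ∀ g, ‖φ g‖ ≤ C * wordLength (S : Set G) g := by
  have h1 : φ 1 = 0 := by simpa using hφ 1 1
  have hinv : ∀ g, φ g⁻¹ = -φ g := fun g => by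
    have := hφ g⁻¹ g
    rw [inv_mul_cancel, h1] at this
    exact eq_neg_of_add_eq_zero_left this.symm
  refine ⟨1 + ∑ s ∈ S, ‖φ s‖, by positivity, fun g => ?_⟩
  have hne : {n | ∃ l : List G, l.length = n ∧
      (∀ x ∈ l, x ∈ (S : Set G) ∨ x⁻¹ ∈ (S : Set G)) ∧ l.prod = g}.Nonempty := by
    have hmem : g ∈ (Subgroup.closure (S : Set G)).toSubmonoid := hS ▸ Subgroup.mem_top g
    rw [Subgroup.closure_toSubmonoid] at hmem
    obtain ⟨l, hl, hg⟩ := Submonoid.exists_list_of_mem_closure hmem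
    exact ⟨_, l, rfl, hl, hg⟩
  obtain ⟨l, hlen, hl, hg⟩ := Nat.sInf_mem hne
  rw [wordLength, ← hlen, ← hg]
  clear hlen hg hne
  have hle : ∀ s ∈ S, ‖φ s‖ ≤ 1 + ∑ s ∈ S, ‖φ s‖ := fun s hs =>
    (Finset.single_le_sum (f := fun s => ‖φ s‖) (fun _ _ => norm_nonneg _) hs).trans (by simp)
  induction l with
  | nil => simp [h1]
  | cons x l ih =>
    have hx : ‖φ x‖ ≤ 1 + ∑ s ∈ S, ‖φ s‖ := by
      rcases hl x (by simp) with h | h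
      · exact hle x h
      · simpa [hinv] using hle _ h
    have := ih fun y hy => hl y (by simp [hy])
    rw [List.prod_cons, hφ, List.length_cons]
    push_cast
    linarith [norm_add_le (φ x) (φ l.prod)]

/-- Every element of the rational span of an additive subgroup has a nonzero integer multiple in
the subgroup. -/
theorem exists_smul_mem_of_mem_span {M : Type*} [AddCommGroup M] [Module ℚ M] (H : AddSubgroup M)
    {x : M} (hx : x ∈ Submodule.span ℚ (H : Set M)) : ∃ n : ℤ, n ≠ 0 ∧ n • x ∈ H := by
  induction hx using Submodule.span_induction with
  | mem x hx => exact ⟨1, one_ne_zero, by simpa using hx⟩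
  | zero => exact ⟨1, one_ne_zero, by simp⟩
  | add x y _ _ hx hy =>
    obtain ⟨a, ha, hax⟩ := hx
    obtain ⟨b, hb, hby⟩ := hy
    refine ⟨a * b, mul_ne_zero ha hb, ?_⟩
    rw [smul_add, mul_smul a b y, mul_comm, mul_smul, smul_comm a b y]
    exact H.add_mem (H.zsmul_mem hax b) (by rw [smul_comm]; exact H.zsmul_mem hby a)
  | smul q x _ hx =>
    obtain ⟨a, ha, hax⟩ := hx
    refine ⟨q.den * a, mul_ne_zero (by exact_mod_cast q.den_nz) ha, ?_⟩
    have h : ((q.den : ℤ) * a) • q • x = q.num • a • x := by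
      simp only [← Int.cast_smul_eq_zsmul ℚ, smul_smul]
      congr 1
      push_cast
      linear_combination (a : ℚ) * Rat.den_mul_eq_num q
    rw [h]
    exact H.zsmul_mem hax _

/-- The inclusion of the integer lattice into rational coordinate space. -/
def latticeInclusion (m : ℕ) : (Fin m → ℤ) →+ (Fin m → ℚ) where
  toFun v i := v i
  map_zero' := by ext; simp
  map_add' v w := by ext; simp

theorem latticeInclusion_injective (m : ℕ) : Function.Injective (latticeInclusion m) := by
  intro v w h
  ext i
  exact Int.cast_injective (congrFun h i)

/-- A lattice vector whose real coordinates lie in the real span of a set of lattice vectors lies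
in every rational subspace containing that set. -/
theorem latticeInclusion_mem_of_mem_real_span {m : ℕ} (U : Submodule ℚ (Fin m → ℚ))
    (T : Set (Fin m → ℤ)) (hT : ∀ v ∈ T, latticeInclusion m v ∈ U) (w : Fin m → ℤ)
    (hw : (fun i => (w i : ℝ)) ∈
      Submodule.span ℝ ((fun v : Fin m → ℤ => fun i => (v i : ℝ)) '' T)) :
    latticeInclusion m w ∈ U := by
  by_contra hwU
  obtain ⟨φ, hφw, hφU⟩ := Submodule.exists_le_ker_of_notMem hwU
  set Φ : (Fin m → ℝ) →ₗ[ℝ] ℝ :=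
    Fintype.linearCombination ℝ fun i => ((φ (Pi.single i 1) : ℚ) : ℝ)
  have hΦ : ∀ v : Fin m → ℤ, Φ (fun i => (v i : ℝ)) = (φ (latticeInclusion m v) : ℚ) := by
    intro v
    have hs : ∀ i : Fin m, (fun j => if i = j then 1 else 0 : Fin m → ℚ) = Pi.single i 1 := by
      intro i
      ext j
      simp [Pi.single_apply, eq_comm]
    rw [LinearMap.pi_apply_eq_sum_univ φ, Fintype.linearCombination_apply]
    simp [latticeInclusion, hs]
  have hle : Submodule.span ℝ ((fun v : Fin m → ℤ => fun i => (v i : ℝ)) '' T) ≤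
      LinearMap.ker Φ := by
    rw [Submodule.span_le]
    rintro _ ⟨v, hv, rfl⟩
    have := hΦ v
    rw [LinearMap.mem_ker.mp (hφU (hT v hv))] at this
    simpa using this
  have h0 := hΦ w
  rw [LinearMap.mem_ker.mp (hle hw)] at h0
  exact hφw (by exact_mod_cast h0.symm)

/-- The action of an integer matrix on rational coordinate space. -/
noncomputable def rationalAction (m : ℕ) : Matrix (Fin m) (Fin m) ℤ →+* End ℚ (Fin m → ℚ) :=
  (Matrix.toLinAlgEquiv' : Matrix (Fin m) (Fin m) ℚ ≃ₐ[ℚ] _).toRingEquiv.toRingHom.comp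
    (Int.castRingHom ℚ).mapMatrix

theorem rationalAction_latticeInclusion {m : ℕ} (M : Matrix (Fin m) (Fin m) ℤ) (v : Fin m → ℤ) :
    rationalAction m M (latticeInclusion m v) = latticeInclusion m (M.mulVec v) := by
  ext i
  simp [rationalAction, latticeInclusion, Matrix.mulVec, dotProduct]

/-- A group of integer matrices with all eigenvalues in the closed unit disc acts with finite image
on every rationally irreducible invariant lattice. -/
theorem finite_range_mulVec_of_norm_eigenvalue_le_one {Γ : Type*} [Monoid Γ] {m : ℕ}
    (ρ : Γ →* Matrix (Fin m) (Fin m) ℤ) (W : AddSubgroup (Fin m → ℤ))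
    (hW_inv : ∀ (g : Γ) (w : Fin m → ℤ), w ∈ W → (ρ g).mulVec w ∈ W)
    (hirr : ∀ W' : AddSubgroup (Fin m → ℤ), W' ≤ W → W' ≠ ⊥ →
      (∀ (g : Γ) (w : Fin m → ℤ), w ∈ W' → (ρ g).mulVec w ∈ W') →
      Submodule.span ℝ ((fun v : Fin m → ℤ => fun i => (v i : ℝ)) '' (W' : Set (Fin m → ℤ)))
        = Submodule.span ℝ ((fun v : Fin m → ℤ => fun i => (v i : ℝ)) '' (W : Set (Fin m → ℤ))))
    (hroot : ∀ (g : Γ) (z : ℂ), aeval z (ρ g).charpoly = 0 → ‖z‖ ≤ 1) :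
    (Set.range fun g : Γ =>
      fun w : W => (⟨(ρ g).mulVec w.1, hW_inv g w.1 w.2⟩ : W)).Finite := by
  set V : Submodule ℚ (Fin m → ℚ) :=
    Submodule.span ℚ (W.map (latticeInclusion m) : Set (Fin m → ℚ)) with hV
  have hWV : ∀ w ∈ W, latticeInclusion m w ∈ V := fun w hw =>
    Submodule.subset_span (AddSubgroup.mem_map_of_mem _ hw)
  have hV_inv : ∀ g, ∀ v ∈ V, rationalAction m (ρ g) v ∈ V := by
    intro g
    change V ≤ V.comap (rationalAction m (ρ g))
    rw [hV, Submodule.span_le]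
    rintro _ ⟨w, hw, rfl⟩
    change rationalAction m (ρ g) (latticeInclusion m w) ∈ V
    rw [rationalAction_latticeInclusion]
    exact hWV _ (hW_inv g w hw)
  set σ : Γ →* End ℚ V :=
    { toFun g := (rationalAction m (ρ g)).restrict (hV_inv g)
      map_one' := by ext; simp
      map_mul' g h := by ext; simp }
  have hσ_apply : ∀ g (v : V), (σ g v : Fin m → ℚ) = rationalAction m (ρ g) v := fun _ _ => rfl
  have hfin : (Set.range σ).Finite := by
    refine finite_range_of_irreducible_of_finite_trace σ (fun U hU hU_inv => ?_) ?_
    · have hmemU : ∀ v : V, (v : Fin m → ℚ) ∈ U.map V.subtype ↔ v ∈ U := fun v => by simp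
      set W' : AddSubgroup (Fin m → ℤ) :=
        W ⊓ (U.map V.subtype).toAddSubgroup.comap (latticeInclusion m)
      have hW'_mem : ∀ w, w ∈ W' ↔ w ∈ W ∧ latticeInclusion m w ∈ U.map V.subtype :=
        fun _ => Iff.rfl
      have hspan := hirr W' inf_le_left ?_ ?_
      · have hle : V ≤ U.map V.subtype := by
          refine Submodule.span_le.mpr ?_
          rintro _ ⟨w, hw, rfl⟩
          refine latticeInclusion_mem_of_mem_real_span _ W' (fun v hv => hv.2) w ?_
          rw [hspan]
          exact Submodule.subset_span ⟨w, hw, rfl⟩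
        exact Submodule.eq_top_iff'.mpr fun v => (hmemU v).mp (hle v.2)
      · obtain ⟨u, huU, hu0⟩ := (Submodule.ne_bot_iff _).mp hU
        obtain ⟨n, hn, w, hw, hwu⟩ := exists_smul_mem_of_mem_span _ u.2
        intro hbot
        have hw' : w ∈ W' := (hW'_mem w).mpr ⟨hw, by
          rw [hwu]; exact zsmul_mem ((hmemU u).mpr huU) n⟩
        rw [hbot, AddSubgroup.mem_bot] at hw'
        rw [hw', map_zero, eq_comm, smul_eq_zero, or_iff_right hn] at hwu
        exact hu0 (Subtype.ext hwu)
      · intro g w hw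
        rw [hW'_mem] at hw ⊢
        refine ⟨hW_inv g w hw.1, ?_⟩
        have h := (hmemU (σ g ⟨_, hWV w hw.1⟩)).mpr
          (hU_inv g ⟨_, hWV w hw.1⟩ ((hmemU ⟨_, hWV w hw.1⟩).mp hw.2))
        rwa [hσ_apply, rationalAction_latticeInclusion] at h
    · refine ((Set.finite_Icc (-(finrank ℚ V : ℤ)) (finrank ℚ V)).image
        (Int.cast : ℤ → ℚ)).subset ?_
      rintro _ ⟨g, rfl⟩
      refine exists_int_trace_eq_of_aeval_eq_zero (σ g) (ρ g).charpoly
        (Matrix.charpoly_monic _) ?_ (hroot g)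
      ext1 v
      apply Subtype.ext
      have h := aeval_apply_of_intertwines V.subtype (σ g) _ (hσ_apply g) (ρ g).charpoly v
      have h' := aeval_algHom_apply (rationalAction m).toIntAlgHom (ρ g) (ρ g).charpoly
      rw [Matrix.aeval_self_charpoly, map_zero] at h'
      refine h.trans ?_
      exact congrArg (fun f : End ℚ (Fin m → ℚ) => f v) h'
  have hker : ∀ g h, σ g = σ h → ∀ w ∈ W, (ρ g).mulVec w = (ρ h).mulVec w := by
    intro g h hgh w hw
    apply latticeInclusion_injective
    rw [← rationalAction_latticeInclusion, ← rationalAction_latticeInclusion]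
    exact congrArg (fun f : End ℚ V => (f ⟨_, hWV w hw⟩ : Fin m → ℚ)) hgh
  have hfac : Function.FactorsThrough
      (fun g => fun w : W => (⟨(ρ g).mulVec w.1, hW_inv g w.1 w.2⟩ : W)) σ := by
    intro g h hgh
    funext w
    exact Subtype.ext (hker g h hgh w.1 w.2)
  rw [← hfac.extend_comp (fun _ w => w), Set.range_comp]
  exact hfin.image _

/-- A complex eigenvalue of an integer matrix admits a left eigenvector. -/
theorem exists_left_eigenvector {m : ℕ} (M : Matrix (Fin m) (Fin m) ℤ) {z : ℂ}
    (hz : aeval z M.charpoly = 0) :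
    ∃ v : Fin m → ℂ, v ≠ 0 ∧ ∀ x : Fin m → ℤ,
      v ⬝ᵥ (fun i => ((M.mulVec x) i : ℂ)) = z * v ⬝ᵥ (fun i => (x i : ℂ)) := by
  set N : Matrix (Fin m) (Fin m) ℂ := M.map (algebraMap ℤ ℂ)
  have hN : End.HasEigenvalue (Matrix.toLin' N.transpose) z := by
    rw [End.hasEigenvalue_iff_isRoot_charpoly, Matrix.charpoly_toLin', Matrix.charpoly_transpose,
      Matrix.charpoly_map, IsRoot.def, eval_map_algebraMap, hz]
  obtain ⟨v, hv⟩ := hN.exists_hasEigenvector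
  refine ⟨v, hv.2, fun x => ?_⟩
  have h := hv.apply_eq_smul
  rw [Matrix.toLin'_apply, Matrix.mulVec_transpose] at h
  have hx : (fun i => ((M.mulVec x) i : ℂ)) = N.mulVec (fun i => (x i : ℂ)) := by
    ext i
    simp [N, Matrix.mulVec, dotProduct]
  rw [hx, Matrix.dotProduct_mulVec, h, smul_dotProduct, smul_eq_mul]

/-- exponential lower bound on distortion from an invariant
subgroup `W ≤ ℤ^m` which is irreducible with infinite image.  Let `K ⊴ Γ` be
finitely generated, `ρ : Γ → GL(m, ℤ)` a homomorphism, and `ψ : K → ℤ^m` a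
surjective `Γ`-equivariant homomorphism.  Suppose `W ≤ ℤ^m` is a nonzero
`ρ(Γ)`-invariant subgroup such that every nonzero invariant subgroup `W' ≤ W`
has the same `ℝ`-span as `W`, and the image of `Γ` acting on `W` is infinite.
Then there are `x ∈ Γ`, `y ∈ K`, `a > 0`, `λ > 1` with
`‖xⁿ y x⁻ⁿ‖_{S_K} ≥ a λⁿ` for all `n ≥ 1`. -/
theorem exponential_distortion_from_irreducible_subrep {Γ : Type*} [Group Γ]
    (K : Subgroup Γ) (hK : K.Normal)
    (S_K : Finset K) (hSK : Subgroup.closure (S_K : Set K) = (⊤ : Subgroup K))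
    (S_Γ : Finset Γ) (hSΓ : Subgroup.closure (S_Γ : Set Γ) = (⊤ : Subgroup Γ))
    (m : ℕ) (hm : 1 ≤ m)
    (ρ : Γ →* GL (Fin m) ℤ)
    (ψ : K → (Fin m → ℤ))
    (hψ_hom : ∀ a b : K, ψ (a * b) = ψ a + ψ b)
    (hψ_surj : Function.Surjective ψ)
    (hψ_equiv : ∀ (x : Γ) (y : K),
      ψ ⟨x * ↑y * x⁻¹, hK.conj_mem y.1 y.2 x⟩ = (ρ x).1.mulVec (ψ y))
    (W : AddSubgroup (Fin m → ℤ)) (hW_ne : W ≠ ⊥)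
    (hW_inv : ∀ (g : Γ) (w : Fin m → ℤ), w ∈ W → (ρ g).1.mulVec w ∈ W)
    (hirr : ∀ W' : AddSubgroup (Fin m → ℤ), W' ≤ W → W' ≠ ⊥ →
      (∀ (g : Γ) (w : Fin m → ℤ), w ∈ W' → (ρ g).1.mulVec w ∈ W') →
      Submodule.span ℝ ((fun v : Fin m → ℤ => fun i => (v i : ℝ)) '' (W' : Set (Fin m → ℤ)))
        = Submodule.span ℝ ((fun v : Fin m → ℤ => fun i => (v i : ℝ)) '' (W : Set (Fin m → ℤ))))
    (hinf : Set.Infinite (Set.range (fun g : Γ =>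
      fun w : W => (⟨(ρ g).1.mulVec w.1, hW_inv g w.1 w.2⟩ : W)))) :
    ∃ (x : Γ) (y : K) (a lam : ℝ), 0 < a ∧ 1 < lam ∧
      ∀ n : ℕ, 1 ≤ n →
        a * lam ^ n ≤
          (wordLength (S_K : Set K)
            ⟨x ^ n * ↑y * (x ^ n)⁻¹, hK.conj_mem y.1 y.2 (x ^ n)⟩ : ℝ) := by
  by_cases hroot : ∀ (g : Γ) (z : ℂ), aeval z (ρ g).1.charpoly = 0 → ‖z‖ ≤ 1
  · exact absurd (finite_range_mulVec_of_norm_eigenvalue_le_one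
      ((Units.coeHom _).comp ρ) W hW_inv hirr hroot) hinf
  push Not at hroot
  obtain ⟨x, z, hz, hz1⟩ := hroot
  obtain ⟨v, hv0, hv⟩ := exists_left_eigenvector _ hz
  obtain ⟨i, hi⟩ := Function.ne_iff.mp hv0
  obtain ⟨y, hy⟩ := hψ_surj (Pi.single i 1)
  obtain ⟨C, hC, hle⟩ := exists_norm_le_mul_wordLength S_K hSK
    (fun k => v ⬝ᵥ (fun i => (ψ k i : ℂ)))
    (fun a b => by rw [← dotProduct_add, hψ_hom]; congr 1; ext; simp)
  have hpow : ∀ (n : ℕ) (w : Fin m → ℤ), v ⬝ᵥ (fun i => (((ρ x).1 ^ n).mulVec w i : ℂ)) =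
      z ^ n * v ⬝ᵥ (fun i => (w i : ℂ)) := by
    intro n w
    induction n with
    | zero => simp
    | succ n ih => rw [pow_succ', ← Matrix.mulVec_mulVec, hv, ih, pow_succ', mul_assoc]
  refine ⟨x, y, ‖v i‖ / C, ‖z‖, div_pos (norm_pos_iff.mpr hi) hC, hz1, fun n _ => ?_⟩
  have hn := hle ⟨x ^ n * ↑y * (x ^ n)⁻¹, hK.conj_mem y.1 y.2 (x ^ n)⟩
  have hvi : v ⬝ᵥ (fun j => ((Pi.single i 1 : Fin m → ℤ) j : ℂ)) = v i := by
    simp [dotProduct, Pi.single_apply]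
  have hρ : (ρ (x ^ n)).1 = (ρ x).1 ^ n := by rw [map_pow]; rfl
  simp only [hψ_equiv, hρ] at hn
  rw [hpow, hy, hvi, norm_mul, norm_pow] at hn
  rw [div_mul_eq_mul_div, div_le_iff₀ hC, mul_comm ‖v i‖, mul_comm _ C]
  exact hn
end

section
/- Let g ≥ 1 and let Sp(2g, ℤ) denote the group of 2g × 2g integer matrices preserving the standard symplectic form on ℤ^{2g}. If V ⊆ ℝ^{2g} is an ℝ-linear subspace with M · V ⊆ V for every M ∈ Sp(2g, ℤ), then V = 0 or V = ℝ^{2g}. That is, ℝ^{2g} is an irreducible Sp(2g, ℤ)-module. -/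
theorem Matrix.fromBlocks_one_zero_one_mem_symplecticGroup {l R : Type*} [DecidableEq l] [Fintype l]
    [CommRing R] {S : Matrix l l R} (hS : S.IsSymm) :
    Matrix.fromBlocks 1 S 0 1 ∈ Matrix.symplecticGroup l R := by
  simp [SymplecticGroup.fromBlocks_mem_iff, hS.eq]

theorem Matrix.map_intCast_single {m n R : Type*} [DecidableEq m] [DecidableEq n] [Ring R]
    (i : m) (j : n) (a : ℤ) :
    (Matrix.single i j a).map (Int.cast : ℤ → R) = Matrix.single i j (a : R) :=
  Matrix.map_single i j a (Int.castRingHom R)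

/-- A real subspace is stable under every integral symplectic matrix. -/
def IsSymplecticInvariant {l : Type*} [DecidableEq l] [Fintype l]
    (V : Submodule ℝ ((l ⊕ l) → ℝ)) : Prop :=
  ∀ M : Matrix (l ⊕ l) (l ⊕ l) ℤ, M ∈ Matrix.symplecticGroup l ℤ →
    ∀ v ∈ V, (M.map (Int.cast : ℤ → ℝ)).mulVec v ∈ V

namespace IsSymplecticInvariant

variable {l : Type*} [DecidableEq l] [Fintype l] {V : Submodule ℝ ((l ⊕ l) → ℝ)}

/-- Subtracting a vector from its image under a unipotent upper block triangular matrix. -/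
theorem sumElim_mulVec_zero_mem (hV : IsSymplecticInvariant V)
    {S : Matrix l l ℤ} (hS : S.IsSymm) {v : (l ⊕ l) → ℝ}
    (hv : v ∈ V) :
    Sum.elim ((S.map (Int.cast : ℤ → ℝ)).mulVec (v ∘ Sum.inr)) 0 ∈ V := by
  have h := V.sub_mem (hV _ (Matrix.fromBlocks_one_zero_one_mem_symplecticGroup hS) v hv) hv
  convert h using 1
  ext (i | i) <;> simp [Matrix.fromBlocks_map, Matrix.fromBlocks_mulVec]

theorem sumElim_neg_mem (hV : IsSymplecticInvariant V)
    {v : (l ⊕ l) → ℝ} (hv : v ∈ V) :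
    Sum.elim (-(v ∘ Sum.inr)) (v ∘ Sum.inl) ∈ V := by
  have h := hV _ (SymplecticGroup.J_mem l ℤ) v hv
  convert h using 1
  have hJ : (Matrix.J l ℤ).map (Int.cast : ℤ → ℝ) = Matrix.J l ℝ :=
    Matrix.map_J l (Int.castRingHom ℝ)
  rw [hJ, Matrix.J, Matrix.fromBlocks_mulVec]
  simp [Matrix.neg_mulVec]

theorem single_inr_mem_of_single_inl_mem (hV : IsSymplecticInvariant V)
    {i : l} (h : Pi.single (Sum.inl i) 1 ∈ V) :
    Pi.single (Sum.inr i) 1 ∈ V := by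
  convert sumElim_neg_mem hV h using 1
  ext (j | j) <;> simp [Pi.single_apply]

theorem single_inl_mem_of_apply_inr_ne_zero (hV : IsSymplecticInvariant V)
    {v : (l ⊕ l) → ℝ} (hv : v ∈ V) {i : l}
    (hi : v (Sum.inr i) ≠ 0) : Pi.single (Sum.inl i) 1 ∈ V := by
  have hS : (Matrix.single i i (1 : ℤ)).IsSymm := by simp [Matrix.IsSymm]
  convert V.smul_mem (v (Sum.inr i))⁻¹ (sumElim_mulVec_zero_mem hV hS hv) using 1
  ext (j | j)
  · by_cases hj : j = i
    · subst hj
      simp [Matrix.map_intCast_single, Matrix.single_mulVec, hi]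
    · simp [Matrix.map_intCast_single, Matrix.single_mulVec, hj]
  · simp

theorem single_inl_mem_of_single_inr_mem (hV : IsSymplecticInvariant V)
    {i : l} (h : Pi.single (Sum.inr i) 1 ∈ V) (j : l) :
    Pi.single (Sum.inl j) 1 ∈ V := by
  by_cases hj : j = i
  · exact single_inl_mem_of_apply_inr_ne_zero hV h (by simp [hj])
  have hS : (Matrix.single i j (1 : ℤ) + Matrix.single j i 1).IsSymm := by
    simp [Matrix.IsSymm, add_comm]
  convert sumElim_mulVec_zero_mem hV hS h using 1
  ext (k | k)
  · simp [Matrix.map_add, Matrix.map_intCast_single, Matrix.add_mulVec, Matrix.single_mulVec, hj,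
      Pi.single_apply, Function.update_apply]
  · simp

theorem eq_top_of_apply_inr_ne_zero (hV : IsSymplecticInvariant V)
    {v : (l ⊕ l) → ℝ} (hv : v ∈ V) {i : l}
    (hi : v (Sum.inr i) ≠ 0) : V = ⊤ := by
  have hinl : ∀ j, Pi.single (Sum.inl j) 1 ∈ V := single_inl_mem_of_single_inr_mem hV
    (single_inr_mem_of_single_inl_mem hV (single_inl_mem_of_apply_inr_ne_zero hV hv hi))
  rw [eq_top_iff, ← (Pi.basisFun ℝ (l ⊕ l)).span_eq, Submodule.span_le]
  rintro _ ⟨j | j, rfl⟩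
  · simpa using hinl j
  · simpa using single_inr_mem_of_single_inl_mem hV (hinl j)

end IsSymplecticInvariant

/-- `ℝ^{2g}` is an irreducible `Sp(2g, ℤ)`-module: any `ℝ`-linear
subspace of `ℝ^{2g}` invariant under every symplectic integer matrix is `0` or
all of `ℝ^{2g}`. -/
theorem symplectic_irreducible {g : ℕ} (hg : 1 ≤ g)
    (V : Submodule ℝ ((Fin g ⊕ Fin g) → ℝ))
    (hV : ∀ M : Matrix (Fin g ⊕ Fin g) (Fin g ⊕ Fin g) ℤ,
      M ∈ Matrix.symplecticGroup (Fin g) ℤ →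
      ∀ v ∈ V, (M.map (Int.cast : ℤ → ℝ)).mulVec v ∈ V) :
    V = ⊥ ∨ V = ⊤ := by
  rw [or_iff_not_imp_left]
  intro hbot
  obtain ⟨v, hv, hne⟩ := V.ne_bot_iff.mp hbot
  obtain ⟨i | i, hi⟩ := Function.ne_iff.mp hne
  · exact IsSymplecticInvariant.eq_top_of_apply_inr_ne_zero hV
      (IsSymplecticInvariant.sumElim_neg_mem hV hv) (i := i) hi
  · exact IsSymplecticInvariant.eq_top_of_apply_inr_ne_zero hV hv hi
end

section
/- Let n ≥ 2. If V ⊆ ℝⁿ is an ℝ-linear subspace with M · V ⊆ V for every M ∈ SL(n, ℤ), then V = 0 or V = ℝⁿ. That is, ℝⁿ is an irreducible SL(n, ℤ)-module. -/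
/-- A subspace of `ℝⁿ` invariant under the integral transvections `1 + E_{i,j}` contains the
`i`-th basis vector as soon as it contains a vector whose `j`-th coordinate is nonzero. -/
theorem single_mem_of_special_linear_invariant {n : ℕ} {V : Submodule ℝ (Fin n → ℝ)}
    (hV : ∀ M : Matrix.SpecialLinearGroup (Fin n) ℤ,
      ∀ v ∈ V, ((M : Matrix (Fin n) (Fin n) ℤ).map (Int.cast : ℤ → ℝ)).mulVec v ∈ V)
    {v : Fin n → ℝ} (hv : v ∈ V) {i j : Fin n} (hij : i ≠ j) (hvj : v j ≠ 0) :
    Pi.single i (1 : ℝ) ∈ V := by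
  have key : ((Matrix.SpecialLinearGroup.transvection hij (1 : ℤ) :
      Matrix (Fin n) (Fin n) ℤ).map (Int.cast : ℤ → ℝ)).mulVec v
      = v + v j • Pi.single i (1 : ℝ) := by
    rw [Matrix.SpecialLinearGroup.transvection_coe,
      Matrix.map_add _ Int.cast_add, Matrix.map_one _ Int.cast_zero Int.cast_one,
      show (Matrix.single i j (1 : ℤ)).map (Int.cast : ℤ → ℝ) = Matrix.single i j 1 by
        simpa using Matrix.map_single i j (1 : ℤ) (Int.castRingHom ℝ),
      Matrix.add_mulVec, Matrix.one_mulVec, Matrix.single_mulVec]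
    ext k
    simp [Function.update_apply, Pi.single_apply]
  have h := hV (Matrix.SpecialLinearGroup.transvection hij 1) v hv
  rw [key] at h
  exact (V.smul_mem_iff hvj).1 ((V.add_mem_iff_right hv).1 h)

/-- `ℝⁿ` is an irreducible `SL(n, ℤ)`-module for `n ≥ 2`: any
`ℝ`-linear subspace of `ℝⁿ` invariant under every integer matrix of determinant
one is `0` or all of `ℝⁿ`. -/
theorem special_linear_irreducible {n : ℕ} (hn : 2 ≤ n)
    (V : Submodule ℝ (Fin n → ℝ))
    (hV : ∀ M : Matrix.SpecialLinearGroup (Fin n) ℤ,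
      ∀ v ∈ V, ((M : Matrix (Fin n) (Fin n) ℤ).map (Int.cast : ℤ → ℝ)).mulVec v ∈ V) :
    V = ⊥ ∨ V = ⊤ := by
  refine or_iff_not_imp_left.2 fun hbot => ?_
  obtain ⟨v, hv, hv0⟩ := V.ne_bot_iff.1 hbot
  obtain ⟨j, hj⟩ := Function.ne_iff.1 hv0
  have : Nontrivial (Fin n) := Fin.nontrivial_iff_two_le.2 hn
  have off : ∀ i, i ≠ j → Pi.single i (1 : ℝ) ∈ V := fun i hij =>
    single_mem_of_special_linear_invariant hV hv hij hj
  have all : ∀ i, Pi.single i (1 : ℝ) ∈ V := by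
    intro i
    rcases eq_or_ne i j with rfl | hij
    · obtain ⟨k, hk⟩ := exists_ne i
      exact single_mem_of_special_linear_invariant hV (off k hk) hk.symm (by simp)
    · exact off i hij
  rw [eq_top_iff, ← (Pi.basisFun ℝ (Fin n)).span_eq, Submodule.span_le]
  rintro _ ⟨i, rfl⟩
  simpa using all i
end

section
/- For every g ≥ 1, the group Sp(2g, ℤ) admits a finite presentation ⟨S | R⟩ together with a constant C > 1 such that the pair of functions (n ↦ C^n, n ↦ C^n) is a simultaneous (isoperimetric, isodiametric) pair for this presentation: every word w in the free group F(S) representing the identity of Sp(2g, ℤ) can be written in F(S) as a product of at most C^{ℓ(w)} conjugates x_i r_i^{±1} x_i⁻¹ with r_i ∈ R and ℓ(x_i) ≤ C^{ℓ(w)} for each i. That is, Sp(2g, ℤ) has at worst a simultaneous (exponential, exponential) (isoperimetric, isodiametric) pair. -/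
namespace SymplecticFilling

/-! ### Fillings of words over a free group -/

section Filling

variable {S : Type} [DecidableEq S]

/-- `w` is a product of at most `N` conjugates of elements of `R`, by elements of length at
most `L`. -/
def IsFilling (R : Set (FreeGroup S)) (N L : ℕ) (w : FreeGroup S) : Prop :=
  ∃ l : List (FreeGroup S × FreeGroup S), (∀ p ∈ l, p.2 ∈ R ∧ p.1.norm ≤ L) ∧
    w = (l.map fun p => p.1 * p.2 * p.1⁻¹).prod ∧ l.length ≤ N

variable {R : Set (FreeGroup S)} {N N' L : ℕ} {w w' : FreeGroup S}

lemma IsFilling.one : IsFilling R N L 1 := ⟨[], by simp, by simp, by simp⟩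

lemma IsFilling.mul (h : IsFilling R N L w) (h' : IsFilling R N' L w') :
    IsFilling R (N + N') L (w * w') := by
  obtain ⟨l, h1, h2, h3⟩ := h
  obtain ⟨l', h1', h2', h3'⟩ := h'
  refine ⟨l ++ l', ?_, ?_, ?_⟩
  · intro p hp
    rcases List.mem_append.1 hp with hp | hp
    exacts [h1 p hp, h1' p hp]
  · rw [List.map_append, List.prod_append, h2, h2']
  · rw [List.length_append]; omega

lemma IsFilling.conj {x r : FreeGroup S} (hr : r ∈ R) (hx : x.norm ≤ L) :
    IsFilling R 1 L (x * r * x⁻¹) :=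
  ⟨[(x, r)], by simpa using ⟨hr, hx⟩, by simp, by simp⟩

lemma IsFilling.mem_normalClosure (h : IsFilling R N L w) : w ∈ Subgroup.normalClosure R := by
  obtain ⟨l, h1, rfl, -⟩ := h
  refine Subgroup.list_prod_mem _ fun y hy => ?_
  obtain ⟨p, hp, rfl⟩ := List.mem_map.1 hy
  exact Subgroup.normalClosure_normal.conj_mem _
    (Subgroup.subset_normalClosure (h1 p hp).1) _

/-- The product `a 0 * a 1 * ⋯ * a (k - 1)`. -/
def pathProd {G : Type*} [Group G] (a : ℕ → G) : ℕ → G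
  | 0 => 1
  | k + 1 => pathProd a k * a k

lemma norm_pathProd_le {a : ℕ → FreeGroup S} {l : ℕ} {M : ℕ} (ha : ∀ k < M, (a k).norm ≤ l) :
    ∀ k ≤ M, (pathProd a k).norm ≤ k * l := by
  intro k
  induction k with
  | zero => intro _; simp [pathProd]
  | succ k ih =>
    intro hk
    have h1 := ih (by omega)
    have h2 := ha k (by omega)
    have h3 := FreeGroup.norm_mul_le (pathProd a k) (a k)
    rw [pathProd, add_mul, one_mul]
    omega

lemma pathProd_eq_one {G : Type*} [Group G] {a : ℕ → G} {k : ℕ} (h : ∀ j < k, a j = 1) :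
    pathProd a k = 1 := by
  induction k with
  | zero => rfl
  | succ k ih => rw [pathProd, ih fun j hj => h j (by omega), h k (by omega), one_mul]

lemma pathProd_telescope {G : Type*} [Group G] (h : ℕ → G) (k : ℕ) :
    pathProd (fun j => (h j)⁻¹ * h (j + 1)) k = (h 0)⁻¹ * h k := by
  induction k with
  | zero => simp [pathProd]
  | succ k ih => rw [pathProd, ih]; group

/-- Filling a strip of squares. -/
lemma isFilling_strip {a a' b : ℕ → FreeGroup S} {l M : ℕ} (hb : b 0 = 1)
    (ha : ∀ k < M, (a k).norm ≤ l)
    (hR : ∀ k < M, a k * b (k + 1) * (a' k)⁻¹ * (b k)⁻¹ ∈ R) :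
    IsFilling R M (M * l) (pathProd a M * b M * (pathProd a' M)⁻¹) := by
  suffices ∀ k ≤ M, IsFilling R k (M * l) (pathProd a k * b k * (pathProd a' k)⁻¹) from
    this M le_rfl
  intro k
  induction k with
  | zero => intro _; simpa [pathProd, hb] using IsFilling.one
  | succ k ih =>
    intro hk
    have h1 : (pathProd a k).norm ≤ M * l :=
      (norm_pathProd_le ha k (by omega)).trans (Nat.mul_le_mul_right _ (by omega))
    have h2 := (IsFilling.conj (hR k (by omega)) h1).mul (ih (by omega))
    rw [add_comm 1 k] at h2
    convert h2 using 1
    simp only [pathProd]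
    group

/-- Filling a triangular grid, all of whose bottom edges are trivial. -/
lemma isFilling_grid {a b : ℕ → ℕ → FreeGroup S} {l M N : ℕ} (hb : ∀ j < N, b j 0 = 1)
    (ha : ∀ j < N, ∀ k < M, (a j k).norm ≤ l)
    (hR : ∀ j < N, ∀ k < M, a j k * b j (k + 1) * (a (j + 1) k)⁻¹ * (b j k)⁻¹ ∈ R) :
    IsFilling R (N * M) (M * l)
      (pathProd (a 0) M * pathProd (fun j => b j M) N * (pathProd (a N) M)⁻¹) := by
  induction N with
  | zero => simpa [pathProd] using IsFilling.one
  | succ N ih =>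
    have h1 := ih (fun j hj => hb j (by omega)) (fun j hj => ha j (by omega))
      (fun j hj => hR j (by omega))
    have h2 := h1.mul (isFilling_strip (hb N (by omega)) (ha N (by omega)) (hR N (by omega)))
    rw [add_mul, one_mul]
    convert h2 using 1
    simp only [pathProd]
    group

/-- A grid of group elements, with consecutive quotients in a set on which the words `ω` are
short, gives a filling of the boundary of the grid. -/
lemma isFilling_of_group_grid {G : Type*} [Group G] {π : FreeGroup S →* G} {ω : G → FreeGroup S}
    (hω : ∀ g, π (ω g) = g) (hω1 : ω 1 = 1) {T : Set G} {l M : ℕ} (hM : 0 < M)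
    (hl : ∀ g ∈ T, (ω g).norm ≤ l)
    (hR : ∀ r : FreeGroup S, π r = 1 → r.norm ≤ 4 * l → r ∈ R)
    {H : ℕ → ℕ → G} {h : G} {y : FreeGroup S} (hy : y.norm ≤ l)
    (hbot : ∀ j ≤ M, H j 0 = 1) (htop : ∀ j < M, H j M = h) (hend : H M M = h * π y)
    (hvert : ∀ j ≤ M, ∀ k < M, (H j k)⁻¹ * H j (k + 1) ∈ T)
    (hhor : ∀ j < M, ∀ k < M, (H j k)⁻¹ * H (j + 1) k ∈ T) :
    IsFilling R (M * M) (M * l)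
      (pathProd (fun k => ω ((H 0 k)⁻¹ * H 0 (k + 1))) M * y *
        (pathProd (fun k => ω ((H M k)⁻¹ * H M (k + 1))) M)⁻¹) := by
  set b : ℕ → ℕ → FreeGroup S := fun j k =>
    if k < M then ω ((H j k)⁻¹ * H (j + 1) k) else if j + 1 < M then 1 else y with hbdef
  have hb1 : ∀ j k, k < M → b j k = ω ((H j k)⁻¹ * H (j + 1) k) := fun j k hk => by
    simp [hbdef, hk]
  have hb2 : ∀ j, j + 1 < M → b j M = 1 := fun j hj => by simp [hbdef, hj]
  have hb3 : ∀ j, j + 1 = M → b j M = y := fun j hj => by simp [hbdef, hj]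
  have hbn : ∀ j < M, ∀ k ≤ M, (b j k).norm ≤ l := by
    intro j hj k hk
    rcases hk.lt_or_eq with hk | rfl
    · rw [hb1 j k hk]; exact hl _ (hhor j hj k hk)
    · rcases (Nat.succ_le_of_lt hj).lt_or_eq with h1 | h1
      · rw [hb2 j h1]; simp
      · rwa [hb3 j h1]
  have hbπ : ∀ j < M, ∀ k ≤ M, π (b j k) = (H j k)⁻¹ * H (j + 1) k := by
    intro j hj k hk
    rcases hk.lt_or_eq with hk | rfl
    · rw [hb1 j k hk, hω]
    · rcases (Nat.succ_le_of_lt hj).lt_or_eq with h1 | h1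
      · rw [hb2 j h1, htop j hj, htop (j + 1) h1]; simp
      · have h1' : j + 1 = k := h1
        rw [hb3 j h1, htop j hj, h1', hend]; simp
  have key := isFilling_grid (R := R) (a := fun j k => ω ((H j k)⁻¹ * H j (k + 1))) (b := b)
    (l := l) (M := M) (N := M) ?_ ?_ ?_
  · have hprod : pathProd (fun j => b j M) M = y := by
      obtain ⟨m, rfl⟩ : ∃ m, M = m + 1 := ⟨M - 1, by omega⟩
      rw [pathProd, pathProd_eq_one fun j hj => hb2 j (by omega), hb3 m rfl, one_mul]
    rwa [hprod] at key
  · intro j hj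
    rw [hb1 j 0 hM, hbot j hj.le, hbot (j + 1) hj]; simpa using hω1
  · intro j hj k hk
    exact hl _ (hvert j hj.le k hk)
  · intro j hj k hk
    apply hR
    · simp only [map_mul, map_inv, hω]
      rw [hbπ j hj _ hk, hbπ j hj k hk.le]
      group
    · have h1 := hl _ (hvert j hj.le k hk)
      have h2 := hl _ (hvert (j + 1) hj k hk)
      have h3 := hbn j hj (k + 1) hk
      have h4 := hbn j hj k hk.le
      refine (FreeGroup.norm_mul_le _ _).trans ?_
      rw [FreeGroup.norm_inv_eq]
      have h5 := FreeGroup.norm_mul_le (ω ((H j k)⁻¹ * H j (k + 1)) * b j (k + 1))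
        (ω ((H (j + 1) k)⁻¹ * H (j + 1) (k + 1)))⁻¹
      rw [FreeGroup.norm_inv_eq] at h5
      have h6 := FreeGroup.norm_mul_le (ω ((H j k)⁻¹ * H j (k + 1))) (b j (k + 1))
      omega

lemma finite_norm_le [Finite S] (n : ℕ) : {w : FreeGroup S | w.norm ≤ n}.Finite := by
  have h : {l : List (S × Bool) | l.length ≤ n}.Finite := List.finite_length_le _ _
  refine (h.image FreeGroup.mk).subset fun w hw => ⟨w.toWord, hw, FreeGroup.mk_toWord⟩

end Filling


/-! ### Reduced quadratic forms -/

section Reduced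

open Matrix

variable {ι κ : Type*} [Fintype ι] [Fintype κ]

/-- The quadratic form of a square matrix. -/
def qf (Q : Matrix ι ι ℝ) (u : ι → ℝ) : ℝ := u ⬝ᵥ Q *ᵥ u

lemma qf_transpose_mul_mul (P : Matrix κ κ ℝ) (A : Matrix κ ι ℝ) (u : ι → ℝ) :
    qf (Aᵀ * P * A) u = qf P (A *ᵥ u) := by
  simp only [qf, ← mulVec_mulVec, dotProduct_mulVec, vecMul_transpose]

lemma qf_sub (P Q : Matrix ι ι ℝ) (u : ι → ℝ) : qf (P - Q) u = qf P u - qf Q u := by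
  simp [qf, sub_mulVec, dotProduct_sub]

lemma qf_smul (Q : Matrix ι ι ℝ) (t : ℝ) (u : ι → ℝ) : qf Q (t • u) = t ^ 2 * qf Q u := by
  simp [qf, mulVec_smul, dotProduct_smul, smul_dotProduct]; ring

variable [DecidableEq ι] [DecidableEq κ]

lemma qf_one (u : ι → ℝ) : qf 1 u = u ⬝ᵥ u := by simp [qf]

lemma qf_diagonal (d u : ι → ℝ) : qf (diagonal d) u = ∑ i, d i * u i ^ 2 := by
  simp only [qf, dotProduct, mulVec_diagonal]
  exact Finset.sum_congr rfl fun i _ => by ring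

lemma qf_single (Q : Matrix ι ι ℝ) (i : ι) : qf Q (Pi.single i 1) = Q i i := by
  simp [qf]

lemma four_mul_entry {F : Matrix ι ι ℝ} (hF : Fᵀ = F) (i j : ι) :
    4 * F i j = qf F (Pi.single i 1 + Pi.single j 1) - qf F (Pi.single i 1 - Pi.single j 1) := by
  have h : F j i = F i j := by rw [← transpose_apply F i j, hF]
  simp [qf, mulVec_add, mulVec_sub, add_dotProduct, sub_dotProduct, h]
  ring

lemma abs_sum_mul_le {a b : ι → ℝ} {x : ℝ} (hx : ∀ i, |a i * b i| ≤ x) :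
    |∑ i, a i * b i| ≤ Fintype.card ι * x := by
  refine (Finset.abs_sum_le_sum_abs _ _).trans ?_
  refine (Finset.sum_le_card_nsmul _ _ x fun i _ => hx i).trans ?_
  simp

lemma eq_of_transpose_mul_mul_eq {Q M N D : Matrix ι ι ℝ} (h : M * N = 1) (hD : Mᵀ * Q * M = D) :
    Q = Nᵀ * D * N := by
  rw [← hD]
  have h1 : Nᵀ * Mᵀ = 1 := by rw [← transpose_mul, h, transpose_one]
  calc Q = (Nᵀ * Mᵀ) * Q * (M * N) := by rw [h1, h, Matrix.one_mul, Matrix.mul_one]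
    _ = _ := by simp only [Matrix.mul_assoc]

/-- `Q` is diagonalized by the real basis `M`, close to the standard basis in the sense that
`M` and its inverse `N` have entries bounded by `c` and are triangular with respect to the order
of magnitude of the diagonal entries. -/
structure ReducedBy (c : ℝ) (Q M N : Matrix ι ι ℝ) (d : ι → ℝ) : Prop where
  mul_eq_one : M * N = 1
  pos : ∀ i, 0 < d i
  diag : Mᵀ * Q * M = diagonal d
  abs_le : ∀ i j, |M i j| ≤ c
  abs_inv_le : ∀ i j, |N i j| ≤ c
  le_of_ne_zero : ∀ i j, M i j ≠ 0 → d i ≤ c * d j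
  le_of_inv_ne_zero : ∀ i j, N i j ≠ 0 → d i ≤ c * d j

/-- `Q` is reduced, with constant `c`, in the sense of Siegel. -/
def Reduced (c : ℝ) (Q : Matrix ι ι ℝ) : Prop := ∃ M N d, ReducedBy c Q M N d

variable {c : ℝ} {Q M N Q' M' N' : Matrix ι ι ℝ} {d d' : ι → ℝ}

namespace ReducedBy

lemma mono {c' : ℝ} (h : ReducedBy c Q M N d) (hc : c ≤ c') : ReducedBy c' Q M N d where
  mul_eq_one := h.mul_eq_one
  pos := h.pos
  diag := h.diag
  abs_le i j := (h.abs_le i j).trans hc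
  abs_inv_le i j := (h.abs_inv_le i j).trans hc
  le_of_ne_zero i j hij := (h.le_of_ne_zero i j hij).trans
    (mul_le_mul_of_nonneg_right hc (h.pos j).le)
  le_of_inv_ne_zero i j hij := (h.le_of_inv_ne_zero i j hij).trans
    (mul_le_mul_of_nonneg_right hc (h.pos j).le)

lemma inv_mul (h : ReducedBy c Q M N d) : N * M = 1 := mul_eq_one_comm.1 h.mul_eq_one

lemma eq (h : ReducedBy c Q M N d) : Q = Nᵀ * diagonal d * N :=
  eq_of_transpose_mul_mul_eq h.mul_eq_one h.diag

lemma qf_eq (h : ReducedBy c Q M N d) (u : ι → ℝ) : qf Q u = ∑ i, d i * (N *ᵥ u) i ^ 2 := by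
  conv_lhs => rw [h.eq]
  rw [qf_transpose_mul_mul, qf_diagonal]

lemma qf_mulVec (h : ReducedBy c Q M N d) (u : ι → ℝ) : qf Q (M *ᵥ u) = ∑ i, d i * u i ^ 2 := by
  rw [h.qf_eq, mulVec_mulVec, h.inv_mul, one_mulVec]

lemma nonneg_of (h : ReducedBy c Q M N d) (i : ι) : 0 ≤ c := (abs_nonneg _).trans (h.abs_le i i)

/-- The diagonal entries of a reduced form are bounded by its values on the standard basis. -/
lemma diag_le (h : ReducedBy c Q M N d) (i : ι) : Q i i ≤ Fintype.card ι * c ^ 3 * d i := by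
  have hc := h.nonneg_of i
  rw [← qf_single Q i, h.qf_eq]
  refine (Finset.sum_le_card_nsmul _ _ (c ^ 3 * d i) fun j _ => ?_).trans
    (by simp [mul_assoc])
  rw [mulVec_single_one, col_apply]
  by_cases hz : N j i = 0
  · rw [hz]; have := h.pos i; simp; positivity
  · have h1 := h.le_of_inv_ne_zero j i hz
    have h2 : N j i ^ 2 ≤ c ^ 2 := sq_le_sq' (by linarith [_root_.abs_le.1 (h.abs_inv_le j i)])
      (_root_.abs_le.1 (h.abs_inv_le j i)).2
    calc d j * N j i ^ 2 ≤ c * d i * c ^ 2 :=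
          mul_le_mul h1 h2 (sq_nonneg _) (mul_nonneg hc (h.pos i).le)
      _ = c ^ 3 * d i := by ring

/-- The dual form of a reduced form. -/
lemma inv_eq (h : ReducedBy c Q M N d) : Q⁻¹ = M * diagonal (fun i => (d i)⁻¹) * Mᵀ := by
  refine inv_eq_left_inv ?_
  have h1 : Mᵀ * Nᵀ = 1 := by rw [← transpose_mul, h.inv_mul, transpose_one]
  have h2 : diagonal (fun i => (d i)⁻¹) * diagonal d = (1 : Matrix ι ι ℝ) := by
    rw [diagonal_mul_diagonal, ← diagonal_one]
    congr 1; ext i; exact inv_mul_cancel₀ (h.pos i).ne'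
  rw [h.eq]
  calc _ = M * diagonal (fun i => (d i)⁻¹) * (Mᵀ * Nᵀ) * diagonal d * N := by
        simp only [Matrix.mul_assoc]
    _ = M * (diagonal (fun i => (d i)⁻¹) * diagonal d) * N := by
        rw [h1, Matrix.mul_one]; simp only [Matrix.mul_assoc]
    _ = 1 := by rw [h2, Matrix.mul_one, h.mul_eq_one]

lemma inv_diag_mul_le (h : ReducedBy c Q M N d) (i : ι) :
    Q⁻¹ i i * d i ≤ Fintype.card ι * c ^ 3 := by
  have hc := h.nonneg_of i
  have hi := h.pos i
  have h0 : Q⁻¹ i i = ∑ j, (d j)⁻¹ * M i j ^ 2 := by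
    rw [h.inv_eq, Matrix.mul_apply]
    simp only [mul_diagonal, transpose_apply]
    exact Finset.sum_congr rfl fun j _ => by ring
  rw [h0, Finset.sum_mul]
  refine (Finset.sum_le_card_nsmul _ _ (c ^ 3) fun j _ => ?_).trans (by simp)
  by_cases hz : M i j = 0
  · rw [hz]; simp; positivity
  · have h1 := h.le_of_ne_zero i j hz
    have hj := h.pos j
    have h2 : M i j ^ 2 ≤ c ^ 2 := sq_le_sq' (by linarith [_root_.abs_le.1 (h.abs_le i j)])
      (_root_.abs_le.1 (h.abs_le i j)).2
    have h3 : (d j)⁻¹ * d i ≤ c := by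
      rw [inv_mul_le_iff₀ hj]; linarith
    calc (d j)⁻¹ * M i j ^ 2 * d i = ((d j)⁻¹ * d i) * M i j ^ 2 := by ring
      _ ≤ c * c ^ 2 := mul_le_mul h3 h2 (sq_nonneg _) hc
      _ = c ^ 3 := by ring

end ReducedBy

/-- Among `2m + 1` consecutive multiplicative intervals, one avoids `2m` given values. -/
lemma exists_gap (f : ι ⊕ ι → ℝ) {a T : ℝ} (ha : 0 < a) (hT : 1 ≤ T) :
    ∃ l ≤ 2 * Fintype.card ι, ∀ x, T ^ l * a < f x → T ^ (l + 1) * a < f x := by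
  by_contra! hcon
  have h1 : ∀ l : Fin (2 * Fintype.card ι + 1), ∃ x, T ^ (l : ℕ) * a < f x ∧
      f x ≤ T ^ ((l : ℕ) + 1) * a := fun l => hcon l (by omega)
  choose e he1 he2 using h1
  have hlt : ∀ l l' : Fin (2 * Fintype.card ι + 1), l < l' → e l ≠ e l' := by
    intro l l' hll heq
    have h2 : T ^ ((l : ℕ) + 1) * a ≤ T ^ (l' : ℕ) * a :=
      mul_le_mul_of_nonneg_right (pow_le_pow_right₀ hT hll) ha.le
    have h3 := he1 l'
    have h4 := he2 l
    rw [heq] at h4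
    linarith
  have hinj : Function.Injective e := by
    intro l l' h
    rcases lt_trichotomy l l' with h1 | h1 | h1
    · exact absurd h (hlt _ _ h1)
    · exact h1
    · exact absurd h.symm (hlt _ _ h1)
  have := Fintype.card_le_of_injective e hinj
  simp at this
  omega

/-- An integer of absolute value less than one vanishes. -/
lemma intCast_eq_zero_of_abs_lt {z : ℤ} (h : |(z : ℝ)| < 1) : z = 0 := by
  rw [← Int.abs_lt_one_iff]; exact_mod_cast h

lemma abs_mul_mul_apply_le {A B C : Matrix ι ι ℝ} {i j : ι} {x : ℝ}
    (h : ∀ k l, |A i k * B k l * C l j| ≤ x) :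
    |(A * B * C) i j| ≤ Fintype.card ι * (Fintype.card ι * x) := by
  have h0 : (A * B * C) i j = ∑ l, ∑ k, A i k * B k l * C l j := by
    simp only [Matrix.mul_apply, Finset.sum_mul]
  rw [h0]
  refine (Finset.abs_sum_le_sum_abs _ _).trans ?_
  refine (Finset.sum_le_card_nsmul _ _ (Fintype.card ι * x) fun l _ => ?_).trans (by simp)
  refine (Finset.abs_sum_le_sum_abs _ _).trans ?_
  exact (Finset.sum_le_card_nsmul _ _ x fun k _ => h k l).trans (by simp)

/-- The entries of the change of basis between two almost isometric reduced forms vanish when they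
go from a much smaller to a much larger direction. -/
lemma transition_eq_zero (h : ReducedBy c Q M N d) (h' : ReducedBy c Q' M' N' d')
    {G : Matrix ι ι ℤ} {T : ℝ} (hT : 1 ≤ T) (hcT : c ≤ T)
    (hTc : 2 * (Fintype.card ι * (Fintype.card ι * (c * c))) ^ 2 < T)
    (hA : ∀ i j, d' j * (N' * G.map (Int.cast : ℤ → ℝ) * M) j i ^ 2 ≤ 2 * d i)
    {i j : ι} (hij : T ^ (2 * Fintype.card ι + 1) * d i < d' j) :
    (N' * G.map (Int.cast : ℤ → ℝ) * M) j i = 0 := by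
  set GR := G.map (Int.cast : ℤ → ℝ) with hGR
  have hT0 : 0 < T := by linarith
  have hc := h.nonneg_of i
  obtain ⟨l, hl, hgap⟩ := exists_gap (Sum.elim d d') (h.pos i) hT
  set t := T ^ l * d i with ht
  have htpos : 0 < t := mul_pos (pow_pos hT0 _) (h.pos i)
  have hTt : T ^ (l + 1) * d i = T * t := by rw [ht]; ring
  rw [hTt] at hgap
  have hgd : ∀ a, t < d a → T * t < d a := fun a => hgap (Sum.inl a)
  have hgd' : ∀ a, t < d' a → T * t < d' a := fun a => hgap (Sum.inr a)
  have hdi : d i ≤ t := by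
    have : 1 ≤ T ^ l := one_le_pow₀ hT
    nlinarith [h.pos i]
  have hct : c * t ≤ T * t := mul_le_mul_of_nonneg_right hcT htpos.le
  have hd'j : T * t < d' j := by
    refine lt_of_le_of_lt ?_ hij
    rw [← hTt]
    exact mul_le_mul_of_nonneg_right (pow_le_pow_right₀ hT (by omega)) (h.pos i).le
  -- smallness of the transition entries across the gap
  have key : ∀ b a, T * t < d' b → d a ≤ t → GR b a = 0 := by
    intro b a hb ha
    have hG : GR = M' * (N' * GR * M) * N := by
      calc GR = (M' * N') * GR * (M * N) := by
            rw [h'.mul_eq_one, h.mul_eq_one, Matrix.one_mul, Matrix.mul_one]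
        _ = _ := by simp only [Matrix.mul_assoc]
    have hx : ∀ k l, |M' b k * (N' * GR * M) k l * N l a| ≤ c * c * √(2 / T) := by
      intro k l
      by_cases hk : M' b k = 0
      · rw [hk]; simp; positivity
      by_cases hl : N l a = 0
      · rw [hl]; simp; positivity
      have h1 := h'.le_of_ne_zero b k hk
      have h2 := h.le_of_inv_ne_zero l a hl
      have h3 : T * t < d' k := by
        apply hgd'
        by_contra! hcon
        have : c * d' k ≤ c * t := mul_le_mul_of_nonneg_left hcon hc
        linarith
      have h4 : d l ≤ t := by
        by_contra! hcon
        have := hgd l hcon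
        have : c * d a ≤ c * t := mul_le_mul_of_nonneg_left ha hc
        linarith
      have h5 : |(N' * GR * M) k l| ≤ √(2 / T) := by
        apply Real.abs_le_sqrt
        have h6 := hA l k
        rw [le_div_iff₀ hT0]
        have h7 : T * t * (N' * GR * M) k l ^ 2 ≤ 2 * t :=
          (mul_le_mul_of_nonneg_right h3.le (sq_nonneg _)).trans (by linarith)
        have h8 : t * ((N' * GR * M) k l ^ 2 * T) ≤ t * 2 := by linarith
        exact le_of_mul_le_mul_left h8 htpos
      rw [abs_mul, abs_mul]
      calc |M' b k| * |(N' * GR * M) k l| * |N l a| ≤ c * √(2 / T) * c := by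
            have := h'.abs_le b k
            have := h.abs_inv_le l a
            gcongr
        _ = c * c * √(2 / T) := by ring
    have h9 := abs_mul_mul_apply_le hx
    rw [← hG] at h9
    have h10 : |GR b a| < 1 := by
      refine lt_of_le_of_lt h9 ?_
      rw [← mul_assoc, ← mul_assoc]
      have h11 : (0 : ℝ) ≤ Fintype.card ι * (Fintype.card ι * (c * c)) := by positivity
      have h12 : √(2 / T) ^ 2 = 2 / T := Real.sq_sqrt (by positivity)
      have h13 : (Fintype.card ι * (Fintype.card ι * (c * c)) * √(2 / T)) ^ 2 < 1 := by
        rw [mul_pow, h12, ← mul_div_assoc, div_lt_one hT0]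
        linarith
      have h14 := (sq_lt_one_iff_abs_lt_one _).1 h13
      have h15 := le_abs_self (Fintype.card ι * (Fintype.card ι * (c * c)) * √(2 / T))
      calc _ = Fintype.card ι * (Fintype.card ι * (c * c)) * √(2 / T) := by ring
        _ < 1 := lt_of_le_of_lt h15 h14
    rw [hGR, map_apply] at h10 ⊢
    rw [intCast_eq_zero_of_abs_lt h10, Int.cast_zero]
  have h0 : (N' * GR * M) j i = ∑ a, ∑ b, N' j b * GR b a * M a i := by
    simp only [Matrix.mul_apply, Finset.sum_mul]
  rw [h0]
  refine Finset.sum_eq_zero fun a _ => Finset.sum_eq_zero fun b _ => ?_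
  by_cases hb : N' j b = 0
  · rw [hb]; simp
  by_cases ha : M a i = 0
  · rw [ha]; simp
  have h1 := h'.le_of_inv_ne_zero j b hb
  have h2 := h.le_of_ne_zero a i ha
  rw [key b a, mul_zero, zero_mul]
  · apply hgd'
    by_contra! hcon
    have : c * d' b ≤ c * t := mul_le_mul_of_nonneg_left hcon hc
    linarith
  · by_contra! hcon
    have := hgd a hcon
    have : c * d i ≤ c * t := mul_le_mul_of_nonneg_left hdi hc
    linarith

/-- Siegel's finiteness property: an integral change of basis between two almost isometric reduced
forms has bounded entries. -/
lemma transition_bounded (h : ReducedBy c Q M N d) (h' : ReducedBy c Q' M' N' d')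
    {g g' : Matrix ι ι ℤ} (hg : g * g' = 1) {T : ℝ} (hT : 1 ≤ T) (hcT : c ≤ T)
    (hTc : 2 * (Fintype.card ι * (Fintype.card ι * (c * c))) ^ 2 < T) {ε δ : ℝ} (hε : 0 ≤ ε)
    (hε1 : ε ≤ 1) (hδ : 0 < δ) (hdδ : ∀ i, 1 ≤ δ * d i) (hd'δ : ∀ i, d' i ≤ δ)
    (hdδ' : ∀ i, d i ≤ δ) (hd'δ' : ∀ i, 1 ≤ δ * d' i) (hεδ : 4 * Fintype.card ι * ε * δ ^ 3 ≤ 1)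
    (h1 : ∀ u, qf Q (g.map (Int.cast : ℤ → ℝ) *ᵥ u) ≤ (1 + ε) * qf Q' u)
    (h2 : ∀ u, qf Q' u ≤ (1 + ε) * qf Q (g.map (Int.cast : ℤ → ℝ) *ᵥ u)) (a b : ι) :
    |(g a b : ℝ)| ≤ Fintype.card ι *
      (Fintype.card ι * (c * (2 * T ^ (2 * Fintype.card ι + 1)) * c)) := by
  have hc := h.nonneg_of a
  set gR := g.map (Int.cast : ℤ → ℝ) with hgR
  set gR' := g'.map (Int.cast : ℤ → ℝ) with hgR'
  have hgg : gR * gR' = 1 := by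
    have h3 := Matrix.map_mul (f := Int.castRingHom ℝ) (L := g) (M := g')
    rw [hg, Matrix.map_one _ (map_zero _) (map_one _)] at h3
    exact h3.symm
  set A := N * gR * M' with hAdef
  set A' := N' * gR' * M with hA'def
  have hAA : A * A' = 1 := by
    calc A * A' = N * gR * (M' * N') * gR' * M := by
          simp only [hAdef, hA'def, Matrix.mul_assoc]
      _ = N * (gR * gR') * M := by
          rw [h'.mul_eq_one, Matrix.mul_one]; simp only [Matrix.mul_assoc]
      _ = 1 := by rw [hgg, Matrix.mul_one, h.inv_mul]
  have hmA : ∀ u, qf Q (gR *ᵥ (M' *ᵥ u)) = ∑ i, d i * (A *ᵥ u) i ^ 2 := by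
    intro u
    rw [h.qf_eq, mulVec_mulVec, mulVec_mulVec, hAdef]
  have hA2 : ∀ i j, d i * A i j ^ 2 ≤ 2 * d' j := by
    intro i j
    have h3 := h1 (M' *ᵥ Pi.single j 1)
    rw [hmA, h'.qf_mulVec] at h3
    simp only [mulVec_single_one, col_apply, Pi.single_apply, ite_pow, one_pow, ne_eq,
      OfNat.ofNat_ne_zero, not_false_eq_true, zero_pow, mul_ite, mul_one, mul_zero,
      Finset.sum_ite_eq', Finset.mem_univ, if_true] at h3
    have h4 := Finset.single_le_sum (f := fun i => d i * A i j ^ 2)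
      (fun i _ => mul_nonneg (h.pos i).le (sq_nonneg _)) (Finset.mem_univ i)
    have := h'.pos j
    nlinarith
  have hA'2 : ∀ i j, d' j * A' j i ^ 2 ≤ 2 * d i := by
    intro i j
    have h3 := h2 (gR' *ᵥ (M *ᵥ Pi.single i 1))
    rw [mulVec_mulVec _ gR gR', hgg, one_mulVec, h.qf_mulVec, h'.qf_eq, mulVec_mulVec,
      mulVec_mulVec, ← hA'def] at h3
    simp only [mulVec_single_one, col_apply, Pi.single_apply, ite_pow, one_pow, ne_eq,
      OfNat.ofNat_ne_zero, not_false_eq_true, zero_pow, mul_ite, mul_one, mul_zero,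
      Finset.sum_ite_eq', Finset.mem_univ, if_true] at h3
    have h4 := Finset.single_le_sum (f := fun j => d' j * A' j i ^ 2)
      (fun i _ => mul_nonneg (h'.pos i).le (sq_nonneg _)) (Finset.mem_univ j)
    have := h.pos i
    nlinarith
  -- the defect of orthogonality
  set F := Aᵀ * diagonal d * A - diagonal d' with hF
  have hFT : Fᵀ = F := by simp [hF, Matrix.mul_assoc]
  have hFq : ∀ u, |qf F u| ≤ ε * ∑ i, d' i * u i ^ 2 := by
    intro u
    rw [hF, qf_sub, qf_transpose_mul_mul, qf_diagonal, qf_diagonal, ← hmA]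
    have h3 := h1 (M' *ᵥ u)
    have h4 := h2 (M' *ᵥ u)
    rw [h'.qf_mulVec] at h3 h4
    have h5 : 0 ≤ ∑ i, d' i * u i ^ 2 :=
      Finset.sum_nonneg fun i _ => mul_nonneg (h'.pos i).le (sq_nonneg _)
    rw [abs_le]
    constructor <;> nlinarith
  have hFe : ∀ i j, |F i j| ≤ 2 * ε * δ := by
    intro i j
    have h3 := four_mul_entry hFT i j
    have h4 : ∀ u : ι → ℝ, u = Pi.single i 1 + Pi.single j 1 ∨ u = Pi.single i 1 - Pi.single j 1 →
        ∑ k, d' k * u k ^ 2 ≤ 4 * δ := by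
      intro u hu
      have h5 : ∀ k, d' k * u k ^ 2 ≤
          δ * (2 * ((Pi.single i (1 : ℝ) : ι → ℝ) k + (Pi.single j (1 : ℝ) : ι → ℝ) k)) := by
        intro k
        refine mul_le_mul (hd'δ k) ?_ (sq_nonneg _) hδ.le
        rcases hu with rfl | rfl <;> simp only [Pi.add_apply, Pi.sub_apply, Pi.single_apply] <;>
          split_ifs <;> norm_num
      refine (Finset.sum_le_sum fun k _ => h5 k).trans (le_of_eq ?_)
      rw [← Finset.mul_sum, ← Finset.mul_sum, Finset.sum_add_distrib]
      simp; ring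
    have h5 := (hFq _).trans (mul_le_mul_of_nonneg_left (h4 _ (Or.inl rfl)) hε)
    have h6 := (hFq _).trans (mul_le_mul_of_nonneg_left (h4 _ (Or.inr rfl)) hε)
    rw [abs_le] at h5 h6 ⊢
    constructor <;> linarith
  have hAb : ∀ i j, |A i j| ≤ 2 * T ^ (2 * Fintype.card ι + 1) := by
    intro i j
    have hTk : 1 ≤ T ^ (2 * Fintype.card ι + 1) := one_le_pow₀ hT
    by_cases hij : d' j ≤ T ^ (2 * Fintype.card ι + 1) * d i
    · have h3 : A i j ^ 2 ≤ 2 * T ^ (2 * Fintype.card ι + 1) := by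
        have := hA2 i j
        refine le_of_mul_le_mul_left ?_ (h.pos i)
        linarith
      apply abs_le_of_sq_le_sq _ (by linarith)
      nlinarith
    · have hz : A' j i = 0 :=
        transition_eq_zero h h' hT hcT hTc (G := g') hA'2 (not_le.1 hij)
      have h3 : Aᵀ * diagonal d = diagonal d' * A' + F * A' := by
        rw [← Matrix.add_mul, hF, add_sub_cancel, Matrix.mul_assoc, hAA, Matrix.mul_one]
      have h4 := congrFun (congrFun h3 j) i
      rw [mul_diagonal, transpose_apply, Matrix.add_apply, diagonal_mul, hz, mul_zero, zero_add,
        Matrix.mul_apply] at h4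
      have hA'e : ∀ l, |A' l i| ≤ 2 * δ := by
        intro l
        apply abs_le_of_sq_le_sq _ (by linarith)
        have h5 := hA'2 i l
        have h6 := hd'δ' l
        have h7 := hdδ' i
        have h8 : δ * d' l * A' l i ^ 2 ≤ δ * (2 * δ) := by
          rw [mul_assoc]; exact mul_le_mul_of_nonneg_left (by linarith) hδ.le
        nlinarith [sq_nonneg (A' l i)]
      have h5 : |A i j * d i| ≤ Fintype.card ι * (2 * ε * δ * (2 * δ)) := by
        rw [h4]
        refine abs_sum_mul_le fun l => ?_
        rw [abs_mul]
        exact mul_le_mul (hFe j l) (hA'e l) (abs_nonneg _) (by positivity)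
      rw [abs_mul, abs_of_pos (h.pos i)] at h5
      have h6 : |A i j| ≤ 1 := by
        have h7 : |A i j| * 1 ≤ |A i j| * (δ * d i) :=
          mul_le_mul_of_nonneg_left (hdδ i) (abs_nonneg _)
        have h8 : δ * (|A i j| * d i) ≤ δ * (Fintype.card ι * (2 * ε * δ * (2 * δ))) :=
          mul_le_mul_of_nonneg_left h5 hδ.le
        nlinarith
      linarith
  have hG : gR = M * A * N' := by
    calc gR = (M * N) * gR * (M' * N') := by
          rw [h'.mul_eq_one, h.mul_eq_one, Matrix.one_mul, Matrix.mul_one]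
      _ = _ := by simp only [hAdef, Matrix.mul_assoc]
  have hx : ∀ k l, |M a k * A k l * N' l b| ≤ c * (2 * T ^ (2 * Fintype.card ι + 1)) * c := by
    intro k l
    rw [abs_mul, abs_mul]
    have := h.abs_le a k
    have := h'.abs_inv_le l b
    have := hAb k l
    gcongr
  have h9 := abs_mul_mul_apply_le hx
  rw [← hG] at h9
  simpa [hgR] using h9

end Reduced


/-! ### Siegel space -/

section Siegel

open Matrix

section PosDef

variable {ι : Type*} [Fintype ι]

lemma posDef_iff_qf {Q : Matrix ι ι ℝ} : Q.PosDef ↔ Qᵀ = Q ∧ ∀ u, u ≠ 0 → 0 < qf Q u := by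
  rw [posDef_iff_dotProduct_mulVec]
  simp only [IsHermitian, conjTranspose_eq_transpose_of_trivial, star_trivial, qf]

lemma qf_add_left (P Q : Matrix ι ι ℝ) (u : ι → ℝ) : qf (P + Q) u = qf P u + qf Q u := by
  simp [qf, add_mulVec, dotProduct_add]

lemma qf_smul_left (Q : Matrix ι ι ℝ) (t : ℝ) (u : ι → ℝ) : qf (t • Q) u = t * qf Q u := by
  simp [qf, smul_mulVec, dotProduct_smul]

lemma dotProduct_mulVec_comm {Q : Matrix ι ι ℝ} (hQ : Qᵀ = Q) (u v : ι → ℝ) :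
    u ⬝ᵥ Q *ᵥ v = v ⬝ᵥ Q *ᵥ u := by
  rw [dotProduct_mulVec, ← mulVec_transpose, hQ, dotProduct_comm]

lemma qf_add {Q : Matrix ι ι ℝ} (hQ : Qᵀ = Q) (u v : ι → ℝ) :
    qf Q (u + v) = qf Q u + 2 * (u ⬝ᵥ Q *ᵥ v) + qf Q v := by
  simp only [qf, mulVec_add, dotProduct_add, add_dotProduct]
  rw [dotProduct_mulVec_comm hQ v u]; ring

variable {Q : Matrix ι ι ℝ}

lemma qf_nonneg (hQ : Q.PosDef) (u : ι → ℝ) : 0 ≤ qf Q u := by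
  by_cases hu : u = 0
  · simp [hu, qf]
  · exact ((posDef_iff_qf.1 hQ).2 u hu).le

lemma _root_.Matrix.PosDef.transpose_eq (hQ : Q.PosDef) : Qᵀ = Q := (posDef_iff_qf.1 hQ).1

lemma posDef_transpose_mul_mul {ι' : Type*} [Fintype ι'] [DecidableEq ι'] (hQ : Q.PosDef)
    {A : Matrix ι ι' ℝ} {B : Matrix ι' ι ℝ} (hBA : B * A = 1) : (Aᵀ * Q * A).PosDef := by
  refine posDef_iff_qf.2 ⟨by simp [hQ.transpose_eq, Matrix.mul_assoc], fun u hu => ?_⟩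
  rw [qf_transpose_mul_mul]
  refine (posDef_iff_qf.1 hQ).2 _ fun h => hu ?_
  rw [← one_mulVec u, ← hBA, ← mulVec_mulVec, h, mulVec_zero]

variable [DecidableEq ι]

lemma posDef_mul_inv (hQ : Q.PosDef) : Q * Q⁻¹ = 1 :=
  mul_nonsing_inv _ ((isUnit_iff_isUnit_det _).1 hQ.isUnit)

lemma posDef_inv_mul (hQ : Q.PosDef) : Q⁻¹ * Q = 1 := mul_eq_one_comm.1 (posDef_mul_inv hQ)

lemma le_qf_inv (hQ : Q.PosDef) (z v : ι → ℝ) : 2 * (z ⬝ᵥ v) - qf Q z ≤ qf Q⁻¹ v := by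
  have h1 := qf_nonneg hQ (z + -(Q⁻¹ *ᵥ v))
  rw [qf_add hQ.transpose_eq] at h1
  have h2 : qf Q (-(Q⁻¹ *ᵥ v)) = qf Q⁻¹ v := by
    simp only [qf, mulVec_neg, mulVec_mulVec, posDef_mul_inv hQ, one_mulVec, dotProduct_neg,
      neg_dotProduct, neg_neg]
    exact dotProduct_comm _ _
  rw [h2, mulVec_neg, mulVec_mulVec, posDef_mul_inv hQ, one_mulVec, dotProduct_neg] at h1
  linarith

lemma qf_inv_eq (hQ : Q.PosDef) (v : ι → ℝ) :
    qf Q⁻¹ v = 2 * ((Q⁻¹ *ᵥ v) ⬝ᵥ v) - qf Q (Q⁻¹ *ᵥ v) := by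
  simp only [qf, mulVec_mulVec, posDef_mul_inv hQ, one_mulVec]
  rw [dotProduct_comm v]; ring

/-- The matrix-fractional function `(Y, v) ↦ v ⬝ᵥ Y⁻¹ *ᵥ v` is convex. -/
lemma qf_inv_convex {P : Matrix ι ι ℝ} (hP : P.PosDef) (hQ : Q.PosDef) {s t : ℝ} (hs : 0 ≤ s)
    (ht : 0 ≤ t) (hPQ : (s • P + t • Q).PosDef) (v w : ι → ℝ) :
    qf (s • P + t • Q)⁻¹ (s • v + t • w) ≤ s * qf P⁻¹ v + t * qf Q⁻¹ w := by
  rw [qf_inv_eq hPQ]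
  set z := (s • P + t • Q)⁻¹ *ᵥ (s • v + t • w)
  rw [qf_add_left, qf_smul_left, qf_smul_left, dotProduct_add, dotProduct_smul, dotProduct_smul,
    smul_eq_mul, smul_eq_mul]
  have h1 := mul_le_mul_of_nonneg_left (le_qf_inv hP z v) hs
  have h2 := mul_le_mul_of_nonneg_left (le_qf_inv hQ z w) ht
  linarith

end PosDef

variable {κ : Type*} [Fintype κ] [DecidableEq κ]

/-- Positive definite symmetric matrices that are symplectic. -/
def SiegelForm (Q : Matrix (κ ⊕ κ) (κ ⊕ κ) ℝ) : Prop := Q.PosDef ∧ Q * J κ ℝ * Q = J κ ℝ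

lemma siegelForm_one : SiegelForm (1 : Matrix (κ ⊕ κ) (κ ⊕ κ) ℝ) :=
  ⟨PosDef.one, by simp⟩

lemma J_transpose_mul_self : (J κ ℝ)ᵀ * J κ ℝ = 1 := by
  rw [J_transpose, Matrix.neg_mul, J_squared, neg_neg]

lemma dotProduct_J_mulVec (u v : κ ⊕ κ → ℝ) : (J κ ℝ *ᵥ u) ⬝ᵥ (J κ ℝ *ᵥ v) = u ⬝ᵥ v := by
  rw [dotProduct_mulVec, ← mulVec_transpose, mulVec_mulVec, J_transpose_mul_self, one_mulVec]

/-- Comparisons between symplectic quadratic forms are symmetric. -/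
lemma SiegelForm.flip {P Q : Matrix (κ ⊕ κ) (κ ⊕ κ) ℝ} (hP : SiegelForm P) (hQ : SiegelForm Q)
    {a : ℝ} (ha : 0 < a) (h : ∀ u, qf P u ≤ a * qf Q u) (u : κ ⊕ κ → ℝ) :
    qf Q u ≤ a * qf P u := by
  set v := J κ ℝ *ᵥ (Q *ᵥ u) with hv
  have h1 := qf_nonneg hP.1 (u + (1 / a) • (J κ ℝ *ᵥ (P *ᵥ v)))
  have h2 : ∀ {W : Matrix (κ ⊕ κ) (κ ⊕ κ) ℝ}, SiegelForm W → ∀ w,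
      W *ᵥ (J κ ℝ *ᵥ (W *ᵥ w)) = J κ ℝ *ᵥ w := by
    intro W hW w
    rw [mulVec_mulVec, mulVec_mulVec, hW.2]
  have h3 : qf P (J κ ℝ *ᵥ (P *ᵥ v)) = qf P v := by
    rw [qf, h2 hP, dotProduct_J_mulVec, dotProduct_comm, qf]
  have h4 : qf Q v = qf Q u := by
    rw [hv, qf, h2 hQ, dotProduct_J_mulVec, dotProduct_comm, qf]
  have h5 : u ⬝ᵥ P *ᵥ (J κ ℝ *ᵥ (P *ᵥ v)) = - qf Q u := by
    rw [h2 hP, hv, mulVec_mulVec, J_squared, neg_mulVec, one_mulVec, dotProduct_neg, qf]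
  rw [qf_add hP.1.transpose_eq, qf_smul, h3, mulVec_smul, dotProduct_smul, h5, smul_eq_mul] at h1
  have h6 : (1 / a) ^ 2 * qf P v ≤ (1 / a) * qf Q u := by
    calc (1 / a) ^ 2 * qf P v ≤ (1 / a) ^ 2 * (a * qf Q v) :=
          mul_le_mul_of_nonneg_left (h v) (by positivity)
      _ = _ := by rw [h4]; field_simp
  have h7 : (1 / a) * qf Q u ≤ qf P u := by linarith
  rw [one_div, inv_mul_le_iff₀ ha] at h7
  exact h7

lemma SiegelForm.transpose_mul_mul {Q : Matrix (κ ⊕ κ) (κ ⊕ κ) ℝ} (hQ : SiegelForm Q)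
    {A : Matrix (κ ⊕ κ) (κ ⊕ κ) ℝ} (hA : A ∈ symplecticGroup κ ℝ) : SiegelForm (Aᵀ * Q * A) := by
  have h1 : A * J κ ℝ * Aᵀ = J κ ℝ := SymplecticGroup.mem_iff.1 hA
  have h2 : Aᵀ * J κ ℝ * A = J κ ℝ := SymplecticGroup.mem_iff'.1 hA
  refine ⟨posDef_transpose_mul_mul hQ.1 (B := -(J κ ℝ) * Aᵀ * J κ ℝ) ?_, ?_⟩
  · calc _ = -(J κ ℝ) * (Aᵀ * J κ ℝ * A) := by simp only [Matrix.mul_assoc]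
      _ = 1 := by rw [h2, Matrix.neg_mul, J_squared, neg_neg]
  · calc _ = Aᵀ * (Q * (A * J κ ℝ * Aᵀ) * Q) * A := by simp only [Matrix.mul_assoc]
      _ = _ := by rw [h1, hQ.2, h2]

/-- Siegel space, as a convex set: `X` symmetric, `Y` positive definite. -/
def siegelSpace (κ : Type*) [Fintype κ] : Set (Matrix κ κ ℝ × Matrix κ κ ℝ) :=
  {p | p.1ᵀ = p.1 ∧ p.2.PosDef}

lemma convex_siegelSpace : Convex ℝ (siegelSpace κ) := by
  intro p hp q hq s t hs ht hst
  refine ⟨by simp [hp.1, hq.1], ?_⟩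
  refine posDef_iff_qf.2 ⟨by simp [hp.2.transpose_eq, hq.2.transpose_eq], fun u hu => ?_⟩
  simp only [Prod.snd_add, Prod.smul_snd]
  rw [qf_add_left, qf_smul_left, qf_smul_left]
  have h1 := (posDef_iff_qf.1 hp.2).2 u hu
  have h2 := (posDef_iff_qf.1 hq.2).2 u hu
  rcases hs.eq_or_lt with rfl | hs
  · rw [zero_add] at hst; subst hst; simpa
  · have := mul_pos hs h1
    have := mul_nonneg ht h2.le
    linarith

/-- The symplectic quadratic form attached to a point of Siegel space. -/
noncomputable def form (p : Matrix κ κ ℝ × Matrix κ κ ℝ) : Matrix (κ ⊕ κ) (κ ⊕ κ) ℝ :=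
  (fromBlocks 1 0 p.1 1)ᵀ * fromBlocks p.2 0 0 p.2⁻¹ * fromBlocks 1 0 p.1 1

lemma qf_fromBlocks_diag (A B : Matrix κ κ ℝ) (u : κ ⊕ κ → ℝ) :
    qf (fromBlocks A 0 0 B) u = qf A (u ∘ Sum.inl) + qf B (u ∘ Sum.inr) := by
  simp only [qf, fromBlocks_mulVec, zero_mulVec, add_zero, zero_add, dotProduct,
    Fintype.sum_sum_type, Sum.elim_inl, Sum.elim_inr, Function.comp]

lemma qf_form (p : Matrix κ κ ℝ × Matrix κ κ ℝ) (u : κ ⊕ κ → ℝ) :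
    qf (form p) u = qf p.2 (u ∘ Sum.inl) + qf p.2⁻¹ (p.1 *ᵥ (u ∘ Sum.inl) + u ∘ Sum.inr) := by
  rw [form, qf_transpose_mul_mul, qf_fromBlocks_diag, fromBlocks_mulVec]
  simp only [Sum.elim_comp_inl, Sum.elim_comp_inr, one_mulVec, zero_mulVec, add_zero]

lemma siegelForm_fromBlocks_diag {Y : Matrix κ κ ℝ} (hY : Y.PosDef) :
    SiegelForm (fromBlocks Y 0 0 Y⁻¹) := by
  refine ⟨posDef_iff_qf.2 ⟨?_, fun u hu => ?_⟩, ?_⟩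
  · rw [fromBlocks_transpose, hY.transpose_eq, hY.inv.transpose_eq]; simp
  · rw [qf_fromBlocks_diag]
    by_cases h : u ∘ Sum.inl = 0
    · refine add_pos_of_nonneg_of_pos (qf_nonneg hY _) ((posDef_iff_qf.1 hY.inv).2 _ fun h' => hu ?_)
      ext (i | i)
      exacts [congrFun h i, congrFun h' i]
    · exact add_pos_of_pos_of_nonneg ((posDef_iff_qf.1 hY).2 _ h) (qf_nonneg hY.inv _)
  · simp [J, fromBlocks_multiply, posDef_mul_inv hY, posDef_inv_mul hY]

lemma lower_mem_symplecticGroup {R : Type*} [CommRing R] {X : Matrix κ κ R} (hX : Xᵀ = X) :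
    fromBlocks 1 0 X 1 ∈ symplecticGroup κ R := by
  rw [SymplecticGroup.mem_iff]
  simp [J, fromBlocks_multiply, fromBlocks_transpose, hX]

lemma siegelForm_form {p : Matrix κ κ ℝ × Matrix κ κ ℝ} (hp : p ∈ siegelSpace κ) :
    SiegelForm (form p) :=
  (siegelForm_fromBlocks_diag hp.2).transpose_mul_mul (lower_mem_symplecticGroup hp.1)

/-- The symplectic quadratic form is convex on Siegel space. -/
lemma qf_form_convex {p q : Matrix κ κ ℝ × Matrix κ κ ℝ} (hp : p ∈ siegelSpace κ)
    (hq : q ∈ siegelSpace κ) {s t : ℝ} (hs : 0 ≤ s) (ht : 0 ≤ t) (hst : s + t = 1)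
    (u : κ ⊕ κ → ℝ) : qf (form (s • p + t • q)) u ≤ s * qf (form p) u + t * qf (form q) u := by
  have h1 := convex_siegelSpace hp hq hs ht hst
  simp only [qf_form, Prod.snd_add, Prod.smul_snd, Prod.fst_add, Prod.smul_fst]
  have h2 := qf_inv_convex hp.2 hq.2 hs ht h1.2 (p.1 *ᵥ (u ∘ Sum.inl) + u ∘ Sum.inr)
    (q.1 *ᵥ (u ∘ Sum.inl) + u ∘ Sum.inr)
  have h3 : s • (p.1 *ᵥ (u ∘ Sum.inl) + u ∘ Sum.inr) + t • (q.1 *ᵥ (u ∘ Sum.inl) + u ∘ Sum.inr) =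
      (s • p.1 + t • q.1) *ᵥ (u ∘ Sum.inl) + u ∘ Sum.inr := by
    have : u ∘ Sum.inr = s • (u ∘ Sum.inr) + t • (u ∘ Sum.inr) := by
      rw [← add_smul, hst, one_smul]
    conv_rhs => rw [this]
    rw [add_mulVec, smul_mulVec, smul_mulVec, smul_add, smul_add]
    abel
  rw [h3] at h2
  rw [qf_add_left, qf_smul_left, qf_smul_left]
  linarith

/-- Every symplectic quadratic form comes from a point of Siegel space. -/
lemma SiegelForm.exists_form {Q : Matrix (κ ⊕ κ) (κ ⊕ κ) ℝ} (hQ : SiegelForm Q) :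
    ∃ p ∈ siegelSpace κ, form p = Q := by
  obtain ⟨A, B, C, D, rfl⟩ : ∃ A B C D, Q = fromBlocks A B C D :=
    ⟨_, _, _, _, (fromBlocks_toBlocks Q).symm⟩
  have hT := hQ.1.transpose_eq
  rw [fromBlocks_transpose, fromBlocks_inj] at hT
  obtain ⟨-, hCT, -, -⟩ := hT
  have hD : D.PosDef := by
    have := hQ.1.submatrix (e := (Sum.inr : κ → κ ⊕ κ)) Sum.inr_injective
    exact this
  have hJ := hQ.2
  simp only [J, fromBlocks_multiply, Matrix.mul_zero, Matrix.mul_one, Matrix.mul_neg, zero_add,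
    add_zero, Matrix.neg_mul, fromBlocks_inj] at hJ
  obtain ⟨-, h12, -, h22⟩ := hJ
  have hDD := posDef_inv_mul hD
  have hDD' := posDef_mul_inv hD
  have hDT := hD.inv.transpose_eq
  have hXT : D⁻¹ * C = B * D⁻¹ := by
    have h1 : D * B = C * D := by
      rw [← sub_eq_zero, ← h22]; abel
    calc D⁻¹ * C = D⁻¹ * (C * D) * D⁻¹ := by
          rw [Matrix.mul_assoc, Matrix.mul_assoc, hDD', Matrix.mul_one]
      _ = _ := by rw [← h1, ← Matrix.mul_assoc, hDD, Matrix.one_mul]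
  have hBT : (B * D⁻¹)ᵀ = B * D⁻¹ := by
    rw [transpose_mul, hDT, ← hCT, transpose_transpose, hXT, hCT]
  refine ⟨(B * D⁻¹, D⁻¹), ⟨hBT, hD.inv⟩, ?_⟩
  · have hii : (D⁻¹)⁻¹ = D := nonsing_inv_nonsing_inv _ ((isUnit_iff_isUnit_det _).1 hD.isUnit)
    have hA : A = D⁻¹ + B * D⁻¹ * D * (B * D⁻¹) := by
      have h1 : A * D = 1 + B * B := by
        have : B * B - A * D = -1 := by rw [← h12]; abel
        have h2 : A * D = B * B - (B * B - A * D) := by abel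
        rw [h2, this]; abel
      calc A = A * D * D⁻¹ := by rw [Matrix.mul_assoc, hDD', Matrix.mul_one]
        _ = _ := by
          rw [h1, Matrix.add_mul, Matrix.one_mul, Matrix.mul_assoc B D⁻¹ D, hDD, Matrix.mul_one,
            Matrix.mul_assoc]
    have hB : B * D⁻¹ * D = B := by rw [Matrix.mul_assoc, hDD, Matrix.mul_one]
    have hC : D * (B * D⁻¹) = C := by
      rw [← hXT, ← Matrix.mul_assoc, hDD', Matrix.one_mul]
    simp only [form, fromBlocks_transpose, hBT, hii, fromBlocks_multiply]
    rw [hB] at hA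
    simp [hB, hC, ← hA]

/-- Two points of a segment of Siegel space are close. -/
lemma qf_form_segment_le {p q : Matrix κ κ ℝ × Matrix κ κ ℝ} (hp : p ∈ siegelSpace κ)
    (hq : q ∈ siegelSpace κ) {K s t : ℝ} (hs : 0 ≤ s) (ht : 0 ≤ t) (hst : s + t = 1)
    (h : ∀ u, qf (form q) u ≤ K * qf (form p) u) (u : κ ⊕ κ → ℝ) :
    qf (form (s • p + t • q)) u ≤ (1 + t * K) * qf (form p) u := by
  have h1 := qf_form_convex hp hq hs ht hst u
  have h2 := mul_le_mul_of_nonneg_left (h u) ht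
  have h3 := mul_nonneg ht (qf_nonneg (siegelForm_form hp).1 u)
  have h4 : s = 1 - t := by linarith
  rw [h4] at h1 ⊢
  linarith

/-- The set of points of Siegel space at bounded distance from the base point. -/
def siegelBall (κ : Type*) [Fintype κ] [DecidableEq κ] (Λ : ℝ) :
    Set (Matrix κ κ ℝ × Matrix κ κ ℝ) :=
  {p | p ∈ siegelSpace κ ∧ ∀ u, qf (form p) u ≤ Λ * (u ⬝ᵥ u)}

lemma convex_siegelBall (Λ : ℝ) : Convex ℝ (siegelBall κ Λ) := by
  intro p hp q hq s t hs ht hst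
  refine ⟨convex_siegelSpace hp.1 hq.1 hs ht hst, fun u => ?_⟩
  have h1 := qf_form_convex hp.1 hq.1 hs ht hst u
  have h2 := mul_le_mul_of_nonneg_left (hp.2 u) hs
  have h3 := mul_le_mul_of_nonneg_left (hq.2 u) ht
  have h4 : s * (Λ * (u ⬝ᵥ u)) + t * (Λ * (u ⬝ᵥ u)) = Λ * (u ⬝ᵥ u) := by
    rw [← add_mul, hst, one_mul]
  linarith

variable {p q : Matrix κ κ ℝ × Matrix κ κ ℝ} {Λ : ℝ}

lemma le_qf_form (hΛ : 0 < Λ) (hp : p ∈ siegelBall κ Λ) (u : κ ⊕ κ → ℝ) :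
    u ⬝ᵥ u ≤ Λ * qf (form p) u := by
  have := (siegelForm_form hp.1).flip siegelForm_one hΛ
    (fun u => by rw [qf_one]; exact hp.2 u) u
  rwa [qf_one] at this

lemma qf_form_le_of_mem_ball (hΛ : 0 < Λ) (hp : p ∈ siegelBall κ Λ) (hq : q ∈ siegelBall κ Λ)
    (u : κ ⊕ κ → ℝ) : qf (form q) u ≤ Λ ^ 2 * qf (form p) u := by
  have h1 := hq.2 u
  have h2 := mul_le_mul_of_nonneg_left (le_qf_form hΛ hp u) hΛ.le
  nlinarith

/-- The `j`-th point of the subdivision of a segment into `m` pieces. -/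
noncomputable def seg {E : Type*} [AddCommGroup E] [Module ℝ E] (m : ℕ) (p q : E) (j : ℕ) : E :=
  (1 - j / m : ℝ) • p + (j / m : ℝ) • q

lemma seg_zero {E : Type*} [AddCommGroup E] [Module ℝ E] (m : ℕ) (p q : E) : seg m p q 0 = p := by
  simp [seg]

lemma seg_self {E : Type*} [AddCommGroup E] [Module ℝ E] {m : ℕ} (hm : 0 < m) (p q : E) :
    seg m p q m = q := by
  have : (m : ℝ) ≠ 0 := by positivity
  simp [seg, this]

lemma seg_comm {E : Type*} [AddCommGroup E] [Module ℝ E] (m : ℕ) (o p q : E) (j k : ℕ) :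
    seg m o (seg m p q j) k = seg m (seg m o p k) (seg m o q k) j := by
  simp only [seg]
  module

lemma seg_mem {E : Type*} [AddCommGroup E] [Module ℝ E] {s : Set E} (hs : Convex ℝ s) {m : ℕ}
    {p q : E} (hp : p ∈ s) (hq : q ∈ s) {j : ℕ} (hj : j ≤ m) : seg m p q j ∈ s := by
  refine hs hp hq ?_ (by positivity) (by ring)
  rw [sub_nonneg]
  exact div_le_one_of_le₀ (by exact_mod_cast hj) (by positivity)

/-- Consecutive points of a subdivided segment are close. -/
lemma seg_near (hΛ : 0 < Λ) (hp : p ∈ siegelBall κ Λ) (hq : q ∈ siegelBall κ Λ) {m j : ℕ}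
    (hj : j < m) :
    (∀ u, qf (form (seg m p q j)) u ≤ (1 + 2 * Λ ^ 2 / m) * qf (form (seg m p q (j + 1))) u) ∧
    ∀ u, qf (form (seg m p q (j + 1))) u ≤ (1 + 2 * Λ ^ 2 / m) * qf (form (seg m p q j)) u := by
  have hm : (0 : ℝ) < m := by exact_mod_cast (by omega : 0 < m)
  have hx := seg_mem (convex_siegelBall Λ) hp hq hj.le
  have hy := seg_mem (convex_siegelBall Λ) hp hq (Nat.succ_le_of_lt hj)
  have hε : 0 < 1 + 2 * Λ ^ 2 / m := by positivity
  have aux : ∀ {x y e : Matrix κ κ ℝ × Matrix κ κ ℝ} {t : ℝ}, x ∈ siegelBall κ Λ →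
      e ∈ siegelBall κ Λ → 0 ≤ t → t ≤ 1 → t ≤ 2 / m → y = (1 - t) • x + t • e →
      ∀ u, qf (form y) u ≤ (1 + 2 * Λ ^ 2 / m) * qf (form x) u := by
    intro x y e t hx he ht0 ht1 ht hy u
    rw [hy]
    refine (qf_form_segment_le hx.1 he.1 (by linarith) ht0 (by ring)
      (qf_form_le_of_mem_ball hΛ hx he) u).trans ?_
    refine mul_le_mul_of_nonneg_right ?_ (qf_nonneg (siegelForm_form hx.1).1 u)
    have := mul_le_mul_of_nonneg_right ht (sq_nonneg Λ)
    have h2 : 2 / (m : ℝ) * Λ ^ 2 = 2 * Λ ^ 2 / m := by ring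
    linarith
  by_cases hc : m ≤ 2 * (m - j)
  · have hmj : (0 : ℝ) < m - j := by rw [sub_pos]; exact_mod_cast hj
    have hmj1 : (1 : ℝ) ≤ m - j := by
      rw [le_sub_iff_add_le, add_comm]; exact_mod_cast hj
    have hc' : (m : ℝ) ≤ 2 * (m - j) := by
      have : ((m - j : ℕ) : ℝ) = m - j := by rw [Nat.cast_sub hj.le]
      rw [← this]; exact_mod_cast hc
    have h := aux (y := seg m p q (j + 1)) (t := 1 / (m - j)) hx hq (by positivity)
      (by rw [div_le_one hmj]; exact hmj1) (by rw [div_le_div_iff₀ hmj hm]; linarith) (by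
        have h1 : (1 - 1 / (m - j) : ℝ) * (j / m) + 1 / (m - j) = (j + 1) / m := by
          field_simp; ring
        have h2 : (1 - 1 / (m - j) : ℝ) * (1 - j / m) = 1 - (j + 1) / m := by
          field_simp; ring
        simp only [seg, Nat.cast_add, Nat.cast_one]
        rw [← h2, ← h1]
        module)
    exact ⟨fun u => (siegelForm_form hy.1).flip (siegelForm_form hx.1) hε h u, h⟩
  · have hj1 : (0 : ℝ) < j + 1 := by positivity
    have hc' : (m : ℝ) ≤ 2 * (j + 1) := by
      exact_mod_cast (by omega : m ≤ 2 * (j + 1))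
    have h := aux (y := seg m p q j) (t := 1 / (j + 1)) hy hp (by positivity)
      (by rw [div_le_one hj1]; linarith [Nat.cast_nonneg (α := ℝ) j])
      (by rw [div_le_div_iff₀ hj1 hm]; linarith) (by
        have h1 : (1 - 1 / (j + 1) : ℝ) * ((j + 1) / m) = j / m := by
          field_simp; ring
        have h2 : (1 - 1 / (j + 1) : ℝ) * (1 - (j + 1) / m) + 1 / (j + 1) = 1 - j / m := by
          field_simp; ring
        simp only [seg]
        push_cast
        rw [← h2, ← h1]
        module)
    exact ⟨h, fun u => (siegelForm_form hx.1).flip (siegelForm_form hy.1) hε h u⟩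

end Siegel


/-! ### Reduction of positive definite forms under integral changes of basis -/

section Reduction

open Matrix

lemma exists_le_two_mul {α : Type*} [Nonempty α] (f : α → ℝ) {lo : ℝ} (hl : 0 < lo)
    (hf : ∀ a, lo ≤ f a) : ∃ a, ∀ b, f a ≤ 2 * f b := by
  have hbdd : BddBelow (Set.range f) := ⟨lo, by rintro _ ⟨a, rfl⟩; exact hf a⟩
  have h1 : lo ≤ iInf f := le_ciInf hf
  obtain ⟨a, ha⟩ := exists_lt_of_ciInf_lt (show iInf f < 2 * iInf f by linarith)
  exact ⟨a, fun b => ha.le.trans (by linarith [ciInf_le hbdd b])⟩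

section Bounds

variable {ι : Type*} [Fintype ι]

lemma exists_qf_le (Q : Matrix ι ι ℝ) : ∃ K, 1 ≤ K ∧ ∀ u, qf Q u ≤ K * (u ⬝ᵥ u) := by
  refine ⟨1 + ∑ i, ∑ j, |Q i j|, ?_, fun u => ?_⟩
  · have : 0 ≤ ∑ i, ∑ j, |Q i j| :=
      Finset.sum_nonneg fun i _ => Finset.sum_nonneg fun j _ => abs_nonneg _
    linarith
  have hu : ∀ i, u i ^ 2 ≤ u ⬝ᵥ u := by
    intro i
    have := Finset.single_le_sum (f := fun i => u i * u i) (fun i _ => mul_self_nonneg _)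
      (Finset.mem_univ i)
    simpa [dotProduct, sq] using this
  have h0 : 0 ≤ u ⬝ᵥ u := Finset.sum_nonneg fun i _ => mul_self_nonneg (u i)
  obtain ⟨s, hs⟩ : ∃ s, s = u ⬝ᵥ u := ⟨_, rfl⟩
  rw [← hs] at hu h0 ⊢
  have h1 : qf Q u ≤ ∑ i, ∑ j, |Q i j| * s := by
    simp only [qf, dotProduct, mulVec, Finset.mul_sum]
    refine Finset.sum_le_sum fun i _ => Finset.sum_le_sum fun j _ => ?_
    have h2 : |u i * u j| ≤ s := by
      rw [abs_mul]
      nlinarith [hu i, hu j, sq_nonneg (|u i| - |u j|), sq_abs (u i), sq_abs (u j)]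
    calc u i * (Q i j * u j) = Q i j * (u i * u j) := by ring
      _ ≤ |Q i j * (u i * u j)| := le_abs_self _
      _ ≤ |Q i j| * s := by
        rw [abs_mul]; exact mul_le_mul_of_nonneg_left h2 (abs_nonneg _)
  simp only [← Finset.sum_mul] at h1
  linarith

variable [DecidableEq ι]

lemma exists_le_qf {Q : Matrix ι ι ℝ} (hQ : Q.PosDef) :
    ∃ lo, 0 < lo ∧ ∀ u, lo * (u ⬝ᵥ u) ≤ qf Q u := by
  obtain ⟨K, hK, h⟩ := exists_qf_le Q⁻¹
  have hK0 : 0 < K := by linarith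
  refine ⟨1 / K, by positivity, fun u => ?_⟩
  have h1 := le_qf_inv hQ.inv ((1 / K) • u) u
  rw [nonsing_inv_nonsing_inv _ ((isUnit_iff_isUnit_det _).1 hQ.isUnit), qf_smul,
    smul_dotProduct, smul_eq_mul] at h1
  have h2 := mul_le_mul_of_nonneg_left (h u) (sq_nonneg (1 / K))
  have h3 : (1 / K) ^ 2 * (K * (u ⬝ᵥ u)) = 1 / K * (u ⬝ᵥ u) := by field_simp
  linarith

end Bounds

/-- The real matrix underlying an integral one. -/
def intMat {m n : Type*} (A : Matrix m n ℤ) : Matrix m n ℝ := A.map (Int.cast : ℤ → ℝ)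

section intMat

variable {m n o p : Type*}

@[simp] lemma intMat_apply (A : Matrix m n ℤ) (i : m) (j : n) : intMat A i j = (A i j : ℝ) := rfl

lemma intMat_mul [Fintype n] (A : Matrix m n ℤ) (B : Matrix n o ℤ) :
    intMat (A * B) = intMat A * intMat B := Matrix.map_mul (f := Int.castRingHom ℝ)

@[simp] lemma intMat_one [DecidableEq n] : intMat (1 : Matrix n n ℤ) = 1 :=
  Matrix.map_one _ Int.cast_zero Int.cast_one

@[simp] lemma intMat_zero : intMat (0 : Matrix m n ℤ) = 0 := Matrix.map_zero _ Int.cast_zero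

lemma intMat_transpose (A : Matrix m n ℤ) : intMat Aᵀ = (intMat A)ᵀ := rfl

lemma intMat_fromBlocks (A : Matrix m n ℤ) (B : Matrix m o ℤ) (C : Matrix p n ℤ)
    (D : Matrix p o ℤ) :
    intMat (fromBlocks A B C D) = fromBlocks (intMat A) (intMat B) (intMat C) (intMat D) :=
  fromBlocks_map _ _ _ _ _

lemma one_le_dotProduct_of_int [Fintype m] {u : m → ℝ} (v : m → ℤ) (hv : ∀ i, u i = v i)
    (hu : u ≠ 0) : 1 ≤ u ⬝ᵥ u := by
  obtain ⟨i, hi⟩ := Function.ne_iff.1 hu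
  have h1 := Finset.single_le_sum (f := fun i => u i * u i) (fun i _ => mul_self_nonneg _)
    (Finset.mem_univ i)
  have h2 : (1 : ℝ) ≤ u i * u i := by
    rw [hv] at hi ⊢
    have : (v i) ≠ 0 := by simpa using hi
    have h3 : 0 < v i * v i := mul_self_pos.2 this
    exact_mod_cast h3
  exact h2.trans h1

end intMat

variable {ι κ : Type*} [Fintype ι] [Fintype κ] [DecidableEq ι] [DecidableEq κ]

lemma Reduced.submatrix {c : ℝ} {Q : Matrix ι ι ℝ} (h : Reduced c Q) (e : κ ≃ ι) :
    Reduced c (Q.submatrix e e) := by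
  obtain ⟨M, N, d, h⟩ := h
  refine ⟨M.submatrix e e, N.submatrix e e, d ∘ e, ?_, fun i => h.pos _, ?_, fun i j => h.abs_le _ _,
    fun i j => h.abs_inv_le _ _, fun i j => h.le_of_ne_zero _ _,
    fun i j => h.le_of_inv_ne_zero _ _⟩
  · rw [submatrix_mul_equiv, h.mul_eq_one, submatrix_one_equiv]
  · rw [transpose_submatrix, submatrix_mul_equiv, submatrix_mul_equiv, h.diag,
      submatrix_diagonal_equiv]

/-- Every positive definite form becomes reduced, with constant `c`, in some integral basis. -/
def HasReduction (c : ℝ) (κ : Type*) [Fintype κ] [DecidableEq κ] : Prop :=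
  ∀ Q : Matrix κ κ ℝ, Q.PosDef →
    ∃ U U' : Matrix κ κ ℤ, U * U' = 1 ∧ Reduced c ((intMat U)ᵀ * Q * intMat U)

lemma HasReduction.congr {c : ℝ} (h : HasReduction c ι) (e : ι ≃ κ) : HasReduction c κ := by
  intro Q hQ
  obtain ⟨U, U', hU, hred⟩ := h (Q.submatrix e e) (hQ.submatrix e.injective)
  refine ⟨U.submatrix e.symm e.symm, U'.submatrix e.symm e.symm, ?_, ?_⟩
  · rw [submatrix_mul_equiv, hU, submatrix_one_equiv]
  · convert hred.submatrix e.symm using 1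
    have h1 : intMat (U.submatrix e.symm e.symm) = (intMat U).submatrix e.symm e.symm := rfl
    have h2 : Q = (Q.submatrix e e).submatrix e.symm e.symm := by simp
    rw [h1, transpose_submatrix]
    conv_lhs => rw [h2]
    rw [submatrix_mul_equiv, submatrix_mul_equiv]

/-- A positive definite form splits off its first basis vector, if this vector is almost the
shortest one among all integral bases. -/
lemma HasReduction.unit_sum {c : ℝ} (hc : 1 ≤ c) (h : HasReduction c κ) :
    HasReduction (4 * (Fintype.card κ + 1) * c ^ 3) (Unit ⊕ κ) := by
  intro Q hQ
  obtain ⟨lo, hlo, hle⟩ := exists_le_qf hQ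
  let α := {U : Matrix (Unit ⊕ κ) (Unit ⊕ κ) ℤ // ∃ U', U * U' = 1}
  have : Nonempty α := ⟨⟨1, 1, by simp⟩⟩
  let e0 : Unit ⊕ κ := Sum.inl ()
  obtain ⟨⟨U, U', hU⟩, hmin⟩ := exists_le_two_mul
    (fun U : α => qf Q ((intMat U.1) *ᵥ Pi.single e0 1)) hlo (by
      rintro ⟨U, U', hU⟩
      refine le_trans ?_ (hle _)
      refine le_mul_of_one_le_right hlo.le (one_le_dotProduct_of_int (fun i => U i e0) ?_ ?_)
      · intro i; simp
      · intro h0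
        have h1 : intMat U' *ᵥ (intMat U *ᵥ Pi.single e0 1) = Pi.single e0 1 := by
          rw [mulVec_mulVec, ← intMat_mul, mul_eq_one_comm.1 hU, intMat_one, one_mulVec]
        rw [h0, mulVec_zero] at h1
        simpa using congrFun h1 e0)
  set Q1 := (intMat U)ᵀ * Q * intMat U with hQ1
  have hQ1P : Q1.PosDef := posDef_transpose_mul_mul hQ (B := intMat U') (by
    rw [← intMat_mul, mul_eq_one_comm.1 hU, intMat_one])
  have hmin1 : ∀ V V' : Matrix (Unit ⊕ κ) (Unit ⊕ κ) ℤ, V * V' = 1 →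
      Q1 e0 e0 ≤ 2 * qf Q1 (intMat V *ᵥ Pi.single e0 1) := by
    intro V V' hV
    have h1 := hmin ⟨U * V, V' * U', by
      rw [Matrix.mul_assoc, ← Matrix.mul_assoc V, hV, Matrix.one_mul, hU]⟩
    simp only at h1
    rw [← qf_transpose_mul_mul, qf_single, intMat_mul, ← mulVec_mulVec,
      ← qf_transpose_mul_mul] at h1
    exact h1
  clear_value Q1
  obtain ⟨q, b, b', S, rfl⟩ : ∃ q b b' S, Q1 = fromBlocks q b b' S :=
    ⟨_, _, _, _, (fromBlocks_toBlocks Q1).symm⟩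
  have hqP : q.PosDef := by
    have := hQ1P.submatrix (e := (Sum.inl : Unit → Unit ⊕ κ)) Sum.inl_injective
    exact this
  have hT := hQ1P.transpose_eq
  rw [fromBlocks_transpose, fromBlocks_inj] at hT
  obtain ⟨-, hb, -, -⟩ := hT
  have hqT := hqP.inv.transpose_eq
  -- the orthogonal complement of the first vector
  set x0 := q⁻¹ * b with hx0
  set S' := S - b' * x0 with hS'
  have hbq : x0ᵀ * q = b' := by
    rw [hx0, transpose_mul, hqT, Matrix.mul_assoc, posDef_inv_mul hqP, Matrix.mul_one, ← hb,
      transpose_transpose]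
  have hqx : q * x0 = b := by
    rw [hx0, ← Matrix.mul_assoc, posDef_mul_inv hqP, Matrix.one_mul]
  have hsplit : (fromBlocks 1 (-x0) 0 1)ᵀ * fromBlocks q b b' S * fromBlocks 1 (-x0) 0 1 =
      fromBlocks q 0 0 S' := by
    have hbx : x0ᵀ * b = b' * x0 := by rw [← hbq, Matrix.mul_assoc, hqx]
    simp [fromBlocks_transpose, fromBlocks_multiply, hbq, hqx, hS', hbx]
    abel
  have hS'P : S'.PosDef := by
    have h1 := posDef_transpose_mul_mul hQ1P (A := fromBlocks 1 (-x0) 0 1)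
      (B := fromBlocks 1 x0 0 1) (by simp [fromBlocks_multiply])
    rw [hsplit] at h1
    have := h1.submatrix (e := (Sum.inr : κ → Unit ⊕ κ)) Sum.inr_injective
    exact this
  obtain ⟨V, V', hV, M1, N1, d1, hred⟩ := h S' hS'P
  set y : Matrix Unit κ ℤ := fun i j => - round ((x0 * intMat V) i j) with hy
  set x := x0 * intMat V + intMat y with hx
  have hx2 : ∀ i j, |x i j| ≤ 1 / 2 := by
    intro i j
    have := abs_sub_round ((x0 * intMat V) i j)
    rw [hx, Matrix.add_apply, intMat_apply, hy, Int.cast_neg, ← sub_eq_add_neg]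
    exact this
  set E : Matrix (Unit ⊕ κ) (Unit ⊕ κ) ℤ := fromBlocks 1 y 0 V with hE
  set E' : Matrix (Unit ⊕ κ) (Unit ⊕ κ) ℤ := fromBlocks 1 (-(y * V')) 0 V' with hE'
  have hEE : E * E' = 1 := by
    simp [hE, hE', fromBlocks_multiply, hV]
  set M : Matrix (Unit ⊕ κ) (Unit ⊕ κ) ℝ := fromBlocks 1 (-(x * M1)) 0 M1 with hM
  set N : Matrix (Unit ⊕ κ) (Unit ⊕ κ) ℝ := fromBlocks 1 x 0 N1 with hN
  set d : Unit ⊕ κ → ℝ := Sum.elim (fun _ => q () ()) d1 with hd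
  have hMN : M * N = 1 := by
    simp [hM, hN, fromBlocks_multiply, hred.mul_eq_one, Matrix.mul_assoc]
  set Q3 := (intMat E)ᵀ * fromBlocks q b b' S * intMat E with hQ3
  have hdiag : Mᵀ * Q3 * M = diagonal d := by
    have h1 : intMat E * M = fromBlocks 1 (-x0) 0 1 * fromBlocks 1 0 0 (intMat V * M1) := by
      simp [hM, hE, intMat_fromBlocks, fromBlocks_multiply, hx, Matrix.add_mul, Matrix.mul_assoc]
    have h2 : q = diagonal (fun _ => q () ()) := by
      ext i j; simp
    calc Mᵀ * Q3 * M = (intMat E * M)ᵀ * fromBlocks q b b' S * (intMat E * M) := by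
          simp only [hQ3, transpose_mul, Matrix.mul_assoc]
      _ = (fromBlocks 1 0 0 (intMat V * M1))ᵀ * fromBlocks q 0 0 S' *
            fromBlocks 1 0 0 (intMat V * M1) := by
          rw [h1, ← hsplit]; simp only [transpose_mul, Matrix.mul_assoc]
      _ = fromBlocks q 0 0 (M1ᵀ * ((intMat V)ᵀ * S' * intMat V) * M1) := by
          simp [fromBlocks_transpose, fromBlocks_multiply, Matrix.mul_assoc]
      _ = _ := by rw [hred.diag, hd, ← fromBlocks_diagonal, ← h2]
  have hQ3N : Q3 = Nᵀ * diagonal d * N := eq_of_transpose_mul_mul_eq hMN hdiag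
  have hqpos : 0 < q () () := hqP.diag_pos
  have hm : (0 : ℝ) ≤ Fintype.card κ := by positivity
  have hc2 : 1 ≤ c ^ 2 := one_le_pow₀ hc
  have hc3 : c ≤ c ^ 3 := by nlinarith
  have hqd : ∀ j, q () () ≤ 4 * Fintype.card κ * c ^ 3 * d1 j := by
    intro j
    let σ := Equiv.swap e0 (Sum.inr j)
    have h1 := hmin1 (E.submatrix id σ) (E'.submatrix σ id) (by
      rw [submatrix_mul_equiv, hEE, submatrix_id_id])
    have h2 : intMat (E.submatrix id σ) *ᵥ Pi.single e0 1 = intMat E *ᵥ Pi.single (Sum.inr j) 1 := by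
      ext i; simp [σ]
    rw [h2, ← qf_transpose_mul_mul, ← hQ3, hQ3N, qf_transpose_mul_mul, qf_diagonal] at h1
    have h3 := hred.diag_le j
    rw [← qf_single ((intMat V)ᵀ * S' * intMat V) j, hred.qf_eq] at h3
    simp only [Fintype.sum_sum_type, hd, hN, mulVec_single_one, col_apply, fromBlocks_apply₁₂,
      fromBlocks_apply₂₂, Sum.elim_inl, Sum.elim_inr, Finset.univ_unique, Finset.sum_singleton,
      e0, fromBlocks_apply₁₁] at h1 h3
    have h4 : x () j ^ 2 ≤ 1 / 4 := by
      have := sq_le_sq' (by linarith [_root_.abs_le.1 (hx2 () j)]) (_root_.abs_le.1 (hx2 () j)).2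
      linarith
    have h5 := mul_le_mul_of_nonneg_left h4 hqpos.le
    have h6 : q () () ≤ 2 * (q () () * x () j ^ 2 + ∑ i, d1 i * N1 i j ^ 2) := h1
    linarith
  have hc' : 4 * Fintype.card κ * c ^ 3 ≤ 4 * (Fintype.card κ + 1) * c ^ 3 := by
    nlinarith [pow_pos (zero_lt_one.trans_le hc) 3]
  have hc'' : c ≤ 4 * (Fintype.card κ + 1) * c ^ 3 := by nlinarith
  have hC1 := hc.trans hc''
  refine ⟨U * E, E' * U', ?_, M, N, d, hMN, ?_, ?_, ?_, ?_, ?_, ?_⟩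
  · rw [Matrix.mul_assoc, ← Matrix.mul_assoc E, hEE, Matrix.one_mul, hU]
  · rintro (i | i)
    exacts [hqpos, hred.pos i]
  · rw [intMat_mul, transpose_mul]
    rw [← hdiag, hQ3, hQ1]; simp only [Matrix.mul_assoc]
  · rintro (i | i) (j | j)
    · simpa [hM] using hC1
    · have h1 : |(x * M1) i j| ≤ Fintype.card κ * (1 / 2 * c) := by
        rw [Matrix.mul_apply]
        refine abs_sum_mul_le fun k => ?_
        rw [abs_mul]
        exact mul_le_mul (hx2 i k) (hred.abs_le k j) (abs_nonneg _) (by norm_num)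
      simp only [hM, fromBlocks_apply₁₂, Matrix.neg_apply, abs_neg]
      nlinarith
    · simpa [hM] using zero_le_one.trans hC1
    · exact (hred.abs_le i j).trans hc''
  · rintro (i | i) (j | j)
    · simpa [hN] using hC1
    · exact (hx2 i j).trans (by linarith)
    · simpa [hN] using zero_le_one.trans hC1
    · exact (hred.abs_inv_le i j).trans hc''
  · rintro (i | i) (j | j) hij
    · exact le_mul_of_one_le_left hqpos.le hC1
    · exact (hqd j).trans (mul_le_mul_of_nonneg_right hc' (hred.pos j).le)
    · simp [hM] at hij
    · exact (hred.le_of_ne_zero i j hij).trans (mul_le_mul_of_nonneg_right hc'' (hred.pos j).le)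
  · rintro (i | i) (j | j) hij
    · exact le_mul_of_one_le_left hqpos.le hC1
    · exact (hqd j).trans (mul_le_mul_of_nonneg_right hc' (hred.pos j).le)
    · simp [hN] at hij
    · exact (hred.le_of_inv_ne_zero i j hij).trans
        (mul_le_mul_of_nonneg_right hc'' (hred.pos j).le)

lemma exists_hasReduction_fin (n : ℕ) : ∃ c, 1 ≤ c ∧ HasReduction c (Fin n) := by
  induction n with
  | zero =>
    refine ⟨1, le_rfl, fun Q _ => ⟨1, 1, by simp, 1, 1, 0, by simp, fun i => i.elim0, ?_,
      fun i => i.elim0, fun i => i.elim0, fun i => i.elim0, fun i => i.elim0⟩⟩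
    ext i; exact i.elim0
  | succ n ih =>
    obtain ⟨c, hc, h⟩ := ih
    refine ⟨_, ?_, (h.unit_sum hc).congr (Fintype.equivOfCardEq (by simp [add_comm]))⟩
    have : 1 ≤ c ^ 3 := one_le_pow₀ hc
    have h2 : (0 : ℝ) ≤ Fintype.card (Fin n) := by positivity
    nlinarith

end Reduction


/-! ### Reduction of symplectic forms under the integral symplectic group -/

section SymplecticReduction

open Matrix

variable {κ : Type*} [Fintype κ] [DecidableEq κ]

section Det

variable {R : Type*} [CommRing R]

lemma det_one_updateCol (v : κ → R) (l : κ) : ((1 : Matrix κ κ R).updateCol l v).det = v l := by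
  rw [← cramer_apply, cramer_one]; rfl

lemma det_add_single (A : Matrix κ κ R) (l : κ) (y : R) :
    (A + single l l y).det = A.det + y * A.adjugate l l := by
  have h : A + single l l y = A.updateRow l (A l + y • Pi.single l 1) := by
    ext i j
    by_cases hi : i = l
    · subst hi
      simp [Matrix.single, Pi.single_apply, eq_comm]
    · simp [Matrix.single, hi, Ne.symm hi]
  rw [h, det_updateRow_add, updateRow_eq_self, det_updateRow_smul, adjugate_apply]

lemma adjugate_one_updateCol_apply (v : κ → R) (l j : κ) :
    ((1 : Matrix κ κ R).updateCol l v).adjugate l j = (1 : Matrix κ κ R) l j := by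
  have h : (1 : Matrix κ κ R).updateCol l v = ((1 : Matrix κ κ R).updateRow l v)ᵀ := by
    rw [← updateCol_transpose, transpose_one]
  have h2 : ((1 : Matrix κ κ R).updateRow l v).updateRow l (Pi.single j 1) =
      ((1 : Matrix κ κ R).updateCol l (Pi.single j 1))ᵀ := by
    rw [← updateRow_transpose, transpose_one]
    ext i k; by_cases hi : i = l
    · subst hi; simp
    · simp [hi]
  rw [h, ← adjugate_transpose, transpose_apply, adjugate_apply, h2, det_transpose,
    det_one_updateCol, one_apply]
  simp [Pi.single_apply]

lemma det_congr_add_single (D : Matrix κ κ R) (v : κ → R) (l : κ) (y : R) :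
    (((1 : Matrix κ κ R).updateCol l v)ᵀ * D * (1 : Matrix κ κ R).updateCol l v +
      single l l y).det = D.det * v l ^ 2 + y * D.adjugate l l := by
  set C := (1 : Matrix κ κ R).updateCol l v with hC
  have h1 : (Cᵀ * D * C).adjugate l l = D.adjugate l l := by
    rw [adjugate_mul_distrib, adjugate_mul_distrib, ← adjugate_transpose, ← Matrix.mul_assoc]
    simp only [Matrix.mul_apply, transpose_apply, hC, adjugate_one_updateCol_apply, one_apply]
    simp
  rw [det_add_single, h1, det_mul, det_mul, det_transpose, hC, det_one_updateCol]
  ring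

/-- The symplectic matrix exchanging two dual basis vectors. -/
def symplecticSwap (R : Type*) [CommRing R] (l : κ) : Matrix (κ ⊕ κ) (κ ⊕ κ) R :=
  fromBlocks (1 - single l l 1) (single l l 1) (-single l l 1) (1 - single l l 1)

lemma symplecticSwap_mem (l : κ) : symplecticSwap R l ∈ symplecticGroup κ R := by
  rw [SymplecticGroup.mem_iff, symplecticSwap]
  simp [J, fromBlocks_multiply, fromBlocks_transpose, Matrix.sub_mul, Matrix.mul_sub]
  abel

lemma blockDiag_mem {U U' : Matrix κ κ R} (h : U * U' = 1) :
    fromBlocks U'ᵀ 0 0 U ∈ symplecticGroup κ R := by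
  rw [SymplecticGroup.mem_iff]
  have h2 : U' * U = 1 := mul_eq_one_comm.1 h
  simp [J, fromBlocks_multiply, fromBlocks_transpose, h, ← transpose_mul]

end Det

/-- The lower right block of a symplectic form after a change of basis. -/
lemma toBlocks₂₂_congr_form (p : Matrix κ κ ℝ × Matrix κ κ ℝ) (hp : p.1ᵀ = p.1)
    (A B C D : Matrix κ κ ℝ) :
    ((fromBlocks A B C D)ᵀ * form p * fromBlocks A B C D).toBlocks₂₂ =
      (p.1 * B + D)ᵀ * p.2⁻¹ * (p.1 * B + D) + Bᵀ * p.2 * B := by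
  simp only [form, fromBlocks_transpose, fromBlocks_multiply, toBlocks_fromBlocks₂₂]
  simp [Matrix.mul_add, Matrix.add_mul, Matrix.mul_assoc, hp]
  abel

lemma det_swap_form {p : Matrix κ κ ℝ × Matrix κ κ ℝ} (hp : p ∈ siegelSpace κ) (l : κ) :
    ((symplecticSwap ℝ l)ᵀ * form p * symplecticSwap ℝ l).toBlocks₂₂.det =
      p.2⁻¹.det * (p.1 l l ^ 2 + p.2 l l ^ 2) := by
  have h1 : p.1 * single l l 1 + (1 - single l l 1) =
      (1 : Matrix κ κ ℝ).updateCol l (fun i => p.1 i l) := by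
    ext i j
    by_cases hj : j = l
    · subst hj
      have h : single j j (1 : ℝ) i j = (1 : Matrix κ κ ℝ) i j := by
        simp [Matrix.single, Matrix.one_apply, eq_comm]
      simp [h]
    · simp [hj, Ne.symm hj, Matrix.one_apply]
  have h2 : (single l l (1 : ℝ))ᵀ * p.2 * single l l 1 = single l l (p.2 l l) := by
    simp
  rw [symplecticSwap, toBlocks₂₂_congr_form p hp.1, h1, h2, det_congr_add_single]
  have h3 : p.2⁻¹.adjugate l l = p.2⁻¹.det * p.2 l l := by
    have h4 : p.2⁻¹.adjugate = p.2⁻¹.det • p.2 := by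
      calc p.2⁻¹.adjugate = p.2⁻¹.adjugate * p.2⁻¹ * p.2 := by
            rw [Matrix.mul_assoc, posDef_inv_mul hp.2, Matrix.mul_one]
        _ = _ := by rw [adjugate_mul, smul_mul, Matrix.one_mul]
    rw [h4]; rfl
  rw [h3]; ring

/-- A lower bound for the determinant of a form in terms of its minimum on integral vectors. -/
lemma HasReduction.le_det {c lo : ℝ} (hc : 1 ≤ c) (h : HasReduction c κ) {D : Matrix κ κ ℝ}
    (hD : D.PosDef) (hlo : 0 < lo) (hle : ∀ v : κ → ℤ, v ≠ 0 → lo ≤ qf D fun i => (v i : ℝ)) :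
    (lo / ((Fintype.card κ + 1) * c ^ 3)) ^ Fintype.card κ /
      ((Fintype.card κ).factorial * c ^ Fintype.card κ) ^ 2 ≤ D.det := by
  have hc0 : 0 < c := by linarith
  obtain ⟨U, U', hU, M, N, d, hred⟩ := h D hD
  rw [div_le_iff₀ (by positivity)]
  have hd : ∀ i, lo / ((Fintype.card κ + 1) * c ^ 3) ≤ d i := by
    intro i
    rw [div_le_iff₀ (by positivity)]
    have h1 := hred.diag_le i
    rw [← qf_single ((intMat U)ᵀ * D * intMat U) i, qf_transpose_mul_mul] at h1
    have h2 := hle (fun j => U j i) (fun h0 => by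
      have h3 : U' *ᵥ (U *ᵥ Pi.single i 1) = Pi.single i 1 := by
        rw [mulVec_mulVec, mul_eq_one_comm.1 hU, one_mulVec]
      have h4 : U *ᵥ Pi.single i 1 = 0 := by rw [mulVec_single_one]; exact h0
      rw [h4, mulVec_zero] at h3
      simpa using congrFun h3 i)
    have h5 : (intMat U *ᵥ Pi.single i 1) = fun j => ((U j i : ℤ) : ℝ) := by
      ext j; simp
    rw [h5] at h1
    have h6 : 0 < c ^ 3 * d i := mul_pos (by positivity) (hred.pos i)
    linarith
  have h1 := congrArg Matrix.det hred.diag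
  have hUdet : (intMat U).det ^ 2 = 1 := by
    have h2 : (intMat U).det = ((U.det : ℤ) : ℝ) := by
      rw [intMat]; exact ((Int.castRingHom ℝ).map_det U).symm
    have h3 : IsUnit U.det := by
      rw [← isUnit_iff_isUnit_det]; exact IsUnit.of_mul_eq_one _ hU
    rw [h2]
    rcases Int.isUnit_iff.1 h3 with h4 | h4 <;> simp [h4]
  simp only [det_mul, det_transpose, det_diagonal] at h1
  have h2 : D.det * M.det ^ 2 = ∏ i, d i := by
    rw [← h1]; linear_combination (-(D.det * M.det ^ 2)) * hUdet
  have h3 : |M.det| ≤ (Fintype.card κ).factorial * c ^ Fintype.card κ := by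
    have := Matrix.det_le (abv := AbsoluteValue.abs) (A := M) (x := c) hred.abs_le
    simpa using this
  have h4 : (lo / ((Fintype.card κ + 1) * c ^ 3)) ^ Fintype.card κ ≤ ∏ i, d i := by
    have := Finset.prod_le_prod (s := Finset.univ) (f := fun _ : κ =>
      lo / ((Fintype.card κ + 1) * c ^ 3)) (g := d) (fun i _ => by positivity) fun i _ => hd i
    rwa [Finset.prod_const, Finset.card_univ] at this
  rw [← h2] at h4
  refine h4.trans (mul_le_mul_of_nonneg_left ?_ hD.det_pos.le)
  rw [← sq_abs]
  exact pow_le_pow_left₀ (abs_nonneg _) h3 2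

lemma PosDef.toBlocks₂₂ {Q : Matrix (κ ⊕ κ) (κ ⊕ κ) ℝ} (hQ : Q.PosDef) : Q.toBlocks₂₂.PosDef :=
  hQ.submatrix (e := (Sum.inr : κ → κ ⊕ κ)) Sum.inr_injective

lemma qf_toBlocks₂₂ (Q : Matrix (κ ⊕ κ) (κ ⊕ κ) ℝ) (v : κ → ℝ) :
    qf Q.toBlocks₂₂ v = qf Q (Sum.elim 0 v) := by
  conv_rhs => rw [← fromBlocks_toBlocks Q]
  simp [qf, fromBlocks_mulVec, dotProduct]

/-- The reduced basis of a symplectic form built from a reduced basis of one of its halves. -/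
lemma reduced_form {c : ℝ} (hc : 1 ≤ c) {p : Matrix κ κ ℝ × Matrix κ κ ℝ} (hp : p ∈ siegelSpace κ)
    (hred : Reduced c p.2⁻¹) (hX : ∀ i j, |p.1 i j| ≤ 1 / 2) (hY : ∀ i, 1 / 2 ≤ p.2 i i) :
    Reduced (4 * (Fintype.card κ + 1) ^ 2 * c ^ 6) (form p) := by
  obtain ⟨M, N, d, hred⟩ := hred
  have hYi : (p.2⁻¹)⁻¹ = p.2 :=
    nonsing_inv_nonsing_inv _ ((isUnit_iff_isUnit_det _).1 hp.2.isUnit)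
  have hm : (0 : ℝ) ≤ Fintype.card κ := by positivity
  have hc0 : 0 < c := by linarith
  have hd : ∀ i, d i ≤ 2 * (Fintype.card κ * c ^ 3) := by
    intro i
    have h1 := hred.inv_diag_mul_le i
    rw [hYi] at h1
    have h2 := mul_le_mul_of_nonneg_right (hY i) (hred.pos i).le
    linarith
  set m : ℝ := ((Fintype.card κ : ℕ) : ℝ) with hmdef
  set K := 4 * (m + 1) ^ 2 * c ^ 6 with hK
  have hc6 : c ≤ c ^ 6 := le_self_pow₀ hc (by norm_num)
  have hm1 : m + 1 ≤ (m + 1) ^ 2 := le_self_pow₀ (by linarith) (by norm_num)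
  have hmcK : (m + 1) * c ≤ K := by
    have h1 : (m + 1) * c ≤ (m + 1) ^ 2 * c ^ 6 :=
      mul_le_mul hm1 hc6 hc0.le (by positivity)
    have h2 : 0 ≤ (m + 1) ^ 2 * c ^ 6 := by positivity
    rw [hK]; linarith
  have hcK : c ≤ K := by nlinarith
  have hdd : ∀ i j, d i ≤ K * (d j)⁻¹ := by
    intro i j
    rw [← div_eq_mul_inv, le_div_iff₀ (hred.pos j)]
    calc d i * d j ≤ (2 * (m * c ^ 3)) * (2 * (m * c ^ 3)) :=
          mul_le_mul (hd i) (hd j) (hred.pos j).le (by positivity)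
      _ = 4 * m ^ 2 * c ^ 6 := by ring
      _ ≤ K := by rw [hK]; gcongr; linarith
  have hinv : ∀ {i j}, d i ≤ c * d j → (d j)⁻¹ ≤ K * (d i)⁻¹ := by
    intro i j hij
    rw [← div_eq_mul_inv, le_div_iff₀ (hred.pos i), inv_mul_le_iff₀ (hred.pos j)]
    have := mul_le_mul_of_nonneg_right hcK (hred.pos j).le
    linarith
  have hdi : ∀ {i j}, d i ≤ c * d j → d i ≤ K * d j := fun h =>
    h.trans (mul_le_mul_of_nonneg_right hcK (hred.pos _).le)
  have hNM := hred.inv_mul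
  have hMN := hred.mul_eq_one
  have hMN' : Nᵀ * Mᵀ = 1 := by rw [← transpose_mul, hMN, transpose_one]
  have hprod : ∀ {Z : Matrix κ κ ℝ}, (∀ i j, |Z i j| ≤ c) → ∀ i j, |(p.1 * Z) i j| ≤ K := by
    intro Z hZ i j
    have h1 : |(p.1 * Z) i j| ≤ m * (1 / 2 * c) := by
      rw [Matrix.mul_apply]
      refine abs_sum_mul_le fun k => ?_
      rw [abs_mul]
      exact mul_le_mul (hX i k) (hZ k j) (abs_nonneg _) (by norm_num)
    nlinarith
  have hprod' : ∀ {Z : Matrix κ κ ℝ}, (∀ i j, |Z i j| ≤ c) → ∀ i j, |(Z * p.1) i j| ≤ K := by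
    intro Z hZ i j
    have h1 : (Z * p.1) i j = (p.1 * Zᵀ) j i := by
      rw [← transpose_apply (Z * p.1), transpose_mul, hp.1]
    rw [h1]
    exact hprod (fun i j => hZ j i) j i
  have hK0 : 0 ≤ K := hc0.le.trans hcK
  refine ⟨fromBlocks Nᵀ 0 (-(p.1 * Nᵀ)) M, fromBlocks Mᵀ 0 (N * p.1) N,
    Sum.elim (fun i => (d i)⁻¹) d, ?_, ?_, ?_, ?_, ?_, ?_, ?_⟩
  · simp [fromBlocks_multiply, hMN, hMN', Matrix.mul_assoc, ← Matrix.mul_assoc M]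
  · rintro (i | i)
    exacts [inv_pos.2 (hred.pos i), hred.pos i]
  · have h1 : fromBlocks 1 0 p.1 1 * fromBlocks Nᵀ 0 (-(p.1 * Nᵀ)) M = fromBlocks Nᵀ 0 0 M := by
      simp [fromBlocks_multiply]
    have h2 : N * p.2 * Nᵀ = diagonal fun i => (d i)⁻¹ := by
      rw [← hYi, hred.inv_eq]
      calc _ = (N * M) * (diagonal fun i => (d i)⁻¹) * (Mᵀ * Nᵀ) := by
            simp only [Matrix.mul_assoc]
        _ = _ := by
            rw [hNM, Matrix.one_mul, mul_eq_one_comm.1 hMN', Matrix.mul_one]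
    calc _ = (fromBlocks 1 0 p.1 1 * fromBlocks Nᵀ 0 (-(p.1 * Nᵀ)) M)ᵀ *
          fromBlocks p.2 0 0 p.2⁻¹ * (fromBlocks 1 0 p.1 1 * fromBlocks Nᵀ 0 (-(p.1 * Nᵀ)) M) := by
          rw [form]; simp only [transpose_mul, Matrix.mul_assoc]
      _ = _ := by
          rw [h1, ← fromBlocks_diagonal, ← h2, ← hred.diag]
          simp [fromBlocks_transpose, fromBlocks_multiply]
  · rintro (i | i) (j | j)
    · exact (hred.abs_inv_le j i).trans hcK
    · simpa using hK0
    · simp only [fromBlocks_apply₂₁, Matrix.neg_apply, abs_neg]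
      exact hprod (Z := Nᵀ) (fun i j => hred.abs_inv_le j i) i j
    · exact (hred.abs_le i j).trans hcK
  · rintro (i | i) (j | j)
    · exact (hred.abs_le j i).trans hcK
    · simpa using hK0
    · exact hprod' (fun i j => hred.abs_inv_le i j) i j
    · exact (hred.abs_inv_le i j).trans hcK
  · rintro (i | i) (j | j) hij
    · exact hinv (hred.le_of_inv_ne_zero j i hij)
    · simp at hij
    · exact hdd i j
    · exact hdi (hred.le_of_ne_zero i j hij)
  · rintro (i | i) (j | j) hij
    · exact hinv (hred.le_of_ne_zero j i hij)
    · simp at hij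
    · exact hdd i j
    · exact hdi (hred.le_of_inv_ne_zero i j hij)

lemma intMat_mem {h : Matrix (κ ⊕ κ) (κ ⊕ κ) ℤ} (hh : h ∈ symplecticGroup κ ℤ) :
    intMat h ∈ symplecticGroup κ ℝ :=
  SymplecticGroup.map_mem hh (Int.castRingHom ℝ)

lemma intMat_coe_inv_mul (h : symplecticGroup κ ℤ) :
    intMat (h⁻¹ : symplecticGroup κ ℤ).1 * intMat h.1 = 1 := by
  rw [← intMat_mul, ← Submonoid.coe_mul, inv_mul_cancel]; simp

lemma intMat_symplecticSwap (l : κ) : intMat (symplecticSwap ℤ l) = symplecticSwap ℝ l := by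
  ext (i | i) (j | j) <;> simp [symplecticSwap, Matrix.single, one_apply]

/-- Every symplectic form is reduced in some integral symplectic basis. -/
lemma HasReduction.exists_reduced {c : ℝ} (hc : 1 ≤ c) (hκ : HasReduction c κ)
    {Q : Matrix (κ ⊕ κ) (κ ⊕ κ) ℝ} (hQ : SiegelForm Q) :
    ∃ h : symplecticGroup κ ℤ, Reduced (4 * (Fintype.card κ + 1) ^ 2 * c ^ 6)
      ((intMat h.1)ᵀ * Q * intMat h.1) := by
  obtain ⟨lo, hlo, hle⟩ := exists_le_qf hQ.1
  set f : symplecticGroup κ ℤ → ℝ := fun h => ((intMat h.1)ᵀ * Q * intMat h.1).toBlocks₂₂.det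
    with hf
  have hpos : ∀ h : symplecticGroup κ ℤ, SiegelForm ((intMat h.1)ᵀ * Q * intMat h.1) :=
    fun h => hQ.transpose_mul_mul (intMat_mem h.2)
  obtain ⟨h, hmin⟩ := exists_le_two_mul f (lo := (lo / ((Fintype.card κ + 1) * c ^ 3)) ^
      Fintype.card κ / ((Fintype.card κ).factorial * c ^ Fintype.card κ) ^ 2) (by positivity) (by
    intro h
    refine hκ.le_det hc (PosDef.toBlocks₂₂ (hpos h).1) hlo fun v hv => ?_
    rw [qf_toBlocks₂₂, qf_transpose_mul_mul]
    refine le_trans ?_ (hle _)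
    refine le_mul_of_one_le_right hlo.le
      (one_le_dotProduct_of_int (h.1 *ᵥ Sum.elim 0 v) ?_ fun h0 => hv ?_)
    · intro i
      simp [mulVec, dotProduct]
    · have h1 : intMat (h⁻¹ : symplecticGroup κ ℤ).1 *ᵥ
          (intMat h.1 *ᵥ Sum.elim (0 : κ → ℝ) (fun i => (v i : ℝ))) =
            Sum.elim (0 : κ → ℝ) (fun i => (v i : ℝ)) := by
        rw [mulVec_mulVec, intMat_coe_inv_mul, one_mulVec]
      rw [h0, mulVec_zero] at h1
      ext i
      have := congrFun h1 (Sum.inr i)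
      simpa using this.symm)
  -- reduce the lower right block
  obtain ⟨U, U', hU, hUred⟩ := hκ _ (PosDef.toBlocks₂₂ (hpos h).1)
  have hU2 : intMat U * intMat U' = 1 := by rw [← intMat_mul, hU, intMat_one]
  let a : symplecticGroup κ ℤ := ⟨fromBlocks U'ᵀ 0 0 U, blockDiag_mem hU⟩
  obtain ⟨p, hp, hform⟩ := (hpos (h * a)).exists_form
  have hblock : p.2⁻¹ = (intMat U)ᵀ * ((intMat h.1)ᵀ * Q * intMat h.1).toBlocks₂₂ * intMat U := by
    have h1 : (form p).toBlocks₂₂ = p.2⁻¹ := by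
      simp [form, fromBlocks_transpose, fromBlocks_multiply]
    rw [← h1, hform]
    have h2 : (intMat (h * a).1)ᵀ * Q * intMat (h * a).1 =
        (intMat a.1)ᵀ * ((intMat h.1)ᵀ * Q * intMat h.1) * intMat a.1 := by
      rw [Submonoid.coe_mul, intMat_mul, transpose_mul]; simp only [Matrix.mul_assoc]
    rw [h2]
    conv_lhs => rw [← fromBlocks_toBlocks ((intMat h.1)ᵀ * Q * intMat h.1)]
    simp [a, intMat_fromBlocks, fromBlocks_transpose, fromBlocks_multiply]
  -- translate
  let T : Matrix κ κ ℤ := fun i j => - round (p.1 i j)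
  have hT : Tᵀ = T := by
    ext i j
    have : p.1 j i = p.1 i j := by rw [← transpose_apply p.1 i j, hp.1]
    change -round (p.1 j i) = -round (p.1 i j)
    rw [this]
  have hTe : ∀ i j, (p.1 + intMat T) i j = p.1 i j - (round (p.1 i j) : ℝ) := fun i j => by
    rw [Matrix.add_apply, intMat_apply, sub_eq_add_neg]; exact congrArg _ (Int.cast_neg _)
  let b : symplecticGroup κ ℤ := ⟨fromBlocks 1 0 T 1, lower_mem_symplecticGroup hT⟩
  set q : Matrix κ κ ℝ × Matrix κ κ ℝ := (p.1 + intMat T, p.2) with hq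
  have hqS : q ∈ siegelSpace κ := ⟨by
    rw [hq]; simp only [transpose_add, hp.1]; rw [← intMat_transpose, hT], hp.2⟩
  have hqform : form q = (intMat (h * a * b).1)ᵀ * Q * intMat (h * a * b).1 := by
    have h2 : (intMat (h * a * b).1)ᵀ * Q * intMat (h * a * b).1 =
        (intMat b.1)ᵀ * form p * intMat b.1 := by
      rw [hform, Submonoid.coe_mul, intMat_mul _ b.1, transpose_mul]; simp only [Matrix.mul_assoc]
    have h3 : fromBlocks 1 0 q.1 1 = fromBlocks 1 0 p.1 1 * intMat b.1 := by
      simp [b, hq, intMat_fromBlocks, fromBlocks_multiply]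
    rw [h2, form, form, h3, transpose_mul]; simp only [Matrix.mul_assoc, hq]
  refine ⟨h * a * b, ?_⟩
  rw [← hqform]
  refine reduced_form hc hqS (by rw [hq]; simp only; rw [hblock]; exact hUred) ?_ ?_
  · intro i j
    have := abs_sub_round (p.1 i j)
    rw [hq]
    simp only [hTe]
    exact this
  · intro l
    let s : symplecticGroup κ ℤ := ⟨symplecticSwap ℤ l, symplecticSwap_mem l⟩
    have h1 := hmin (h * a * b * s)
    have h2 : f h = q.2⁻¹.det := by
      have hUdet : (intMat U).det ^ 2 = 1 := by
        have h2 : (intMat U).det = ((U.det : ℤ) : ℝ) := by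
          rw [intMat]; exact ((Int.castRingHom ℝ).map_det U).symm
        have h3 : IsUnit U.det := by
          rw [← isUnit_iff_isUnit_det]; exact IsUnit.of_mul_eq_one _ hU
        rw [h2]
        rcases Int.isUnit_iff.1 h3 with h4 | h4 <;> simp [h4]
      rw [hq]; simp only; rw [hblock, det_mul, det_mul, det_transpose]
      simp only [hf]
      linear_combination (-((intMat h.1)ᵀ * Q * intMat h.1).toBlocks₂₂.det) * hUdet
    have h3 : f (h * a * b * s) = q.2⁻¹.det * (q.1 l l ^ 2 + q.2 l l ^ 2) := by
      rw [← det_swap_form hqS, hqform]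
      simp only [hf]
      rw [Submonoid.coe_mul, intMat_mul _ s.1, transpose_mul]
      simp only [s, intMat_symplecticSwap, Matrix.mul_assoc]
    rw [h2, h3] at h1
    have h4 := hqS.2.inv.det_pos
    have h5 : 1 ≤ 2 * (q.1 l l ^ 2 + q.2 l l ^ 2) := by
      by_contra! hcon
      nlinarith
    have h6 : q.1 l l ^ 2 ≤ 1 / 4 := by
      have := abs_sub_round (p.1 l l)
      have h7 : |q.1 l l| ≤ 1 / 2 := by
        rw [hq]
        simp only [hTe]
        exact this
      have := sq_le_sq' (by linarith [_root_.abs_le.1 h7]) (_root_.abs_le.1 h7).2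
      linarith
    have h7 : 0 < q.2 l l := hqS.2.diag_pos
    nlinarith

end SymplecticReduction


/-! ### Transition matrices between nearby forms -/

section Transition

open Matrix

variable {ι κ : Type*} [Fintype ι] [DecidableEq ι] [Fintype κ] [DecidableEq κ]

lemma Reduced.mono {c c' : ℝ} {Q : Matrix ι ι ℝ} (h : Reduced c Q) (hc : c ≤ c') :
    Reduced c' Q := by
  obtain ⟨M, N, d, h⟩ := h
  exact ⟨M, N, d, h.mono hc⟩

/-- A form comparable to the standard one is reduced. -/
lemma reduced_of_bounds {Q : Matrix ι ι ℝ} (hQ : Q.PosDef) {K : ℝ} (hK : 1 ≤ K)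
    (h1 : ∀ u, qf Q u ≤ K * (u ⬝ᵥ u)) (h2 : ∀ u, u ⬝ᵥ u ≤ K * qf Q u) : Reduced (K ^ 2) Q := by
  set M : Matrix ι ι ℝ := hQ.isHermitian.eigenvectorUnitary.1 with hM
  set d := hQ.isHermitian.eigenvalues with hd
  have hMM : Mᵀ * M = 1 := by
    have := (Unitary.mem_iff.1 hQ.isHermitian.eigenvectorUnitary.2).1
    rwa [star_eq_conjTranspose, conjTranspose_eq_transpose_of_trivial] at this
  have hMM' : M * Mᵀ = 1 := mul_eq_one_comm.1 hMM
  have hdiag : Mᵀ * Q * M = diagonal d := by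
    have h : Q = M * diagonal d * Mᵀ := by
      have := hQ.isHermitian.spectral_theorem
      rw [Unitary.conjStarAlgAut_apply, star_eq_conjTranspose,
        conjTranspose_eq_transpose_of_trivial] at this
      exact this
    rw [h]
    calc _ = (Mᵀ * M) * diagonal d * (Mᵀ * M) := by simp only [Matrix.mul_assoc]
      _ = _ := by rw [hMM, Matrix.one_mul, Matrix.mul_one]
  have hcol : ∀ j, (M *ᵥ Pi.single j 1) ⬝ᵥ (M *ᵥ Pi.single j 1) = 1 := by
    intro j
    rw [← qf_one, ← qf_transpose_mul_mul, Matrix.mul_one, hMM, qf_one]; simp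
  have hle : ∀ i j, |M i j| ≤ K ^ 2 := by
    intro i j
    have h3 : M i j ^ 2 ≤ 1 := by
      rw [← hcol j, mulVec_single_one, dotProduct, sq]
      exact Finset.single_le_sum (f := fun i => M i j * M i j)
        (fun i _ => mul_self_nonneg _) (Finset.mem_univ i)
    exact ((sq_le_one_iff_abs_le_one _).1 h3).trans (one_le_pow₀ hK)
  have hdj : ∀ j, qf Q (M *ᵥ Pi.single j 1) = d j := by
    intro j
    rw [← qf_transpose_mul_mul, hdiag, qf_single, diagonal_apply_eq]
  have hd1 : ∀ i j, d i ≤ K ^ 2 * d j := by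
    intro i j
    have h3 := h1 (M *ᵥ Pi.single i 1)
    have h4 := h2 (M *ᵥ Pi.single j 1)
    rw [hdj, hcol] at h3 h4
    nlinarith
  exact ⟨M, Mᵀ, d, hMM', hQ.eigenvalues_pos, hdiag, hle, fun i j => hle j i,
    fun i j _ => hd1 i j, fun i j _ => hd1 i j⟩

lemma one_le_mul_qf_intMat {Q : Matrix ι ι ℝ} {Λ : ℝ} (h : ∀ u, u ⬝ᵥ u ≤ Λ * qf Q u)
    {A A' : Matrix ι ι ℤ} (hA : A' * A = 1) (i : ι) :
    1 ≤ Λ * qf Q (intMat A *ᵥ Pi.single i 1) := by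
  refine le_trans (one_le_dotProduct_of_int (fun j => A j i) (fun j => ?_) fun h0 => ?_) (h _)
  · simp
  · have h1 : intMat A' *ᵥ (intMat A *ᵥ Pi.single i 1) = Pi.single i 1 := by
      rw [mulVec_mulVec, ← intMat_mul, hA, intMat_one, one_mulVec]
    rw [h0, mulVec_zero] at h1
    simpa using congrFun h1 i

lemma SiegelForm.inv_eq {Q : Matrix (κ ⊕ κ) (κ ⊕ κ) ℝ} (hQ : SiegelForm Q) :
    Q⁻¹ = J κ ℝ * Q * (J κ ℝ)ᵀ := by
  refine inv_eq_right_inv ?_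
  calc Q * (J κ ℝ * Q * (J κ ℝ)ᵀ) = (Q * J κ ℝ * Q) * (J κ ℝ)ᵀ := by
        simp only [Matrix.mul_assoc]
    _ = 1 := by rw [hQ.2]; exact mul_eq_one_comm.1 J_transpose_mul_self

lemma intMat_J : intMat (J κ ℤ) = J κ ℝ := by
  ext (i | i) (j | j) <;> simp [J, one_apply]

/-- The diagonal of a reduced symplectic form is controlled by the distance to the base point. -/
lemma ReducedBy.diag_bounds {Q M N : Matrix (κ ⊕ κ) (κ ⊕ κ) ℝ} {c Λ : ℝ} {d : κ ⊕ κ → ℝ}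
    (hQ : SiegelForm Q) (hΛ : 0 < Λ) (h : ∀ u, qf Q u ≤ Λ * (u ⬝ᵥ u)) (g : symplecticGroup κ ℤ)
    (hred : ReducedBy c ((intMat g.1)ᵀ * Q * intMat g.1) M N d) (i : κ ⊕ κ) :
    1 ≤ (Fintype.card (κ ⊕ κ) + 1) * c ^ 3 * Λ * d i ∧
      d i ≤ (Fintype.card (κ ⊕ κ) + 1) * c ^ 3 * Λ := by
  have h1 : ∀ u, u ⬝ᵥ u ≤ Λ * qf Q u := fun u => by
    have := hQ.flip siegelForm_one hΛ (by simpa only [qf_one] using h) u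
    rwa [qf_one] at this
  have hgg : (g⁻¹ : symplecticGroup κ ℤ).1 * g.1 = 1 := by
    rw [← Submonoid.coe_mul, inv_mul_cancel]; rfl
  have hJJ : J κ ℤ * (J κ ℤ)ᵀ = 1 := by rw [J_transpose, Matrix.mul_neg, J_squared, neg_neg]
  have hc := hred.nonneg_of i
  have hd := hred.pos i
  have h5 : 0 ≤ c ^ 3 * d i := by positivity
  have h6 : 0 ≤ c ^ 3 := by positivity
  constructor
  · have h2 := one_le_mul_qf_intMat h1 hgg i
    rw [← qf_transpose_mul_mul, qf_single] at h2
    have h3 := mul_le_mul_of_nonneg_left (hred.diag_le i) hΛ.le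
    have h4 : 0 ≤ Λ * (c ^ 3 * d i) := by positivity
    linarith
  · have h2 := one_le_mul_qf_intMat h1 (A := g.1 * (J κ ℤ)ᵀ)
      (A' := J κ ℤ * (g⁻¹ : symplecticGroup κ ℤ).1) (i := i) (by
        calc _ = J κ ℤ * ((g⁻¹ : symplecticGroup κ ℤ).1 * g.1) * (J κ ℤ)ᵀ := by
              simp only [Matrix.mul_assoc]
          _ = 1 := by rw [hgg, Matrix.mul_one, hJJ])
    rw [intMat_mul, intMat_transpose, intMat_J, ← mulVec_mulVec, ← qf_transpose_mul_mul,
      ← qf_transpose_mul_mul, qf_single, transpose_transpose,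
      ← (hQ.transpose_mul_mul (intMat_mem g.2)).inv_eq] at h2
    have h3 := mul_le_mul_of_nonneg_left (hred.inv_diag_mul_le i) hΛ.le
    have h4 := mul_le_mul_of_nonneg_right h2 hd.le
    have h7 : 0 ≤ Λ * c ^ 3 := by positivity
    linarith

lemma exists_transition_bound (κ : Type*) [Fintype κ] [DecidableEq κ] {c : ℝ} (hc : 1 ≤ c) :
    ∃ B A : ℝ, 1 ≤ A ∧ ∀ {Q Q' : Matrix (κ ⊕ κ) (κ ⊕ κ) ℝ} {Λ ε : ℝ}, SiegelForm Q →
      SiegelForm Q' → 1 ≤ Λ → 0 ≤ ε → A * Λ ^ 3 * ε ≤ 1 → (∀ u, qf Q u ≤ Λ * (u ⬝ᵥ u)) →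
      (∀ u, qf Q' u ≤ Λ * (u ⬝ᵥ u)) → (∀ u, qf Q u ≤ (1 + ε) * qf Q' u) →
      (∀ u, qf Q' u ≤ (1 + ε) * qf Q u) → ∀ h h' : symplecticGroup κ ℤ,
      Reduced c ((intMat h.1)ᵀ * Q * intMat h.1) →
      Reduced c ((intMat h'.1)ᵀ * Q' * intMat h'.1) →
      ∀ a b, |((h⁻¹ * h').1 a b : ℝ)| ≤ B := by
  set m : ℝ := ((Fintype.card (κ ⊕ κ) : ℕ) : ℝ) with hm
  have hm0 : 0 ≤ m := by positivity
  have hc3 : 1 ≤ c ^ 3 := one_le_pow₀ hc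
  set T : ℝ := c + 2 * (m * (m * (c * c))) ^ 2 + 1 with hT
  have hT0 : 0 ≤ 2 * (m * (m * (c * c))) ^ 2 := by positivity
  set δ₀ : ℝ := (m + 1) * c ^ 3 with hδ₀
  have hδ1 : 1 ≤ δ₀ := by nlinarith
  refine ⟨m * (m * (c * (2 * T ^ (2 * Fintype.card (κ ⊕ κ) + 1)) * c)), 4 * (m + 1) * δ₀ ^ 3,
    ?_, ?_⟩
  · have hδ3 : 1 ≤ δ₀ ^ 3 := one_le_pow₀ hδ1
    nlinarith
  · intro Q Q' Λ ε hQ hQ' hΛ hε hA hQΛ hQ'Λ h1 h2 h h' ⟨M, N, d, hred⟩ ⟨M', N', d', hred'⟩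
    have hΛ0 : 0 < Λ := by linarith
    have hb := hred.diag_bounds hQ hΛ0 hQΛ h
    have hb' := hred'.diag_bounds hQ' hΛ0 hQ'Λ h'
    have hΛ3 : 1 ≤ Λ ^ 3 := one_le_pow₀ hΛ
    have hδ3 : 1 ≤ δ₀ ^ 3 := one_le_pow₀ hδ1
    have hδΛ : 1 ≤ δ₀ ^ 3 * Λ ^ 3 := one_le_mul_of_one_le_of_one_le hδ3 hΛ3
    have hX : 4 * (m + 1) * (δ₀ ^ 3 * Λ ^ 3 * ε) ≤ 1 := by linarith
    have hXε : ε ≤ δ₀ ^ 3 * Λ ^ 3 * ε := le_mul_of_one_le_left hε hδΛ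
    have hvec : ∀ u, intMat h.1 *ᵥ (intMat (h⁻¹ * h').1 *ᵥ u) = intMat h'.1 *ᵥ u := fun u => by
      rw [mulVec_mulVec, ← intMat_mul, ← Submonoid.coe_mul, mul_inv_cancel_left]
    have hgg : (h⁻¹ * h').1 * (h'⁻¹ * h).1 = 1 := by
      rw [← Submonoid.coe_mul, mul_assoc, mul_inv_cancel_left, inv_mul_cancel]; rfl
    refine transition_bounded hred hred' hgg (T := T) (by linarith) (by linarith) (by linarith)
      (ε := ε) (δ := δ₀ * Λ) hε (by nlinarith) (by positivity) (fun i => (hb i).1)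
      (fun i => (hb' i).2) (fun i => (hb i).2) (fun i => (hb' i).1) ?_ ?_ ?_
    · rw [← hm, mul_pow]; nlinarith
    · intro u
      rw [qf_transpose_mul_mul, qf_transpose_mul_mul]
      change qf Q (intMat h.1 *ᵥ (intMat (h⁻¹ * h').1 *ᵥ u)) ≤ _
      rw [hvec]; exact h1 _
    · intro u
      rw [qf_transpose_mul_mul, qf_transpose_mul_mul]
      change _ ≤ _ * qf Q (intMat h.1 *ᵥ (intMat (h⁻¹ * h').1 *ᵥ u))
      rw [hvec]; exact h2 _

lemma finite_entries_le (B : ℝ) : {h : symplecticGroup κ ℤ | ∀ a b, |(h.1 a b : ℝ)| ≤ B}.Finite := by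
  refine Set.Finite.of_finite_image (f := Subtype.val) ?_ Subtype.val_injective.injOn
  refine (Set.Finite.pi' fun _ => Set.Finite.pi' fun _ =>
    Set.finite_Icc (-⌈B⌉ : ℤ) ⌈B⌉).subset ?_
  rintro _ ⟨h, hh, rfl⟩ a b
  have h1 := _root_.abs_le.1 ((hh a b).trans (Int.le_ceil B))
  exact ⟨by exact_mod_cast h1.1, by exact_mod_cast h1.2⟩

/-- Reduced bases at consecutive points of a fine subdivision of a segment differ by elements of
`T`. -/
def IsTransitionSet (c A : ℝ) (T : Set (symplecticGroup κ ℤ)) : Prop :=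
  ∀ {Λ : ℝ} {p q : Matrix κ κ ℝ × Matrix κ κ ℝ} {m : ℕ}, 1 ≤ Λ → p ∈ siegelBall κ Λ →
    q ∈ siegelBall κ Λ → A * Λ ^ 5 ≤ m → ∀ j < m, ∀ h h' : symplecticGroup κ ℤ,
    Reduced c ((intMat h.1)ᵀ * form (seg m p q j) * intMat h.1) →
    Reduced c ((intMat h'.1)ᵀ * form (seg m p q (j + 1)) * intMat h'.1) → h⁻¹ * h' ∈ T

lemma exists_finite_isTransitionSet (κ : Type*) [Fintype κ] [DecidableEq κ] {c : ℝ} (hc : 1 ≤ c) :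
    ∃ (T : Set (symplecticGroup κ ℤ)) (A : ℝ), T.Finite ∧ 1 ≤ A ∧ IsTransitionSet c A T := by
  obtain ⟨B, A, hA, hB⟩ := exists_transition_bound κ hc
  refine ⟨_, 2 * A, finite_entries_le B, by linarith, ?_⟩
  intro Λ p q m hΛ hp hq hm j hj h h' hr hr'
  have hΛ0 : 0 < Λ := by linarith
  have hm0 : (0 : ℝ) < m := by exact_mod_cast (Nat.zero_le j).trans_lt hj
  obtain ⟨h1, h2⟩ := seg_near hΛ0 hp hq hj
  have hj1 := seg_mem (convex_siegelBall Λ) hp hq hj.le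
  have hj2 := seg_mem (convex_siegelBall Λ) hp hq (Nat.succ_le_of_lt hj)
  refine hB (siegelForm_form hj1.1) (siegelForm_form hj2.1) hΛ (by positivity) ?_ hj1.2 hj2.2
    h1 h2 h h' hr hr'
  rw [mul_div_assoc', div_le_one hm0]
  linarith

end Transition


/-! ### Combing the integral symplectic group -/

section Combing

open Matrix

variable {κ : Type*} [Fintype κ] [DecidableEq κ]

lemma exists_point (h : symplecticGroup κ ℤ) : ∃ p ∈ siegelSpace κ,
    form p = (intMat (h⁻¹ : symplecticGroup κ ℤ).1)ᵀ * 1 *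
      intMat (h⁻¹ : symplecticGroup κ ℤ).1 :=
  (siegelForm_one.transpose_mul_mul (intMat_mem (h⁻¹ : symplecticGroup κ ℤ).2)).exists_form

/-- The translate of the base point of Siegel space by an integral symplectic matrix. -/
noncomputable def point (h : symplecticGroup κ ℤ) : Matrix κ κ ℝ × Matrix κ κ ℝ :=
  (exists_point h).choose

lemma point_mem (h : symplecticGroup κ ℤ) : point h ∈ siegelSpace κ :=
  (exists_point h).choose_spec.1

lemma form_point (h : symplecticGroup κ ℤ) : form (point h) =
    (intMat (h⁻¹ : symplecticGroup κ ℤ).1)ᵀ * 1 * intMat (h⁻¹ : symplecticGroup κ ℤ).1 :=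
  (exists_point h).choose_spec.2

/-- The inverse of `h` increases the square of the norm by a factor of at most `Λ`. -/
def InvBound (Λ : ℝ) (h : symplecticGroup κ ℤ) : Prop :=
  ∀ u, (intMat (h⁻¹ : symplecticGroup κ ℤ).1 *ᵥ u) ⬝ᵥ
    (intMat (h⁻¹ : symplecticGroup κ ℤ).1 *ᵥ u) ≤ Λ * (u ⬝ᵥ u)

lemma qf_form_point (h : symplecticGroup κ ℤ) (u : κ ⊕ κ → ℝ) : qf (form (point h)) u =
    (intMat (h⁻¹ : symplecticGroup κ ℤ).1 *ᵥ u) ⬝ᵥ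
      (intMat (h⁻¹ : symplecticGroup κ ℤ).1 *ᵥ u) := by
  rw [form_point, qf_transpose_mul_mul, qf_one]

lemma InvBound.point_mem_ball {Λ : ℝ} {h : symplecticGroup κ ℤ} (hh : InvBound Λ h) :
    point h ∈ siegelBall κ Λ :=
  ⟨point_mem h, fun u => by rw [qf_form_point]; exact hh u⟩

lemma exists_invBound (h : symplecticGroup κ ℤ) : ∃ Λ, 1 ≤ Λ ∧ InvBound Λ h := by
  obtain ⟨K, hK, hle⟩ := exists_qf_le (form (point h))
  exact ⟨K, hK, fun u => by rw [← qf_form_point]; exact hle u⟩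

lemma InvBound.mono {Λ Λ' : ℝ} {h : symplecticGroup κ ℤ} (hh : InvBound Λ h) (hΛ : Λ ≤ Λ') :
    InvBound Λ' h := fun u => (hh u).trans (mul_le_mul_of_nonneg_right hΛ (by
  rw [← qf_one]; exact qf_nonneg PosDef.one u))

lemma invBound_one {Λ : ℝ} (hΛ : 1 ≤ Λ) : InvBound Λ (1 : symplecticGroup κ ℤ) :=
  InvBound.mono (fun u => by simp) hΛ

lemma InvBound.mul {Λ Λ' : ℝ} {h h' : symplecticGroup κ ℤ} (hh : InvBound Λ h)
    (hh' : InvBound Λ' h') (hΛ' : 0 ≤ Λ') : InvBound (Λ' * Λ) (h * h') := by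
  intro u
  rw [_root_.mul_inv_rev, Submonoid.coe_mul, intMat_mul, ← mulVec_mulVec, mul_assoc]
  exact (hh' _).trans (mul_le_mul_of_nonneg_left (hh u) hΛ')

lemma frame_form_point (h : symplecticGroup κ ℤ) :
    (intMat h.1)ᵀ * form (point h) * intMat h.1 = 1 := by
  rw [form_point, Matrix.mul_one]
  have h1 := intMat_coe_inv_mul h
  calc _ = (intMat (h⁻¹ : symplecticGroup κ ℤ).1 * intMat h.1)ᵀ *
        (intMat (h⁻¹ : symplecticGroup κ ℤ).1 * intMat h.1) := by
        rw [transpose_mul]; simp only [Matrix.mul_assoc]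
    _ = 1 := by rw [h1, transpose_one, Matrix.one_mul]

lemma reduced_one {ι : Type*} [Fintype ι] [DecidableEq ι] {c : ℝ} (hc : 1 ≤ c) :
    Reduced c (1 : Matrix ι ι ℝ) :=
  (reduced_of_bounds PosDef.one le_rfl (fun u => by rw [qf_one, one_mul])
    (fun u => by rw [qf_one, one_mul])).mono (by simpa using hc)

/-- The group of integral symplectic matrices admits frames in which symplectic forms are
reduced with constant `c`. -/
def HasFrames (κ : Type*) [Fintype κ] [DecidableEq κ] (c : ℝ) : Prop :=
  1 ≤ c ∧ ∀ p ∈ siegelSpace κ, ∃ h : symplecticGroup κ ℤ,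
    Reduced c ((intMat h.1)ᵀ * form p * intMat h.1)

lemma exists_hasFrames (n : ℕ) : ∃ c, HasFrames (Fin n) c := by
  obtain ⟨c, hc, h⟩ := exists_hasReduction_fin n
  refine ⟨_, ?_, fun p hp => h.exists_reduced hc (siegelForm_form hp)⟩
  have h1 : 1 ≤ c ^ 6 := one_le_pow₀ hc
  have h2 : (1 : ℝ) ≤ (Fintype.card (Fin n) + 1) ^ 2 :=
    one_le_pow₀ (by have : (0 : ℝ) ≤ Fintype.card (Fin n) := by positivity
                    linarith)
  have h3 := one_le_mul_of_one_le_of_one_le h2 h1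
  linarith

open Classical in
/-- A choice of reduced frames that is trivial at the base point. -/
noncomputable def frame (c : ℝ) (p : Matrix κ κ ℝ × Matrix κ κ ℝ) : symplecticGroup κ ℤ :=
  if h : p ≠ point 1 ∧ ∃ h : symplecticGroup κ ℤ, Reduced c ((intMat h.1)ᵀ * form p * intMat h.1)
  then h.2.choose else 1

lemma frame_point_one (c : ℝ) : frame c (point (1 : symplecticGroup κ ℤ)) = 1 := by
  simp [frame]

lemma HasFrames.reduced_frame {c : ℝ} (hc : HasFrames κ c) {p : Matrix κ κ ℝ × Matrix κ κ ℝ}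
    (hp : p ∈ siegelSpace κ) :
    Reduced c ((intMat (frame c p).1)ᵀ * form p * intMat (frame c p).1) := by
  by_cases h1 : p = point 1
  · rw [h1, frame_point_one, frame_form_point]
    exact reduced_one hc.1
  · have h : p ≠ point 1 ∧ ∃ h : symplecticGroup κ ℤ,
        Reduced c ((intMat h.1)ᵀ * form p * intMat h.1) := ⟨h1, hc.2 p hp⟩
    rw [frame, dif_pos h]
    exact h.2.choose_spec

/-- The path of frames from the identity to `h`. -/
noncomputable def framePath (c : ℝ) (M : ℕ) (h : symplecticGroup κ ℤ) (k : ℕ) :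
    symplecticGroup κ ℤ :=
  if k < M then frame c (seg M (point 1) (point h) k) else h

variable {c c₁ A Λ : ℝ} {T : Set (symplecticGroup κ ℤ)} {M : ℕ}

/-- Frames along a segment that ends with a prescribed reduced frame. -/
lemma IsTransitionSet.segment_mem (hT : IsTransitionSet c₁ A T) (hcc : c ≤ c₁)
    (hc : HasFrames κ c) (hΛ : 1 ≤ Λ) {p q : Matrix κ κ ℝ × Matrix κ κ ℝ}
    (hp : p ∈ siegelBall κ Λ) (hq : q ∈ siegelBall κ Λ) (hM : A * Λ ^ 5 ≤ M)
    {h : symplecticGroup κ ℤ} (hh : Reduced c₁ ((intMat h.1)ᵀ * form q * intMat h.1))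
    {k : ℕ} (hk : k < M) :
    (if k < M then frame c (seg M p q k) else h)⁻¹ *
      (if k + 1 < M then frame c (seg M p q (k + 1)) else h) ∈ T := by
  refine hT hΛ hp hq hM k hk _ _ ?_ ?_
  · rw [if_pos hk]
    exact (hc.reduced_frame (seg_mem (convex_siegelBall Λ) hp hq hk.le).1).mono hcc
  · by_cases hk1 : k + 1 < M
    · rw [if_pos hk1]
      exact (hc.reduced_frame (seg_mem (convex_siegelBall Λ) hp hq hk1.le).1).mono hcc
    · rw [if_neg hk1]
      obtain rfl : k + 1 = M := by omega
      rwa [seg_self (by omega)]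

lemma IsTransitionSet.closure_eq_top (hT : IsTransitionSet c A T) (hc : HasFrames κ c) :
    Subgroup.closure T = ⊤ := by
  rw [Subgroup.eq_top_iff']
  intro h
  obtain ⟨Λ, hΛ, hh⟩ := exists_invBound h
  obtain ⟨M, hM⟩ := exists_nat_ge (A * Λ ^ 5)
  obtain ⟨M, hM, hM0⟩ : ∃ M : ℕ, A * Λ ^ 5 ≤ M ∧ 0 < M :=
    ⟨M + 1, by push_cast; linarith, by omega⟩
  have h1 := pathProd_telescope (framePath c M h) M
  have h2 : framePath c M h 0 = 1 := by
    rw [framePath, if_pos hM0, seg_zero, frame_point_one]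
  have h3 : framePath c M h M = h := by rw [framePath, if_neg (lt_irrefl M)]
  rw [h2, h3, inv_one, one_mul] at h1
  rw [← h1]
  have hmem : ∀ k < M, (framePath c M h k)⁻¹ * framePath c M h (k + 1) ∈ T := fun k hk =>
    hT.segment_mem le_rfl hc hΛ (invBound_one hΛ).point_mem_ball hh.point_mem_ball hM
      (by rw [frame_form_point]; exact reduced_one hc.1) hk
  suffices ∀ k ≤ M, pathProd (fun j => (framePath c M h j)⁻¹ * framePath c M h (j + 1)) k ∈
      Subgroup.closure T from this M le_rfl
  intro k
  induction k with
  | zero => intro _; exact Subgroup.one_mem _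
  | succ k ih =>
    intro hk
    exact Subgroup.mul_mem _ (ih (by omega)) (Subgroup.subset_closure (hmem k (by omega)))

variable {S : Type} [DecidableEq S]

/-- The word along the path of frames from the identity to `h`. -/
noncomputable def comb (ω : symplecticGroup κ ℤ → FreeGroup S) (c : ℝ) (M : ℕ)
    (h : symplecticGroup κ ℤ) : FreeGroup S :=
  pathProd (fun k => ω ((framePath c M h k)⁻¹ * framePath c M h (k + 1))) M

lemma comb_one {ω : symplecticGroup κ ℤ → FreeGroup S} (hω1 : ω 1 = 1) : comb ω c M 1 = 1 := by
  have h : ∀ k, framePath c M (1 : symplecticGroup κ ℤ) k = 1 := by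
    intro k
    rw [framePath]
    split_ifs
    · have : seg M (point (1 : symplecticGroup κ ℤ)) (point 1) k = point 1 := by
        rw [seg, ← add_smul]; simp
      rw [this, frame_point_one]
    · rfl
  refine pathProd_eq_one fun k _ => ?_
  simp [h, hω1]

/-- Combings of adjacent group elements bound a small disc. -/
lemma isFilling_comb {π : FreeGroup S →* symplecticGroup κ ℤ}
    {ω : symplecticGroup κ ℤ → FreeGroup S} (hω : ∀ g, π (ω g) = g) (hω1 : ω 1 = 1)
    {l : ℕ} (hl : ∀ g ∈ T, (ω g).norm ≤ l) {R : Set (FreeGroup S)}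
    (hR : ∀ r : FreeGroup S, π r = 1 → r.norm ≤ 4 * l → r ∈ R)
    (hT : IsTransitionSet c₁ A T) (hcc : c ≤ c₁) (hc : HasFrames κ c) (hΛ : 1 ≤ Λ)
    (hM : A * Λ ^ 5 ≤ M) (hM0 : 0 < M) {K : ℝ} (hK : 1 ≤ K) (hKc : K ^ 2 ≤ c₁) {y : FreeGroup S}
    (hy : y.norm ≤ l) (hyK : InvBound K (π y)) {h : symplecticGroup κ ℤ} (hh : InvBound Λ h)
    (hhy : InvBound Λ (h * π y)) :
    IsFilling R (M * M) (M * l) (comb ω c M h * y * (comb ω c M (h * π y))⁻¹) := by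
  set Z : ℕ → Matrix κ κ ℝ × Matrix κ κ ℝ := fun j => seg M (point h) (point (h * π y)) j with hZ
  set t : ℕ → symplecticGroup κ ℤ := fun j => if j < M then h else h * π y with ht
  set H : ℕ → ℕ → symplecticGroup κ ℤ := fun j k =>
    if k < M then frame c (seg M (point 1) (Z j) k) else t j with hH
  have hc1 : 1 ≤ c₁ := hc.1.trans hcc
  have hball : ∀ j ≤ M, Z j ∈ siegelBall κ Λ := fun j hj =>
    seg_mem (convex_siegelBall Λ) hh.point_mem_ball hhy.point_mem_ball hj
  have hbase := (invBound_one (κ := κ) hΛ).point_mem_ball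
  have htop : ∀ j ≤ M, Reduced c₁ ((intMat (t j).1)ᵀ * form (Z j) * intMat (t j).1) := by
    intro j hj
    rcases hj.lt_or_eq with hj | rfl
    · simp only [ht, if_pos hj]
      have hS : SiegelForm ((intMat h.1)ᵀ * form (Z j) * intMat h.1) :=
        (siegelForm_form (hball j hj.le).1).transpose_mul_mul (intMat_mem h.2)
      have hle : ∀ u, qf ((intMat h.1)ᵀ * form (Z j) * intMat h.1) u ≤ K * (u ⬝ᵥ u) := by
        intro u
        have hu : 0 ≤ u ⬝ᵥ u := by rw [← qf_one]; exact qf_nonneg PosDef.one u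
        have hM' : (0 : ℝ) < M := by exact_mod_cast hM0
        have hs : (0 : ℝ) ≤ j / M := by positivity
        have hs1 : (j : ℝ) / M ≤ 1 := by
          rw [div_le_one hM']; exact_mod_cast hj.le
        have h1 := qf_form_convex (point_mem h) (point_mem (h * π y))
          (sub_nonneg.2 hs1) hs (by ring) (intMat h.1 *ᵥ u)
        have h2 : qf (form (point h)) (intMat h.1 *ᵥ u) = u ⬝ᵥ u := by
          rw [qf_form_point, mulVec_mulVec, intMat_coe_inv_mul, one_mulVec]
        have h3 : qf (form (point (h * π y))) (intMat h.1 *ᵥ u) ≤ K * (u ⬝ᵥ u) := by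
          rw [qf_form_point, mulVec_mulVec, ← intMat_mul, ← Submonoid.coe_mul, _root_.mul_inv_rev,
            inv_mul_cancel_right]
          exact hyK u
        rw [h2] at h1
        rw [qf_transpose_mul_mul]
        refine h1.trans ?_
        have h4 := mul_le_mul_of_nonneg_left h3 hs
        have h5 : u ⬝ᵥ u ≤ K * (u ⬝ᵥ u) := le_mul_of_one_le_left hu hK
        have h6 := mul_le_mul_of_nonneg_left h5 (sub_nonneg.2 hs1)
        linarith
      refine (reduced_of_bounds hS.1 hK hle fun u => ?_).mono hKc
      have := hS.flip siegelForm_one (by linarith) (by simpa only [qf_one] using hle) u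
      rwa [qf_one] at this
    · simp only [ht, lt_irrefl, if_false, hZ]
      rw [seg_self hM0, frame_form_point]
      exact reduced_one hc1
  have hvert : ∀ j ≤ M, ∀ k < M, (H j k)⁻¹ * H j (k + 1) ∈ T := fun j hj k hk =>
    hT.segment_mem hcc hc hΛ hbase (hball j hj) hM (htop j hj) hk
  have hhor : ∀ j < M, ∀ k < M, (H j k)⁻¹ * H (j + 1) k ∈ T := by
    intro j hj k hk
    simp only [hH, if_pos hk]
    have hmem : ∀ i ≤ M, Reduced c₁ ((intMat (frame c (seg M (point 1) (Z i) k)).1)ᵀ *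
        form (seg M (point 1) (Z i) k) * intMat (frame c (seg M (point 1) (Z i) k)).1) :=
      fun i hi => (hc.reduced_frame
        (seg_mem (convex_siegelBall Λ) hbase (hball i hi) hk.le).1).mono hcc
    have h1 := hmem j hj.le
    have h2 := hmem (j + 1) hj
    refine hT hΛ (seg_mem (convex_siegelBall Λ) hbase hh.point_mem_ball hk.le)
      (seg_mem (convex_siegelBall Λ) hbase hhy.point_mem_ball hk.le) hM j hj _ _ ?_ ?_
    · rw [← seg_comm]; exact h1
    · rw [← seg_comm]; exact h2
  have hbot : ∀ j ≤ M, H j 0 = 1 := fun j _ => by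
    simp only [hH, if_pos hM0, seg_zero, frame_point_one]
  have hend : H M M = h * π y := by simp only [hH, ht, lt_irrefl, if_false]
  have htoph : ∀ j < M, H j M = h := fun j hj => by
    simp only [hH, ht, lt_irrefl, if_false, if_pos hj]
  have h0 : H 0 = framePath c M h := by
    funext k
    simp only [hH, ht, hZ, framePath, if_pos hM0, seg_zero]
  have hM1 : H M = framePath c M (h * π y) := by
    funext k
    simp only [hH, ht, hZ, framePath, lt_irrefl, if_false, seg_self hM0]
  have := isFilling_of_group_grid hω hω1 hM0 hl hR hy hbot htoph hend hvert hhor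
  rwa [h0, hM1] at this

/-- A word is homotopic to the combing of its endpoint. -/
lemma isFilling_mk {π : FreeGroup S →* symplecticGroup κ ℤ}
    {ω : symplecticGroup κ ℤ → FreeGroup S} (hω : ∀ g, π (ω g) = g) (hω1 : ω 1 = 1)
    {l : ℕ} (hl1 : 1 ≤ l) (hl : ∀ g ∈ T, (ω g).norm ≤ l) {R : Set (FreeGroup S)}
    (hR : ∀ r : FreeGroup S, π r = 1 → r.norm ≤ 4 * l → r ∈ R)
    (hT : IsTransitionSet c₁ A T) (hcc : c ≤ c₁) (hc : HasFrames κ c) {K : ℝ} (hK : 1 ≤ K)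
    (hKc : K ^ 2 ≤ c₁) (hyK : ∀ x, InvBound K (π (FreeGroup.mk [x]))) {n : ℕ}
    (hM : A * (K ^ n) ^ 5 ≤ M) (hM0 : 0 < M) (L : List (S × Bool)) :
    L.length ≤ n → InvBound (K ^ L.length) (π (FreeGroup.mk L)) ∧
      IsFilling R (L.length * (M * M)) (M * l)
        (FreeGroup.mk L * (comb ω c M (π (FreeGroup.mk L)))⁻¹) := by
  induction L using List.reverseRecOn with
  | nil =>
    intro _
    have h1 : FreeGroup.mk ([] : List (S × Bool)) = 1 := rfl
    rw [h1, map_one, comb_one hω1]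
    exact ⟨invBound_one (by simp), by simpa using IsFilling.one⟩
  | append_singleton L x ih =>
    intro hn
    rw [List.length_append, List.length_singleton] at hn ⊢
    obtain ⟨h1, h2⟩ := ih (by omega)
    have hmk : FreeGroup.mk (L ++ [x]) = FreeGroup.mk L * FreeGroup.mk [x] := FreeGroup.mul_mk.symm
    have hmul : InvBound (K ^ (L.length + 1)) (π (FreeGroup.mk L) * π (FreeGroup.mk [x])) := by
      have := h1.mul (hyK x) (by linarith)
      rwa [← pow_succ'] at this
    rw [hmk, map_mul]
    refine ⟨hmul, ?_⟩
    have h3 := isFilling_comb hω hω1 hl hR hT hcc hc (one_le_pow₀ hK) hM hM0 hK hKc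
      (y := FreeGroup.mk [x]) (FreeGroup.norm_mk_le.trans hl1) (hyK x)
      (h1.mono (pow_le_pow_right₀ hK (by omega))) (hmul.mono (pow_le_pow_right₀ hK hn))
    have h4 := h2.mul h3
    rw [add_mul, one_mul]
    convert h4 using 1
    group

end Combing


section Presentation

variable {S : Type} [DecidableEq S]

lemma IsFilling.exists_fin {R : Set (FreeGroup S)} {N L : ℕ} {w : FreeGroup S}
    (h : IsFilling R N L w) :
    ∃ (n : ℕ) (x r : Fin n → FreeGroup S) (ε : Fin n → ℤ), n ≤ N ∧ (∀ i, r i ∈ R) ∧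
      (∀ i, ε i = 1 ∨ ε i = -1) ∧
      w = (List.ofFn fun i => x i * r i ^ ε i * (x i)⁻¹).prod ∧ ∀ i, (x i).norm ≤ L := by
  obtain ⟨l, h1, rfl, h3⟩ := h
  refine ⟨l.length, fun i => (l.get i).1, fun i => (l.get i).2, fun _ => 1, h3,
    fun i => (h1 _ (l.get_mem i)).1, fun _ => Or.inl rfl, ?_, fun i => (h1 _ (l.get_mem i)).2⟩
  congr 1
  refine List.ext_get (by simp) fun i hi hi' => ?_
  simp

/-- A quantitative presentation of the integral symplectic group. -/
theorem exists_presentation (g : ℕ) :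
    ∃ (S : Type) (_ : Fintype S) (_ : DecidableEq S)
      (π : FreeGroup S →* Matrix.symplecticGroup (Fin g) ℤ) (R : Finset (FreeGroup S)) (D l : ℕ),
      Function.Surjective π ∧ (∀ r ∈ R, π r = 1) ∧ 1 ≤ D ∧ 1 ≤ l ∧
      ∀ w : FreeGroup S, π w = 1 → IsFilling (R : Set (FreeGroup S))
        (w.norm * (D ^ w.norm * D ^ w.norm)) (D ^ w.norm * l) w := by
  classical
  obtain ⟨c, hc⟩ := exists_hasFrames g
  obtain ⟨T₀, A₀, hT₀f, -, hT₀⟩ := exists_finite_isTransitionSet (Fin g) hc.1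
  have : Fintype T₀ := hT₀f.fintype
  set π : FreeGroup T₀ →* Matrix.symplecticGroup (Fin g) ℤ := FreeGroup.lift Subtype.val with hπ
  have hsurj : Function.Surjective π := by
    rw [hπ, FreeGroup.lift_surjective_iff_closure_range_eq_top, Subtype.range_coe]
    exact hT₀.closure_eq_top hc
  obtain ⟨K, hK, hyK⟩ : ∃ K, 1 ≤ K ∧ ∀ x, InvBound K (π (FreeGroup.mk [x])) := by
    choose Λ hΛ h using fun x : T₀ × Bool => exists_invBound (π (FreeGroup.mk [x]))
    refine ⟨1 + ∑ x, Λ x, ?_, fun x => (h x).mono ?_⟩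
    · have : 0 ≤ ∑ x, Λ x := Finset.sum_nonneg fun x _ => by linarith [hΛ x]
      linarith
    · have := Finset.single_le_sum (f := Λ) (fun x _ => by linarith [hΛ x]) (Finset.mem_univ x)
      linarith
  set c₁ := max c (K ^ 2)
  obtain ⟨T, A, hTf, hA, hT⟩ :=
    exists_finite_isTransitionSet (Fin g) (hc.1.trans (le_max_left c (K ^ 2)))
  set ω : Matrix.symplecticGroup (Fin g) ℤ → FreeGroup T₀ :=
    fun h => if h = 1 then 1 else Function.surjInv hsurj h with hω_def
  have hω : ∀ h, π (ω h) = h := by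
    intro h
    simp only [hω_def]
    split_ifs with h1
    · rw [map_one, h1]
    · exact Function.surjInv_eq hsurj h
  have hω1 : ω 1 = 1 := by simp [hω_def]
  obtain ⟨l, hl⟩ := (hTf.image fun h => (ω h).norm).bddAbove
  obtain ⟨D, hD⟩ := exists_nat_ge (A * K ^ 5)
  have hK5 : 1 ≤ K ^ 5 := one_le_pow₀ hK
  have hD1 : 1 ≤ D := by
    have h1 : (1 : ℝ) ≤ D := (one_le_mul_of_one_le_of_one_le hA hK5).trans hD
    exact_mod_cast h1
  have hRf : {r : FreeGroup T₀ | π r = 1 ∧ r.norm ≤ 4 * (l + 1)}.Finite :=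
    (finite_norm_le (4 * (l + 1))).subset fun r hr => hr.2
  refine ⟨T₀, inferInstance, inferInstance, π, hRf.toFinset, D, l + 1, hsurj,
    fun r hr => (hRf.mem_toFinset.1 hr).1, hD1, by omega, fun w hw => ?_⟩
  rw [hRf.coe_toFinset]
  rcases Nat.eq_zero_or_pos w.norm with hn | hn
  · rw [FreeGroup.norm_eq_zero.1 hn]
    exact IsFilling.one
  have hM : A * (K ^ w.norm) ^ 5 ≤ (D ^ w.norm : ℕ) := by
    push_cast
    calc A * (K ^ w.norm) ^ 5 ≤ A ^ w.norm * (K ^ w.norm) ^ 5 :=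
          mul_le_mul_of_nonneg_right (le_self_pow₀ hA hn.ne') (by positivity)
      _ = (A * K ^ 5) ^ w.norm := by rw [mul_pow, ← pow_mul, ← pow_mul, mul_comm 5]
      _ ≤ (D : ℝ) ^ w.norm := pow_le_pow_left₀ (by positivity) hD _
  have h := (isFilling_mk hω hω1 (l := l + 1) (by omega)
    (fun h hh => (hl (Set.mem_image_of_mem _ hh)).trans (by omega))
    (R := {r | π r = 1 ∧ r.norm ≤ 4 * (l + 1)}) (fun r h1 h2 => ⟨h1, h2⟩) hT (le_max_left _ _) hc
    hK (le_max_right _ _) hyK hM (by positivity) w.toWord le_rfl).2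
  rw [FreeGroup.mk_toWord, hw, comb_one hω1, inv_one, mul_one] at h
  exact h

end Presentation

end SymplecticFilling

/-- For every `g ≥ 1`, the symplectic group `Sp(2g, ℤ)` admits a
finite presentation `⟨S | R⟩` and a constant `C > 1` such that
`(n ↦ Cⁿ, n ↦ Cⁿ)` is a simultaneous (isoperimetric, isodiametric) pair: every
word `w` in the free group `F(S)` representing the identity can be written as a
product of at most `C^{ℓ(w)}` conjugates `xᵢ rᵢ^{±1} xᵢ⁻¹` with `rᵢ ∈ R` and
`ℓ(xᵢ) ≤ C^{ℓ(w)}`. -/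
theorem symplectic_exponential_iso_pair {g : ℕ} (hg : 1 ≤ g) :
    ∃ (S : Type) (instF : Fintype S) (instD : DecidableEq S)
      (π : FreeGroup S →* Matrix.symplecticGroup (Fin g) ℤ)
      (R : Finset (FreeGroup S)) (C : ℝ),
      Function.Surjective π ∧
      Subgroup.normalClosure (R : Set (FreeGroup S)) = π.ker ∧
      1 < C ∧
      ∀ w : FreeGroup S, π w = 1 →
        ∃ (N : ℕ) (x r : Fin N → FreeGroup S) (ε : Fin N → ℤ),
          (∀ i, r i ∈ R) ∧ (∀ i, ε i = 1 ∨ ε i = -1) ∧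
          w = (List.ofFn (fun i => x i * (r i) ^ (ε i) * (x i)⁻¹)).prod ∧
          (N : ℝ) ≤ C ^ (@FreeGroup.norm S instD w) ∧
          (∀ i, (@FreeGroup.norm S instD (x i) : ℝ) ≤ C ^ (@FreeGroup.norm S instD w)) := by
  obtain ⟨S, instF, instD, π, R, D, l, hπ, hR, hD, hl, h⟩ :=
    SymplecticFilling.exists_presentation g
  refine ⟨S, instF, instD, π, R, ((2 * D * D * l : ℕ) : ℝ), hπ, le_antisymm ?_ ?_, ?_, ?_⟩
  · exact Subgroup.normalClosure_le_normal fun r hr => hR r hr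
  · exact fun w hw => (h w hw).mem_normalClosure
  · have h1 : 1 ≤ D * D * l := Nat.mul_pos (Nat.mul_pos hD hD) hl
    have h2 : 1 < 2 * D * D * l := by nlinarith
    exact_mod_cast h2
  · intro w hw
    obtain ⟨N, x, r, ε, hN, hr, hε, hprod, hx⟩ := (h w hw).exists_fin
    refine ⟨N, x, r, ε, hr, hε, hprod, ?_, fun i => ?_⟩
    · have h1 : N ≤ (2 * D * D * l) ^ w.norm := by
        calc N ≤ w.norm * (D ^ w.norm * D ^ w.norm) := hN
          _ ≤ 2 ^ w.norm * (D ^ w.norm * D ^ w.norm) :=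
              Nat.mul_le_mul_right _ Nat.lt_two_pow_self.le
          _ = (2 * D * D) ^ w.norm := by rw [mul_pow, mul_pow]; ring
          _ ≤ _ := Nat.pow_le_pow_left (Nat.le_mul_of_pos_right _ hl) _
      exact_mod_cast h1
    · rcases Nat.eq_zero_or_pos w.norm with hn | hn
      · exfalso
        rw [hn, zero_mul] at hN
        exact (hN.antisymm (Nat.zero_le _) ▸ i).elim0
      · have h1 : (x i).norm ≤ (2 * D * D * l) ^ w.norm := by
          calc (x i).norm ≤ D ^ w.norm * l := hx i
            _ ≤ D ^ w.norm * l ^ w.norm := Nat.mul_le_mul_left _ (Nat.le_self_pow hn.ne' l)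
            _ = (D * l) ^ w.norm := (mul_pow _ _ _).symm
            _ ≤ _ := by
              refine Nat.pow_le_pow_left (Nat.mul_le_mul_right _ ?_) _
              exact Nat.le_mul_of_pos_left _ (by positivity)
        exact_mod_cast h1
end
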